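/- (Wu–Zhang) Let k be a field and let H be an affine noetherian Hopf algebra over k satisfying a polynomial identity. Then H has a quasi-Frobenius artinian ring of fractions; that is, the set of regular elements of H is a (left and right) Ore set and the corresponding localization of H is an artinian ring that is injective as a left and as a right module over itself. -/

import Mathlib

/-!
STATEMENT 12 (Wu–Zhang):
An affine noetherian Hopf algebra over a field `k` satisfying a polynomial identity
has a quasi-Frobenius artinian ring of fractions: the set of regular elements is a
left and right Ore set, and the corresponding ring of fractions is an artinian ring
which is injective as a left and as a right module over itself.
-/

universe u

/-- An algebra `A` over `k` satisfies a polynomial identity if there is a nonzero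
polynomial `f` in finitely many noncommuting variables, with coefficients in `k`,
which vanishes identically on `A`. -/
def SatisfiesPolynomialIdentity (k : Type u) (A : Type u) [CommSemiring k] [Ring A]
    [Algebra k A] : Prop :=
  ∃ (n : ℕ) (f : FreeAlgebra k (Fin n)), f ≠ 0 ∧
    ∀ v : Fin n → A, FreeAlgebra.lift k v f = 0

namespace WZ

section Goldie

/-- A prime ring. -/
def IsPrimeRing (R : Type*) [Ring R] : Prop :=
  Nontrivial R ∧ ∀ a b : R, (∀ r, a * r * b = 0) → a = 0 ∨ b = 0

/-- A semiprime ring. -/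
def IsSemiprimeRing (R : Type*) [Ring R] : Prop :=
  ∀ a : R, (∀ r, a * r * a = 0) → a = 0

theorem IsPrimeRing.isSemiprimeRing {R : Type*} [Ring R] (h : IsPrimeRing R) :
    IsSemiprimeRing R := fun a ha => (h.2 a a ha).elim id id

/-- The left annihilator of an element. -/
def lann {R : Type*} [Ring R] (c : R) : Ideal R where
  carrier := {y | y * c = 0}
  add_mem' {a b} ha hb := by
    change (a + b) * c = 0
    rw [add_mul, show a * c = 0 from ha, show b * c = 0 from hb, add_zero]
  zero_mem' := by simp
  smul_mem' r x hx := by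
    change r * x * c = 0
    rw [mul_assoc, show x * c = 0 from hx, mul_zero]

theorem mem_lann {R : Type*} [Ring R] {c y : R} : y ∈ lann c ↔ y * c = 0 := Iff.rfl

theorem lann_le_mul {R : Type*} [Ring R] (a b : R) : lann a ≤ lann (a * b) := by
  intro y hy
  rw [mem_lann] at *
  rw [← mul_assoc, hy, zero_mul]

/-- An essential submodule. -/
def IsEss {R M : Type*} [Ring R] [AddCommGroup M] [Module R M] (L : Submodule R M) : Prop :=
  ∀ m : M, m ≠ 0 → ∃ r : R, r • m ∈ L ∧ r • m ≠ 0

variable {R : Type*} [Ring R]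

theorem exists_maximal_of_noeth {M : Type*} [AddCommGroup M] [Module R M] [IsNoetherian R M]
    {ι : Type*} (f : ι → Submodule R M) (p : ι → Prop) (hp : ∃ i, p i) :
    ∃ i, p i ∧ ∀ j, p j → f i ≤ f j → f j = f i := by
  have h := (set_has_maximal_iff_noetherian (R := R) (M := M)).2 inferInstance
    (f '' {i | p i}) (by obtain ⟨i, hi⟩ := hp; exact ⟨f i, i, hi, rfl⟩)
  obtain ⟨_, ⟨i, hi, rfl⟩, hm⟩ := h
  refine ⟨i, hi, fun j hj hij => ?_⟩
  by_contra hne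
  exact hm (f j) ⟨j, hj, rfl⟩ (lt_of_le_of_ne hij (Ne.symm hne))

theorem isNilpotent_mul_comm' {a b : R} (h : IsNilpotent (a * b)) : IsNilpotent (b * a) := by
  obtain ⟨n, hn⟩ := h
  refine ⟨n + 1, ?_⟩
  have : (b * a) ^ (n + 1) = b * (a * b) ^ n * a := by
    clear hn
    induction n with
    | zero => simp
    | succ n ih => rw [pow_succ, ih, pow_succ]; noncomm_ring
  rw [this, hn, mul_zero, zero_mul]

theorem exists_pow_ne_zero {a : R} (h : IsNilpotent a) (ha : a ≠ 0) :
    ∃ k, a ^ (k + 1) ≠ 0 ∧ a ^ (k + 2) = 0 := by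
  classical
  by_contra! hc
  have : ∀ k, a ^ (k + 1) ≠ 0 := by
    intro k
    induction k with
    | zero => simpa using ha
    | succ k ih => exact hc k ih
  obtain ⟨n, hn⟩ := h
  exact this n (by rw [pow_succ, hn, zero_mul])

theorem IsSemiprimeRing.exists_not_isNilpotent [IsNoetherianRing R] (hR : IsSemiprimeRing R)
    {a : R} (ha : a ≠ 0) : ∃ x, ¬ IsNilpotent (x * a) := by
  by_contra! hx
  obtain ⟨c, ⟨hc0, hc⟩, hmax⟩ := exists_maximal_of_noeth (fun c : R => lann c)
    (fun c => c ≠ 0 ∧ ∀ x, IsNilpotent (x * c)) ⟨a, ha, hx⟩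
  refine hc0 (hR c fun x => ?_)
  by_cases h0 : c * x = 0
  · rw [h0, zero_mul]
  obtain ⟨k, hk1, hk2⟩ := exists_pow_ne_zero (isNilpotent_mul_comm' (hc x)) h0
  have hb : (c * x) ^ (k + 1) = c * (x * (c * x) ^ k) := by rw [pow_succ']; noncomm_ring
  have hl := hmax ((c * x) ^ (k + 1)) ⟨hk1, fun r => ?_⟩ ?_
  · have : c * x ∈ lann ((c * x) ^ (k + 1)) := by
      rw [mem_lann, ← pow_succ', hk2]
    rw [hl, mem_lann] at this
    exact this
  · rw [hb, ← mul_assoc]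
    apply isNilpotent_mul_comm'
    rw [← mul_assoc]
    exact hc _
  · show lann c ≤ lann ((c * x) ^ (k + 1))
    rw [hb]; exact lann_le_mul _ _

theorem exists_lann_sq [IsNoetherianRing R] {a : R} (h : ¬ IsNilpotent a) :
    ∃ n, lann (a ^ (n + 1)) = lann (a ^ (n + 1) * a ^ (n + 1)) ∧ a ^ (n + 1) ≠ 0 := by
  have hmono : Monotone fun n => lann (a ^ n) := by
    refine monotone_nat_of_le_succ fun n => ?_
    rw [pow_succ]; exact lann_le_mul _ _
  obtain ⟨n, hn⟩ := (monotone_stabilizes_iff_noetherian (R := R) (M := R)).2 inferInstance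
    ⟨_, hmono⟩
  refine ⟨n, ?_, fun h0 => h ⟨_, h0⟩⟩
  have h1 := hn (n + 1) (by omega)
  have h2 := hn (n + 1 + (n + 1)) (by omega)
  simp only [OrderHom.coe_mk] at h1 h2
  rw [← pow_add, ← h2, h1]

/-- The right annihilator of a subset. -/
def rannSet (L : Set R) : Ideal Rᵐᵒᵖ where
  carrier := {y | ∀ x ∈ L, x * y.unop = 0}
  add_mem' {a b} ha hb x hx := by
    rw [MulOpposite.unop_add, mul_add, ha x hx, hb x hx, add_zero]
  zero_mem' := by simp
  smul_mem' r y hy x hx := by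
    rw [smul_eq_mul, MulOpposite.unop_mul, ← mul_assoc, hy x hx, zero_mul]

theorem IsSemiprimeRing.exists_regular [IsNoetherianRing R] [IsNoetherianRing Rᵐᵒᵖ]
    (hR : IsSemiprimeRing R) (L : Ideal R) (hL : IsEss L) : ∃ c ∈ L, lann c = ⊥ := by
  have key : ∀ I : Ideal R, I ≠ ⊥ → ∃ b ∈ I, b ≠ 0 ∧ lann b = lann (b * b) := by
    intro I hI
    obtain ⟨x, hx, hx0⟩ := Submodule.exists_mem_ne_zero_of_ne_bot hI
    obtain ⟨y, hy⟩ := hR.exists_not_isNilpotent hx0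
    obtain ⟨n, hn, hn0⟩ := exists_lann_sq hy
    refine ⟨_, ?_, hn0, hn⟩
    rw [pow_succ, ← mul_assoc]
    exact I.mul_mem_left _ hx
  obtain ⟨a, ⟨haL, ha2⟩, hmax⟩ := exists_maximal_of_noeth (R := Rᵐᵒᵖ) (M := Rᵐᵒᵖ)
    (fun a : R => rannSet (lann a : Set R)) (fun a => a ∈ L ∧ lann a = lann (a * a))
    ⟨0, L.zero_mem, by simp⟩
  refine ⟨a, haL, ?_⟩
  by_contra hne
  have hLa : L ⊓ lann a ≠ ⊥ := by
    obtain ⟨y, hy, hy0⟩ := Submodule.exists_mem_ne_zero_of_ne_bot hne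
    obtain ⟨r, hr, hr0⟩ := hL y hy0
    intro h
    apply hr0
    rw [← Submodule.mem_bot R, ← h]
    exact ⟨hr, (lann a).smul_mem r hy⟩
  obtain ⟨b, ⟨hbL, hba⟩, hb0, hb2⟩ := key _ hLa
  have hba' : b * a = 0 := hba
  have e1 : ∀ y, y * (a + b) = 0 ↔ y * a = 0 ∧ y * b = 0 := by
    intro y
    constructor
    · intro h
      have h1 : y * a * a = 0 := by
        have : y * (a + b) * a = 0 := by rw [h, zero_mul]
        rw [mul_add, add_mul, mul_assoc y b a, hba', mul_zero, add_zero] at this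
        exact this
      have h2 : y * a = 0 := by
        have : y ∈ lann (a * a) := by rw [mem_lann, ← mul_assoc, h1]
        rw [← ha2] at this; exact this
      refine ⟨h2, ?_⟩
      rwa [mul_add, h2, zero_add] at h
    · rintro ⟨h1, h2⟩
      rw [mul_add, h1, h2, add_zero]
  have e2 : lann (a + b) = lann ((a + b) * (a + b)) := by
    refine le_antisymm (lann_le_mul _ _) fun y hy => ?_
    rw [mem_lann, ← mul_assoc, e1] at hy
    obtain ⟨h1, h2⟩ := hy
    have h1' : y * (a * a) = 0 := by
      have : y * (a + b) * a = y * (a * a) := by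
        rw [mul_add, add_mul, mul_assoc y b a, hba', mul_zero, add_zero, mul_assoc]
      rw [← this, h1]
    have h3 : y * a = 0 := by
      have : y ∈ lann (a * a) := h1'
      rw [← ha2] at this; exact this
    have h4 : y * (b * b) = 0 := by
      rw [mul_add, h3, zero_add, mul_assoc] at h2; exact h2
    have h5 : y * b = 0 := by
      have : y ∈ lann (b * b) := h4
      rw [← hb2] at this; exact this
    rw [mem_lann, e1]; exact ⟨h3, h5⟩
  have hle : rannSet (lann a : Set R) ≤ rannSet (lann (a + b) : Set R) := by
    intro y hy x hx
    exact hy x ((e1 x).1 hx).1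
  have heq := hmax (a + b) ⟨L.add_mem haL hbL, e2⟩ hle
  have hbmem : MulOpposite.op b ∈ rannSet (lann (a + b) : Set R) := fun x hx =>
    ((e1 x).1 hx).2
  rw [heq] at hbmem
  have hbb : b * b = 0 := hbmem b hba
  have : (1 : R) ∈ lann (b * b) := by rw [mem_lann, hbb, mul_zero]
  rw [← hb2, mem_lann, one_mul] at this
  exact hb0 this

/-- Principal left ideals of left regular elements are essential. -/
theorem isEss_of_lann_eq_bot [IsNoetherianRing R] {c : R} (hc : lann c = ⊥) (b : R)
    (hb : b ≠ 0) : ∃ r s : R, r * b = s * c ∧ r * b ≠ 0 := by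
  by_contra! hcon
  have hinj : ∀ n (y : R), y * c ^ n = 0 → y = 0 := by
    intro n
    induction n with
    | zero => simp
    | succ n ih =>
      intro y hy
      rw [pow_succ', ← mul_assoc] at hy
      have := ih _ hy
      have h2 : y ∈ lann c := this
      rwa [hc, Submodule.mem_bot] at h2
  -- the sums `∑ R b c ^ i` strictly increase
  let f : ℕ → Ideal R := fun n => Submodule.span R ((fun i => b * c ^ i) '' Set.Iio n)
  have hmono : Monotone f := fun m n h => Submodule.span_mono
    (Set.image_mono (Set.Iio_subset_Iio h))
  obtain ⟨n, hn⟩ := (monotone_stabilizes_iff_noetherian (R := R) (M := R)).2 inferInstance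
    ⟨_, hmono⟩
  have h1 : b * c ^ n ∈ f n := by
    have := hn (n + 1) (by omega)
    simp only [OrderHom.coe_mk] at this
    rw [this]
    exact Submodule.subset_span ⟨n, by simp, rfl⟩
  have h2 : ∀ x ∈ f n, ∃ g : ℕ → R, x = ∑ i ∈ Finset.range n, g i * (b * c ^ i) := by
    intro x hx
    refine Submodule.span_induction ?_ ?_ ?_ ?_ hx
    · rintro _ ⟨i, hi, rfl⟩
      refine ⟨fun j => if j = i then 1 else 0, ?_⟩
      have : i ∈ Finset.range n := by simpa using hi
      simp [this]
    · exact ⟨0, by simp⟩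
    · rintro x y _ _ ⟨g, rfl⟩ ⟨h, rfl⟩
      exact ⟨g + h, by simp [add_mul, Finset.sum_add_distrib]⟩
    · rintro a x _ ⟨g, rfl⟩
      exact ⟨fun i => a * g i, by simp [Finset.mul_sum, mul_assoc]⟩
  -- a nontrivial relation is impossible
  have h3 : ∀ n (g : ℕ → R), ∑ i ∈ Finset.range n, g i * (b * c ^ i) = 0 →
      ∀ i < n, g i * b = 0 := by
    intro n
    induction n with
    | zero => intro g _ i hi; omega
    | succ n ih =>
      intro g hg
      rw [Finset.sum_range_succ'] at hg
      have e : ∑ k ∈ Finset.range n, g (k + 1) * (b * c ^ (k + 1)) =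
          (∑ k ∈ Finset.range n, g (k + 1) * (b * c ^ k)) * c := by
        rw [Finset.sum_mul]
        refine Finset.sum_congr rfl fun k _ => ?_
        rw [pow_succ]; noncomm_ring
      rw [e, pow_zero, mul_one] at hg
      have h0 : g 0 * b = 0 := by
        refine hcon (g 0) (-(∑ k ∈ Finset.range n, g (k + 1) * (b * c ^ k))) ?_
        rw [neg_mul, eq_neg_iff_add_eq_zero, add_comm, hg]
      rw [h0, add_zero] at hg
      have h4 : (∑ k ∈ Finset.range n, g (k + 1) * (b * c ^ k)) ∈ lann c := hg
      rw [hc, Submodule.mem_bot] at h4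
      intro i hi
      cases i with
      | zero => exact h0
      | succ i => exact ih (fun k => g (k + 1)) h4 i (by omega)
  obtain ⟨g, hg⟩ := h2 _ h1
  have h4 := h3 (n + 1) (fun i => if i = n then -1 else g i) (by
    rw [Finset.sum_range_succ]
    have : ∑ x ∈ Finset.range n, (if x = n then -1 else g x) * (b * c ^ x) =
        ∑ x ∈ Finset.range n, g x * (b * c ^ x) :=
      Finset.sum_congr rfl fun x hx => by
        rw [if_neg (by simp at hx; omega)]
    rw [this, ← hg]; simp) n (by omega)
  simp at h4
  exact hb h4

theorem isEss_span_of_lann_eq_bot [IsNoetherianRing R] {c : R} (hc : lann c = ⊥) :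
    IsEss (Submodule.span R {c} : Ideal R) := by
  intro m hm
  obtain ⟨r, s, h, h0⟩ := isEss_of_lann_eq_bot hc m hm
  exact ⟨r, Submodule.mem_span_singleton.2 ⟨s, h.symm⟩, h0⟩

theorem IsEss.mono {M : Type*} [AddCommGroup M] [Module R M] {L L' : Submodule R M}
    (h : IsEss L) (hle : L ≤ L') : IsEss L' := fun m hm =>
  let ⟨r, h1, h2⟩ := h m hm
  ⟨r, hle h1, h2⟩

theorem IsSemiprimeRing.eq_zero_of_isEss [IsNoetherianRing R] (hR : IsSemiprimeRing R)
    {L : Ideal R} (hL : IsEss L) {x : R} (hx : ∀ y ∈ L, y * x = 0) : x = 0 := by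
  by_contra hx0
  have hx1 : IsEss (lann x) := hL.mono hx
  obtain ⟨z, ⟨hz0, hz⟩, hmax⟩ := exists_maximal_of_noeth (fun x : R => lann x)
    (fun x => x ≠ 0 ∧ IsEss (lann x)) ⟨x, hx0, hx1⟩
  refine hz0 (hR z fun y => ?_)
  by_cases hyz : y * z = 0
  · rw [mul_assoc, hyz, mul_zero]
  -- `lann (y * z)` is essential, so meets `R z`
  have hess : IsEss (lann (z * y)) := hz.mono (lann_le_mul z y)
  by_contra hne
  have h1 : z * y ≠ 0 := fun h => hne (by rw [h, zero_mul])
  have h2 : IsEss (lann (y * z)) := by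
    intro m hm
    by_cases hmy : m * y = 0
    · exact ⟨1, by rw [mem_lann, smul_eq_mul, one_mul, ← mul_assoc, hmy, zero_mul],
        by simpa using hm⟩
    · obtain ⟨r, hr, hr0⟩ := hz (m * y) hmy
      refine ⟨r, ?_, ?_⟩
      · rw [mem_lann] at *
        simp only [smul_eq_mul] at *
        rw [← mul_assoc, mul_assoc r m y, hr]
      · intro h
        apply hr0
        rw [smul_eq_mul] at *
        rw [← mul_assoc, h, zero_mul]
  obtain ⟨r, hr, hr0⟩ := h2 z hz0
  rw [mem_lann, smul_eq_mul] at hr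
  have h3 := hmax (z * (y * z)) ⟨by rw [← mul_assoc]; exact hne, hz.mono (lann_le_mul _ _)⟩
    (lann_le_mul _ _)
  have h4 : r ∈ lann (z * (y * z)) := by rw [mem_lann, ← mul_assoc]; exact hr
  rw [h3, mem_lann] at h4
  exact hr0 h4

theorem IsSemiprimeRing.eq_zero_of_mul_eq_zero [IsNoetherianRing R] (hR : IsSemiprimeRing R)
    {c x : R} (hc : lann c = ⊥) (h : c * x = 0) : x = 0 := by
  refine hR.eq_zero_of_isEss (isEss_span_of_lann_eq_bot hc) fun y hy => ?_
  obtain ⟨s, rfl⟩ := Submodule.mem_span_singleton.1 hy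
  rw [smul_eq_mul, mul_assoc, h, mul_zero]

theorem lann_mul_eq_bot {c d : R} (hc : lann c = ⊥) (hd : lann d = ⊥) : lann (c * d) = ⊥ := by
  rw [eq_bot_iff]
  intro y hy
  rw [mem_lann, ← mul_assoc, ← mem_lann, hd, Submodule.mem_bot, ← mem_lann, hc] at hy
  exact hy

end Goldie

section Multilinear

variable {k : Type*} [CommRing k] {ι : Type*} [DecidableEq ι]

/-- Evaluation of a multilinear noncommutative polynomial of degree `d` in the variables `s`;
`α` gives the coefficient of a monomial, read from right to left. -/
def ev {A : Type*} [Ring A] [Algebra k A] :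
    (d : ℕ) → Finset ι → (List ι → k) → (ι → A) → A
  | 0, _, α, _ => algebraMap k A (α [])
  | d + 1, s, α, x => ∑ j ∈ s, ev d (s.erase j) (fun l => α (j :: l)) x * x j

/-- Some coefficient of the multilinear polynomial is nonzero. -/
def nz : ℕ → Finset ι → (List ι → k) → Prop
  | 0, _, α => α [] ≠ 0
  | d + 1, s, α => ∃ j ∈ s, nz d (s.erase j) (fun l => α (j :: l))

variable {A : Type*} [Ring A] [Algebra k A]

theorem ev_congr (d : ℕ) (s : Finset ι) (α : List ι → k) {x y : ι → A}
    (h : ∀ i ∈ s, x i = y i) : ev d s α x = ev d s α y := by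
  induction d generalizing s α with
  | zero => rfl
  | succ d ih =>
    simp only [ev]
    refine Finset.sum_congr rfl fun j hj => ?_
    rw [ih _ _ fun i hi => h i (Finset.mem_of_mem_erase hi), h j hj]

theorem ev_zero_coeff (d : ℕ) (s : Finset ι) (x : ι → A) :
    ev d s (fun _ => (0 : k)) x = 0 := by
  induction d generalizing s with
  | zero => simp [ev]
  | succ d ih => simp [ev, ih]

theorem ev_add_coeff (d : ℕ) (s : Finset ι) (α β : List ι → k) (x : ι → A) :
    ev d s (fun l => α l + β l) x = ev d s α x + ev d s β x := by
  induction d generalizing s α β with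
  | zero => simp [ev]
  | succ d ih => simp [ev, ih, add_mul, Finset.sum_add_distrib]

theorem ev_smul_coeff (d : ℕ) (s : Finset ι) (c : k) (α : List ι → k) (x : ι → A) :
    ev d s (fun l => c * α l) x = c • ev d s α x := by
  induction d generalizing s α with
  | zero => simp [ev, Algebra.smul_def]
  | succ d ih => simp [ev, ih, Finset.smul_sum]

theorem ev_sum_coeff {κ : Type*} (d : ℕ) (s : Finset ι) (t : Finset κ) (α : κ → List ι → k)
    (x : ι → A) : ev d s (fun l => ∑ m ∈ t, α m l) x = ∑ m ∈ t, ev d s (α m) x := by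
  classical
  induction t using Finset.induction_on with
  | empty => simp [ev_zero_coeff]
  | insert a t ha ih => simp_rw [Finset.sum_insert ha, ev_add_coeff, ih]

theorem map_ev {B : Type*} [Ring B] [Algebra k B] (φ : A →ₐ[k] B) (d : ℕ) (s : Finset ι)
    (α : List ι → k) (x : ι → A) : φ (ev d s α x) = ev d s α (fun i => φ (x i)) := by
  induction d generalizing s α with
  | zero => simp [ev]
  | succ d ih => simp [ev, ih]

theorem nz_of_ne_zero {d : ℕ} {s : Finset ι} {α : List ι → k} {l : List ι} (hl : l.Nodup)
    (hs : ∀ i ∈ l, i ∈ s) (hd : l.length = d) (h : α l ≠ 0) : nz d s α := by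
  induction d generalizing s α l with
  | zero =>
    rw [List.length_eq_zero_iff] at hd
    subst hd; exact h
  | succ d ih =>
    cases l with
    | nil => simp at hd
    | cons j l =>
      rw [List.nodup_cons] at hl
      refine ⟨j, hs j (by simp), ih hl.2 (fun i hi => ?_) (by simpa using hd) h⟩
      refine Finset.mem_erase.2 ⟨fun e => hl.1 (e ▸ hi), hs i (by simp [hi])⟩

/-- A multilinear polynomial vanishing on all values in `X`. -/
def VanishesOn (d : ℕ) (s : Finset ι) (α : List ι → k) (X : Set A) : Prop :=
  ∀ x : ι → A, (∀ i, x i ∈ X) → ev d s α x = 0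

theorem VanishesOn.exists_mem (d : ℕ) (s : Finset ι) (α : List ι → k) {X : Set A}
    (h : VanishesOn d s α X) {x : ι → A} (hX : ∃ a, a ∈ X) (hx : ∀ i ∈ s, x i ∈ X) :
    ev d s α x = 0 := by
  classical
  obtain ⟨a, ha⟩ := hX
  rw [ev_congr d s α (y := fun i => if i ∈ s then x i else a) (fun i hi => by simp [hi])]
  refine h _ fun i => ?_
  split_ifs with hi
  · exact hx i hi
  · exact ha

section Span

variable {F : Type*} [CommRing F] [Algebra F A]

theorem ev_update_add (d : ℕ) (s : Finset ι) (hs : s.card = d) (α : List ι → k) (x : ι → A)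
    {i : ι} (hi : i ∈ s) (a b : A) :
    ev d s α (Function.update x i (a + b)) =
      ev d s α (Function.update x i a) + ev d s α (Function.update x i b) := by
  induction d generalizing s α with
  | zero => simp at hs; simp [hs] at hi
  | succ d ih =>
    simp only [ev]
    rw [← Finset.sum_add_distrib]
    refine Finset.sum_congr rfl fun j hj => ?_
    by_cases hij : j = i
    · subst hij
      have e : ∀ c : A, ev d (s.erase j) (fun l => α (j :: l)) (Function.update x j c) =
          ev d (s.erase j) (fun l => α (j :: l)) x := fun c => ev_congr _ _ _ fun i hi => by
        rw [Function.update_of_ne (Finset.ne_of_mem_erase hi)]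
      rw [e, e, e]
      simp [mul_add]
    · rw [ih _ (by rw [Finset.card_erase_of_mem hj, hs]; rfl) _
        (Finset.mem_erase.2 ⟨Ne.symm hij, hi⟩), add_mul]
      simp [Function.update_of_ne hij]

theorem ev_update_smul (d : ℕ) (s : Finset ι) (hs : s.card = d) (α : List ι → k) (x : ι → A)
    {i : ι} (hi : i ∈ s) (c : F) (a : A) :
    ev d s α (Function.update x i (c • a)) = c • ev d s α (Function.update x i a) := by
  induction d generalizing s α with
  | zero => simp at hs; simp [hs] at hi
  | succ d ih =>
    simp only [ev]
    rw [Finset.smul_sum]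
    refine Finset.sum_congr rfl fun j hj => ?_
    by_cases hij : j = i
    · subst hij
      have e : ∀ c : A, ev d (s.erase j) (fun l => α (j :: l)) (Function.update x j c) =
          ev d (s.erase j) (fun l => α (j :: l)) x := fun c => ev_congr _ _ _ fun i hi => by
        rw [Function.update_of_ne (Finset.ne_of_mem_erase hi)]
      rw [e, e]
      simp
    · rw [ih _ (by rw [Finset.card_erase_of_mem hj, hs]; rfl) _
        (Finset.mem_erase.2 ⟨Ne.symm hij, hi⟩)]
      simp [Function.update_of_ne hij]

theorem VanishesOn.span {d : ℕ} {s : Finset ι} (hs : s.card = d) {α : List ι → k} {X : Set A}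
    (hX : X.Nonempty) (h : VanishesOn d s α X) :
    VanishesOn d s α (Submodule.span F X : Set A) := by
  intro x hx
  have key : ∀ t : Finset ι, t ⊆ s → ∀ x : ι → A, (∀ i ∈ s, i ∉ t → x i ∈ X) →
      (∀ i, x i ∈ Submodule.span F X) → ev d s α x = 0 := by
    intro t
    induction t using Finset.induction_on with
    | empty =>
      intro _ x hx _
      exact h.exists_mem d s α hX fun i hi => hx i hi (by simp)
    | insert j t hj ih =>
      intro hts x hx hx'
      have hjs : j ∈ s := hts (Finset.mem_insert_self j t)
      have hts' : t ⊆ s := fun i hi => hts (Finset.mem_insert_of_mem hi)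
      rw [← Function.update_eq_self j x]
      refine Submodule.span_induction (p := fun a _ => ev d s α (Function.update x j a) = 0)
        ?_ ?_ ?_ ?_ (hx' j)
      · intro a ha
        refine ih hts' _ (fun i hi hit => ?_) (fun i => ?_)
        · by_cases hij : i = j
          · subst hij; simpa using ha
          · rw [Function.update_of_ne hij]
            exact hx i hi (by simp [hij, hit])
        · by_cases hij : i = j
          · subst hij; simpa using Submodule.subset_span ha
          · rw [Function.update_of_ne hij]; exact hx' i
      · have := ev_update_smul d s hs α x hjs (0 : F) (0 : A)
        simpa using this
      · intro a b _ _ ha hb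
        rw [ev_update_add d s hs α x hjs, ha, hb, add_zero]
      · intro c a _ ha
        rw [ev_update_smul d s hs α x hjs, ha, smul_zero]
  exact key s (Finset.Subset.refl s) x (fun i hi h => absurd hi h) hx

end Span

section Linearize

variable {n : ℕ} (w : ι → Fin n)

/-- The value of a word, read from right to left, at the partial sums over `T`. -/
def wordVal (y : ι → A) (T : Finset ι) : List (Fin n) → A
  | [] => 1
  | i :: m => wordVal y T m * ∑ j ∈ T with w j = i, y j

/-- The alternating sum of the word values. -/
def altSum (y : ι → A) (U : Finset ι) (m : List (Fin n)) : A :=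
  ∑ T ∈ U.powerset, (-1 : A) ^ T.card * wordVal w y T m

theorem altSum_cons (y : ι → A) (U : Finset ι) (i : Fin n) (m : List (Fin n)) :
    altSum w y U (i :: m) =
      ∑ j ∈ U with w j = i, (altSum w y U m - altSum w y (U.erase j) m) * y j := by
  have h1 : altSum w y U (i :: m) = ∑ T ∈ U.powerset, ∑ j ∈ U with w j = i,
      (if j ∈ T then (-1 : A) ^ T.card * wordVal w y T m * y j else 0) := by
    refine Finset.sum_congr rfl fun T hT => ?_
    rw [wordVal, ← mul_assoc, Finset.mul_sum, ← Finset.sum_filter, Finset.filter_filter]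
    refine Finset.sum_congr ?_ fun _ _ => rfl
    ext j
    simp only [Finset.mem_filter]
    have := Finset.mem_powerset.1 hT
    constructor
    · rintro ⟨a, b⟩; exact ⟨this a, b, a⟩
    · rintro ⟨a, b, c⟩; exact ⟨c, b⟩
  rw [h1, Finset.sum_comm]
  refine Finset.sum_congr rfl fun j hj => ?_
  have hjU : j ∈ U := (Finset.mem_filter.1 hj).1
  have h2 : altSum w y (U.erase j) m =
      ∑ T ∈ U.powerset, if j ∈ T then 0 else (-1 : A) ^ T.card * wordVal w y T m := by
    rw [altSum]
    have : (U.erase j).powerset = U.powerset.filter (fun T => ¬ j ∈ T) := by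
      ext T
      simp only [Finset.mem_powerset, Finset.mem_filter]
      constructor
      · intro h; exact ⟨h.trans (Finset.erase_subset _ _), fun hj => by simpa using h hj⟩
      · rintro ⟨a, b⟩ x hx
        exact Finset.mem_erase.2 ⟨fun e => b (e ▸ hx), a hx⟩
    rw [this, Finset.sum_filter]
    refine Finset.sum_congr rfl fun T _ => ?_
    by_cases hT : j ∈ T <;> simp [hT]
  rw [h2, altSum, ← Finset.sum_sub_distrib, Finset.sum_mul]
  refine Finset.sum_congr rfl fun T _ => ?_
  by_cases hT : j ∈ T <;> simp [hT]

theorem altSum_eq_zero (y : ι → A) (U : Finset ι) (m : List (Fin n)) (h : m.length < U.card) :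
    altSum w y U m = 0 := by
  induction m generalizing U with
  | nil =>
    simp only [altSum, wordVal, mul_one]
    have h1 : U.Nonempty := Finset.card_pos.1 (by simpa using h)
    have := Finset.sum_powerset_neg_one_pow_card_of_nonempty h1
    have h2 := congrArg (Int.cast : ℤ → A) this
    push_cast at h2
    exact h2
  | cons i m ih =>
    rw [altSum_cons]
    refine Finset.sum_eq_zero fun j hj => ?_
    have hjU : j ∈ U := (Finset.mem_filter.1 hj).1
    simp only [List.length_cons] at h
    rw [ih U (by omega), ih (U.erase j) (by rw [Finset.card_erase_of_mem hjU]; omega)]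
    simp

theorem altSum_eq_ev (y : ι → A) (U : Finset ι) (m : List (Fin n)) (h : m.length = U.card) :
    altSum w y U m = (-1) ^ U.card *
      ev (k := k) U.card U (fun l => if l.map w = m then 1 else 0) y := by
  induction m generalizing U with
  | nil =>
    have : U = ∅ := by rw [← Finset.card_eq_zero, ← h]; rfl
    subst this
    simp [altSum, wordVal, ev]
  | cons i m ih =>
    rw [altSum_cons]
    simp only [List.length_cons] at h
    rw [← h]
    simp only [ev]
    rw [Finset.mul_sum, Finset.sum_filter]
    refine Finset.sum_congr rfl fun j hj => ?_
    have hc : m.length = (U.erase j).card := by rw [Finset.card_erase_of_mem hj]; omega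
    by_cases hw : w j = i
    · rw [if_pos hw, altSum_eq_zero w y U m (by omega), ih _ hc, ← hc]
      simp only [List.map_cons, List.cons.injEq, hw, true_and]
      rw [pow_succ]; noncomm_ring
    · simp [hw, ev_zero_coeff]

end Linearize

end Multilinear

theorem prod_map_reverse_eq_wordVal {ι : Type*} [DecidableEq ι] {A : Type*} [Ring A]
    {n : ℕ} (w : ι → Fin n) (y : ι → A) (T : Finset ι) (m : List (Fin n)) :
    (m.reverse.map (fun i => ∑ j ∈ T with w j = i, y j)).prod = wordVal w y T m := by
  induction m with
  | nil => rfl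
  | cons i m ih => simp [wordVal, ← ih]

theorem exists_multilinear_identity {k A : Type u} [Field k] [Ring A] [Algebra k A]
    (h : SatisfiesPolynomialIdentity k A) : ∃ (d : ℕ) (s : Finset (Fin d)) (α : List (Fin d) → k),
      s.card = d ∧ nz d s α ∧ VanishesOn d s α (Set.univ : Set A) := by
  classical
  obtain ⟨n, f, hf, hv⟩ := h
  set g := FreeAlgebra.equivMonoidAlgebraFreeMonoid f with hg
  have hg0 : g ≠ 0 := by simpa [hg] using hf
  have hlift : ∀ v : Fin n → A, g.coeff.sum (fun m c => c • (m.toList.map v).prod) = 0 := by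
    intro v
    have e : FreeAlgebra.lift k v = (MonoidAlgebra.lift k A (FreeMonoid (Fin n))
        (FreeMonoid.lift v)).comp
        (FreeAlgebra.equivMonoidAlgebraFreeMonoid (R := k) (X := Fin n)).toAlgHom := by
      ext i; simp [FreeAlgebra.equivMonoidAlgebraFreeMonoid]
    have h1 := hv v
    rw [e] at h1
    have h2 : MonoidAlgebra.lift k A (FreeMonoid (Fin n)) (FreeMonoid.lift v) g = 0 := h1
    rw [MonoidAlgebra.lift_apply] at h2
    simpa [FreeMonoid.lift_apply] using h2
  have hsupp : g.coeff.support.Nonempty := by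
    rw [Finsupp.support_nonempty_iff]
    intro h0; apply hg0; ext m; simp [h0]
  obtain ⟨m0, hm0, hmax⟩ := g.coeff.support.exists_max_image (fun m => m.toList.length) hsupp
  set d := m0.toList.length with hd
  let w : Fin d → Fin n := fun i => m0.toList.reverse.get (i.cast (by simp [hd]))
  let t := g.coeff.support.filter (fun m => m.toList.length = d)
  refine ⟨d, Finset.univ, fun l => ∑ m ∈ t,
    g.coeff m * (if l.map w = m.toList.reverse then 1 else 0), by simp, ?_, ?_⟩
  · refine nz_of_ne_zero (l := List.finRange d) (List.nodup_finRange d) (by simp) (by simp) ?_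
    have : (List.finRange d).map w = m0.toList.reverse := by
      apply List.ext_get
      · simp [hd]
      · intro i h1 h2; simp [w]
    rw [this, Finset.sum_eq_single m0]
    · simpa using hm0
    · intro m hm hne
      rw [if_neg, mul_zero]
      intro e
      exact hne (FreeMonoid.toList.injective (List.reverse_injective e)).symm
    · intro h
      exact absurd (Finset.mem_filter.2 ⟨hm0, hd.symm⟩) h
  · intro y _
    rw [ev_sum_coeff]
    have h1 : ∑ T ∈ (Finset.univ : Finset (Fin d)).powerset, (-1 : A) ^ T.card *
        (g.coeff.sum fun m c => c • (m.toList.map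
          (fun i => ∑ j ∈ T with w j = i, y j)).prod) = 0 :=
      Finset.sum_eq_zero fun T _ => by rw [hlift, mul_zero]
    have h2 : ∑ m ∈ g.coeff.support, g.coeff m • altSum w y Finset.univ m.toList.reverse = 0 := by
      rw [← h1]
      simp only [Finsupp.sum, Finset.mul_sum, altSum, Finset.smul_sum]
      rw [Finset.sum_comm]
      refine Finset.sum_congr rfl fun T _ => Finset.sum_congr rfl fun m _ => ?_
      rw [← prod_map_reverse_eq_wordVal, List.reverse_reverse, mul_smul_comm]
    have h3 : ∑ m ∈ g.coeff.support, g.coeff m • altSum w y Finset.univ m.toList.reverse =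
        ∑ m ∈ t, g.coeff m • altSum w y Finset.univ m.toList.reverse := by
      rw [Finset.sum_filter]
      refine Finset.sum_congr rfl fun m hm => ?_
      split_ifs with hml
      · rfl
      · rw [altSum_eq_zero, smul_zero]
        have := hmax m hm
        simp only [List.length_reverse, Finset.card_univ, Fintype.card_fin]
        omega
    rw [h3] at h2
    have h4 : (-1 : A) ^ d * ∑ m ∈ t, ev d Finset.univ (fun l => g.coeff m *
        (if l.map w = m.toList.reverse then 1 else 0)) y = 0 := by
      rw [← h2, Finset.mul_sum]
      refine Finset.sum_congr rfl fun m hm => ?_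
      have hml := (Finset.mem_filter.1 hm).2
      rw [altSum_eq_ev (k := k) w y _ _ (by simp [hml]), ev_smul_coeff]
      simp
    have h5 : IsUnit ((-1 : A) ^ d) := (isUnit_one.neg).pow d
    exact (h5.mul_right_eq_zero).1 h4

section Bounded

variable {k : Type*} [Field k] {ι : Type*} [DecidableEq ι] {R : Type*} [Ring R] [Algebra k R]

/-- Essential left ideals of prime rings with a polynomial identity contain two-sided ideals. -/
theorem exists_mul_mem_of_isEss [IsNoetherianRing R] [IsNoetherianRing Rᵐᵒᵖ] (hR : IsPrimeRing R)
    (d : ℕ) (s : Finset ι) (α : List ι → k) (hs : s.card = d) (hα : nz d s α) (c : R)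
    (hc : lann c = ⊥) (hv : VanishesOn d s α {y : R | ∃ r, y = r * c}) (L : Ideal R)
    (hL : IsEss L) : ∃ b, b ≠ 0 ∧ ∀ r, b * r ∈ L := by
  have := hR.1
  induction d generalizing s α c with
  | zero =>
    exfalso
    have h := hv (fun _ => 0) (fun _ => ⟨0, by simp⟩)
    simp only [ev] at h
    exact hα ((map_eq_zero_iff _ (algebraMap k R).injective).1 h)
  | succ d ih =>
    obtain ⟨j, hj, hjα⟩ := hα
    have hcard : (s.erase j).card = d := by rw [Finset.card_erase_of_mem hj, hs]; rfl
    by_cases hcase : ∀ l : ι → R, (∀ i, l i ∈ L) →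
        ev d (s.erase j) (fun t => α (j :: t)) (fun i => l i * c) = 0
    · obtain ⟨c', hc'L, hc'⟩ := hR.isSemiprimeRing.exists_regular L hL
      refine ih (s.erase j) _ hcard hjα (c' * c) (lann_mul_eq_bot hc' hc) fun x hx => ?_
      choose r hr using hx
      have := hcase (fun i => r i * c') (fun i => L.mul_mem_left _ hc'L)
      convert this using 2
      ext i
      rw [hr, mul_assoc]
    · push Not at hcase
      obtain ⟨l, hl, hne⟩ := hcase
      refine ⟨_, hne, fun r => ?_⟩
      set x : ι → R := Function.update (fun i => l i * c) j (r * c) with hx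
      have h0 := hv x (fun i => by
        by_cases hij : i = j
        · subst hij; exact ⟨r, by simp [hx]⟩
        · exact ⟨l i, by simp [hx, hij]⟩)
      simp only [ev] at h0
      rw [← Finset.add_sum_erase _ _ hj] at h0
      have e1 : ev d (s.erase j) (fun t => α (j :: t)) x =
          ev d (s.erase j) (fun t => α (j :: t)) (fun i => l i * c) :=
        ev_congr _ _ _ fun i hi => by simp [hx, Finset.ne_of_mem_erase hi]
      have e2 : ∑ i ∈ s.erase j, ev d (s.erase i) (fun t => α (i :: t)) x * x i =
          (∑ i ∈ s.erase j, ev d (s.erase i) (fun t => α (i :: t)) x * l i) * c := by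
        rw [Finset.sum_mul]
        refine Finset.sum_congr rfl fun i hi => ?_
        have : x i = l i * c := by simp [hx, Finset.ne_of_mem_erase hi]
        rw [this, mul_assoc]
      have e3 : x j = r * c := by simp [hx]
      rw [e1, e2, e3, ← mul_assoc, ← add_mul] at h0
      have h1 : _ ∈ lann c := h0
      rw [hc, Submodule.mem_bot] at h1
      rw [eq_neg_of_add_eq_zero_left h1]
      exact L.neg_mem (L.sum_mem fun i _ => L.mul_mem_left _ (hl i))

end Bounded

section Kaplansky

theorem exists_ev_apply_ne_zero {k F M ι : Type*} [Field k] [Field F] [Algebra k F]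
    [AddCommGroup M] [Module F M] [Module k M] [IsScalarTower k F M] [DecidableEq ι]
    {𝒜 : Set (Module.End F M)}
    (hdens : ∀ (f : Module.End F M) (t : Finset M), ∃ a ∈ 𝒜, ∀ m ∈ t, f m = a m)
    (d : ℕ) (s : Finset ι) (α : List ι → k) (hα : nz d s α) (t : Finset M) (w : M)
    (hw : w ∉ Submodule.span F (t : Set M))
    (hbig : ¬ ∃ v : Finset M, v.card ≤ t.card + d ∧ Submodule.span F (v : Set M) = ⊤) :
    ∃ x : ι → Module.End F M, (∀ i, x i ∈ 𝒜) ∧ (∀ i, ∀ m ∈ t, x i m = 0) ∧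
      ev d s α x w ≠ 0 := by
  classical
  induction d generalizing s α t w with
  | zero =>
    obtain ⟨a, ha, ha'⟩ := hdens 0 t
    refine ⟨fun _ => a, fun _ => ha, fun _ m hm => (ha' m hm).symm, ?_⟩
    simp only [ev, Module.algebraMap_end_apply]
    have hw0 : w ≠ 0 := fun h => hw (h ▸ Submodule.zero_mem _)
    have h1 : α [] ≠ 0 := hα
    rw [← algebraMap_smul F (α []) w]
    intro h
    rcases smul_eq_zero.1 h with h | h
    · exact h1 ((map_eq_zero_iff _ (algebraMap k F).injective).1 h)
    · exact hw0 h
  | succ d ih =>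
    obtain ⟨j, hj, hjα⟩ := hα
    have hne : Submodule.span F ((insert w t : Finset M) : Set M) ≠ ⊤ := fun h =>
      hbig ⟨_, (Finset.card_insert_le w t).trans (by omega), h⟩
    obtain ⟨w', hw'⟩ : ∃ w', w' ∉ Submodule.span F ((insert w t : Finset M) : Set M) := by
      by_contra! h
      exact hne (by rw [eq_top_iff]; intro y _; exact h y)
    obtain ⟨x, hx, hxt, hxw⟩ := ih (s.erase j) _ hjα (insert w t) w' hw' (by
      rintro ⟨v, hv, hv'⟩
      exact hbig ⟨v, hv.trans (by have := Finset.card_insert_le w t; omega), hv'⟩)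
    obtain ⟨f, hf, hfk⟩ := Submodule.exists_le_ker_of_notMem hw
    obtain ⟨a, ha, ha'⟩ := hdens ((LinearMap.toSpanSingleton F M ((f w)⁻¹ • w')).comp f)
      (insert w t)
    have haw : a w = w' := by
      rw [← ha' w (by simp)]
      simp [smul_smul, mul_inv_cancel₀ hf]
    have hat : ∀ m ∈ t, a m = 0 := fun m hm => by
      rw [← ha' m (by simp [hm])]
      have : f m = 0 := hfk (Submodule.subset_span hm)
      simp [this]
    refine ⟨Function.update x j a, fun i => ?_, fun i m hm => ?_, ?_⟩
    · by_cases hij : i = j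
      · subst hij; simpa using ha
      · simpa [hij] using hx i
    · by_cases hij : i = j
      · subst hij; simpa using hat m hm
      · simpa [hij] using hxt i m (by simp [hm])
    · simp only [ev]
      rw [← Finset.add_sum_erase _ _ hj]
      have e1 : ev d (s.erase j) (fun l => α (j :: l)) (Function.update x j a) =
          ev d (s.erase j) (fun l => α (j :: l)) x :=
        ev_congr _ _ _ fun i hi => by simp [Finset.ne_of_mem_erase hi]
      rw [e1, LinearMap.add_apply, LinearMap.sum_apply, Finset.sum_eq_zero, add_zero]
      · simpa [haw] using hxw
      · intro i hi
        have : Function.update x j a i = x i := by simp [Finset.ne_of_mem_erase hi]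
        rw [this, Module.End.mul_apply, hxt i w (by simp), map_zero]

theorem exists_maximal_commuting (D : Type*) [Ring D] :
    ∃ S : Set D, Subring.centralizer S = (Subring.centralizer S : Subring D) ∧
      ∀ x, x ∈ Subring.centralizer S ↔ x ∈ S := by
  obtain ⟨S, hS⟩ := zorn_subset {S : Set D | ∀ a ∈ S, ∀ b ∈ S, a * b = b * a} (by
    intro c hc hchain
    refine ⟨⋃₀ c, ?_, fun s hs => Set.subset_sUnion_of_mem hs⟩
    rintro a ⟨s, hs, ha⟩ b ⟨t, ht, hb⟩
    rcases hchain.total hs ht with h | h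
    · exact hc ht a (h ha) b hb
    · exact hc hs a ha b (h hb))
  refine ⟨S, rfl, fun x => ?_⟩
  constructor
  · intro hx
    have hx' : ∀ g ∈ S, g * x = x * g := Subring.mem_centralizer_iff.1 hx
    have h1 : insert x S ∈ {S : Set D | ∀ a ∈ S, ∀ b ∈ S, a * b = b * a} := by
      rintro a (rfl | ha) b (rfl | hb)
      · rfl
      · exact (hx' b hb).symm
      · exact hx' a ha
      · exact hS.1 a ha b hb
    exact hS.2 h1 (Set.subset_insert x S) (Set.mem_insert x S)
  · intro hx
    exact Subring.mem_centralizer_iff.2 fun g hg => hS.1 g hg x hx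

theorem exists_matrix_rep_aux {k F B M : Type u} {ι : Type*} [Field k] [Field F] [Algebra k F]
    [AddCommGroup M] [Module F M] [Module k M] [IsScalarTower k F M] [DecidableEq ι]
    [Ring B] [Algebra k B] [Module B M] [IsSimpleModule B M] [SMulCommClass B F M]
    (hk : ∀ (c : k) (m : M), algebraMap k B c • m = c • m)
    (hF : ∀ g : Module.End B M, (∀ (c : F) (m : M), g (c • m) = c • g m) →
      ∃ c : F, ∀ m, g m = c • m)
    (d : ℕ) (s : Finset ι) (α : List ι → k) (hs : s.card = d) (hα : nz d s α)
    (hv : VanishesOn d s α (Set.univ : Set B)) :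
    ∃ (m : ℕ) (Φ : B →ₐ[k] Matrix (Fin m) (Fin m) F), m ≤ d ∧
      (∀ b, Φ b = 0 ↔ ∀ x : M, b • x = 0) ∧
      ∃ v : Finset M, ∀ b : B, (∀ x ∈ v, b • x = 0) → ∀ x : M, b • x = 0 := by
  classical
  let Ψ : B →ₐ[k] Module.End F M :=
    { toFun b := { toFun := fun m => b • m, map_add' := smul_add b,
                   map_smul' := fun c m => smul_comm b c m }
      map_one' := by ext; simp
      map_mul' a b := by ext; simp [mul_smul]
      map_zero' := by ext; simp
      map_add' a b := by ext; simp [add_smul]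
      commutes' c := by ext m; simp [hk] }
  have hΨ : ∀ b m, Ψ b m = b • m := fun _ _ => rfl
  let 𝒜 := Algebra.adjoin F (Set.range Ψ)
  have h𝒜 : Subalgebra.toSubmodule 𝒜 = Submodule.span F (Set.range Ψ) := by
    rw [Algebra.adjoin_eq_span_of_subset]
    have : Submonoid.closure (Set.range Ψ) = MonoidHom.mrange (Ψ : B →* Module.End F M) := by
      apply le_antisymm
      · rw [Submonoid.closure_le]; rintro _ ⟨b, rfl⟩; exact ⟨b, rfl⟩
      · rintro _ ⟨b, rfl⟩; exact Submonoid.subset_closure ⟨b, rfl⟩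
    rw [this]
    rintro _ ⟨b, rfl⟩
    exact Submodule.subset_span ⟨b, rfl⟩
  have hΨmem : ∀ b, Ψ b ∈ 𝒜 := fun b => Algebra.subset_adjoin ⟨b, rfl⟩
  have hsmul : ∀ (a : 𝒜) (m : M), a • m = (a : Module.End F M) m := fun _ _ => rfl
  have hsimple : IsSimpleModule 𝒜 M := by
    have := IsSimpleModule.nontrivial B M
    rw [isSimpleModule_iff]
    refine { eq_bot_or_eq_top := fun N => ?_ }
    let N' : Submodule B M :=
      { N.toAddSubmonoid with
        smul_mem' := fun b m hm => N.smul_mem ⟨Ψ b, hΨmem b⟩ hm }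
    rcases eq_bot_or_eq_top N' with h | h
    · left
      rw [eq_bot_iff]; intro x hx
      have : x ∈ N' := hx
      rwa [h] at this
    · right
      rw [eq_top_iff]; intro x _
      have : x ∈ N' := by rw [h]; trivial
      exact this
  have hdens : ∀ (f : Module.End F M) (t : Finset M), ∃ a ∈ (𝒜 : Set (Module.End F M)),
      ∀ m ∈ t, f m = a m := by
    intro f t
    let f' : Module.End (Module.End 𝒜 M) M :=
      { toFun := f
        map_add' := map_add f
        map_smul' := fun g m => by
          have hgB : ∀ (b : B) (m : M), g (b • m) = b • g m := fun b m =>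
            g.map_smul ⟨Ψ b, hΨmem b⟩ m
          have hgF : ∀ (c : F) (m : M), g (c • m) = c • g m := fun c m =>
            g.map_smul (algebraMap F 𝒜 c) m
          obtain ⟨c, hc⟩ := hF { toFun := g, map_add' := map_add g, map_smul' := hgB } hgF
          have hc' : ∀ m, g m = c • m := hc
          simp [hc'] }
    obtain ⟨r, hr⟩ := jacobson_density f' t
    exact ⟨r, r.2, hr⟩
  have hv𝒜 : VanishesOn d s α (𝒜 : Set (Module.End F M)) := by
    have h1 : VanishesOn d s α (Set.range Ψ) := by
      intro x hx
      choose b hb using hx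
      rw [show x = fun i => Ψ (b i) from funext fun i => (hb i).symm, ← map_ev,
        hv _ (fun _ => trivial), map_zero]
    have h2 := h1.span (F := F) hs (Set.range_nonempty _)
    rwa [← h𝒜] at h2
  obtain ⟨v, hvc, hvt⟩ : ∃ v : Finset M, v.card ≤ d ∧ Submodule.span F (v : Set M) = ⊤ := by
    by_contra hbig
    have := IsSimpleModule.nontrivial B M
    obtain ⟨w, hw⟩ := exists_ne (0 : M)
    obtain ⟨x, hx, -, hne⟩ := exists_ev_apply_ne_zero hdens d s α hα ∅ w (by simpa using hw)
      (by simpa using hbig)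
    apply hne
    rw [hv𝒜 x hx, LinearMap.zero_apply]
  have hfin : Module.Finite F M := ⟨⟨v, hvt⟩⟩
  have hrank : Module.finrank F M ≤ d := by
    have := finrank_span_finset_le_card (R := F) v
    rw [Set.finrank, hvt, finrank_top] at this
    exact this.trans hvc
  let b := Module.finBasis F M
  let e := LinearMap.toMatrixAlgEquiv b
  refine ⟨Module.finrank F M, ((e.restrictScalars k).toAlgHom).comp Ψ, hrank, fun x => ?_, v, ?_⟩
  swap
  · intro a ha x
    rw [← hΨ]
    have h1 : Submodule.span F (v : Set M) ≤ LinearMap.ker (Ψ a) :=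
      Submodule.span_le.2 fun y hy => ha y hy
    rw [hvt] at h1
    exact h1 trivial
  have : ((e.restrictScalars k).toAlgHom).comp Ψ x = e (Ψ x) := rfl
  rw [this, map_eq_zero_iff e e.injective]
  constructor
  · intro h m
    rw [← hΨ, h, LinearMap.zero_apply]
  · intro h
    ext m
    rw [hΨ, h, LinearMap.zero_apply]

/-- Simple modules over rings with a polynomial identity give representations by matrices over
fields. -/
theorem exists_matrix_rep {k B : Type u} {ι : Type*} [Field k] [Ring B] [Algebra k B]
    [DecidableEq ι] (M : Type u) [AddCommGroup M] [Module B M] [IsSimpleModule B M]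
    (d : ℕ) (s : Finset ι) (α : List ι → k) (hs : s.card = d) (hα : nz d s α)
    (hv : VanishesOn d s α (Set.univ : Set B)) :
    ∃ (F : Type u) (_ : Field F) (_ : Algebra k F) (m : ℕ)
      (Φ : B →ₐ[k] Matrix (Fin m) (Fin m) F), m ≤ d ∧
      (∀ b, Φ b = 0 ↔ ∀ x : M, b • x = 0) ∧
      ∃ v : Finset M, ∀ b : B, (∀ x ∈ v, b • x = 0) → ∀ x : M, b • x = 0 := by
  classical
  obtain ⟨S, -, hS⟩ := exists_maximal_commuting (Module.End B M)
  let K := Subring.centralizer S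
  have hcomm : ∀ x y : K, x * y = y * x := fun x y =>
    Subtype.ext (Subring.mem_centralizer_iff.1 y.2 x ((hS _).1 x.2))
  have := IsSimpleModule.nontrivial B M
  have hfield : IsField K :=
    { exists_pair_ne := ⟨0, 1, by
        intro h
        exact zero_ne_one (congrArg Subtype.val h)⟩
      mul_comm := hcomm
      mul_inv_cancel := by
        intro a ha
        have ha0 : (a : Module.End B M) ≠ 0 := fun h => ha (Subtype.ext h)
        obtain hb := LinearMap.bijective_of_ne_zero ha0
        have hu : IsUnit (a : Module.End B M) := (Module.End.isUnit_iff _).2 hb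
        obtain ⟨v, hv⟩ := hu
        refine ⟨⟨↑v⁻¹, Subring.mem_centralizer_iff.2 fun g hg => ?_⟩, Subtype.ext ?_⟩
        · have h1 : g * a = a * g := Subring.mem_centralizer_iff.1 a.2 g hg
          rw [← hv] at h1
          calc g * ↑v⁻¹ = ↑v⁻¹ * (↑v * g) * ↑v⁻¹ := by rw [Units.inv_mul_cancel_left]
            _ = ↑v⁻¹ * (g * ↑v) * ↑v⁻¹ := by rw [h1]
            _ = ↑v⁻¹ * g := by rw [mul_assoc, Units.mul_inv_cancel_right]
        · change (a : Module.End B M) * ↑v⁻¹ = 1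
          rw [← hv, Units.mul_inv] }
  let _ : Field K := hfield.toField
  let _ : Module k M := Module.compHom M (algebraMap k B)
  have hk : ∀ (c : k) (m : M), algebraMap k B c • m = c • m := fun _ _ => rfl
  let φ : k →+* K :=
    { toFun c := ⟨{ toFun := fun m => algebraMap k B c • m
                    map_add' := smul_add _
                    map_smul' := fun b m => by
                      simp [← mul_smul, Algebra.commutes] },
                  Subring.mem_centralizer_iff.2 fun g _ => by ext m; simp⟩
      map_one' := Subtype.ext (by ext m; simp)
      map_mul' a b := Subtype.ext (by
        ext m
        change algebraMap k B (a * b) • m = algebraMap k B a • algebraMap k B b • m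
        rw [map_mul, mul_smul])
      map_zero' := Subtype.ext (by ext m; simp)
      map_add' a b := Subtype.ext (by ext m; simp [add_smul]) }
  let _ : Algebra k K := φ.toAlgebra
  have : IsScalarTower k K M := by
    refine ⟨fun a b m => ?_⟩
    rw [Algebra.smul_def, mul_smul]
    rfl
  have : SMulCommClass B K M := ⟨fun b c m => ((c : Module.End B M).map_smul b m).symm⟩
  obtain ⟨m, Φ, h⟩ := exists_matrix_rep_aux (F := K) (M := M) (B := B) hk (by
    intro g hg
    refine ⟨⟨g, Subring.mem_centralizer_iff.2 fun c hc => ?_⟩, fun _ => rfl⟩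
    ext m
    exact (hg ⟨c, (hS c).2 hc⟩ m).symm) d s α hs hα hv
  exact ⟨K, inferInstance, inferInstance, m, Φ, h⟩

end Kaplansky

section FiniteDimensional

theorem finite_of_ker_le {k H V M : Type*} [Field k] [Ring H] [Algebra k H] [AddCommGroup V]
    [Module k V] [Module.Finite k V] [AddCommGroup M] [Module k M] (f : H →ₗ[k] V)
    (g : H →ₗ[k] M) (h : LinearMap.ker f ≤ LinearMap.ker g) :
    Module.Finite k (LinearMap.range g) := by
  have h1 : Module.Finite k (H ⧸ LinearMap.ker f) :=
    Module.Finite.equiv f.quotKerEquivRange.symm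
  have h2 : LinearMap.range ((LinearMap.ker f).liftQ g h) = LinearMap.range g :=
    Submodule.range_liftQ _ _ _
  rw [← h2]
  infer_instance

theorem finite_of_ker_le_annihilator {k H V M : Type*} [Field k] [Ring H] [Algebra k H]
    [AddCommGroup V] [Module k V] [Module.Finite k V] [AddCommGroup M] [Module k M] [Module H M]
    [IsScalarTower k H M] [Module.Finite H M] (f : H →ₗ[k] V)
    (h : ∀ r, f r = 0 → ∀ m : M, r • m = 0) : Module.Finite k M := by
  obtain ⟨t, ht⟩ := Module.Finite.fg_top (R := H) (M := M)
  have key : (⨆ m ∈ t, LinearMap.range ((LinearMap.toSpanSingleton H M m).restrictScalars k)) =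
      ⊤ := by
    rw [eq_top_iff]
    intro x _
    rw [Submodule.mem_iSup]
    intro N hN
    have hspan : ∀ y ∈ Submodule.span H (t : Set M), y ∈ N := by
      intro y hy
      refine Submodule.span_induction (p := fun y _ => ∀ r : H, r • y ∈ N) ?_ ?_ ?_ ?_ hy 1 |>
        fun h => by simpa using h
      · intro m hm r
        have h2 := hN m
        have h3 : LinearMap.range ((LinearMap.toSpanSingleton H M m).restrictScalars k) ≤ N :=
          (le_iSup_of_le (f := fun (_ : m ∈ t) =>
            LinearMap.range ((LinearMap.toSpanSingleton H M m).restrictScalars k)) hm le_rfl).trans h2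
        exact h3 ⟨r, rfl⟩
      · intro r; simp
      · intro a b _ _ ha hb r; rw [smul_add]; exact N.add_mem (ha r) (hb r)
      · intro a x _ hx r; rw [← mul_smul]; exact hx _
    exact hspan x (by rw [ht]; trivial)
  have h2 : (⨆ m ∈ t, LinearMap.range
      ((LinearMap.toSpanSingleton H M m).restrictScalars k)).FG := by
    refine Submodule.fg_biSup t _ fun m _ => ?_
    have := finite_of_ker_le f ((LinearMap.toSpanSingleton H M m).restrictScalars k)
      (fun r hr => h r hr m)
    exact Module.Finite.iff_fg.1 this
  rw [key] at h2
  exact ⟨h2⟩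

/-- The action of `H` on a module, as a linear map. -/
def actionMap (k H M : Type*) [Field k] [Ring H] [Algebra k H] [AddCommGroup M] [Module k M]
    [Module H M] [IsScalarTower k H M] : H →ₐ[k] Module.End k M := Algebra.lsmul k k M

theorem actionMap_eq_zero_iff {k H M : Type*} [Field k] [Ring H] [Algebra k H] [AddCommGroup M]
    [Module k M] [Module H M] [IsScalarTower k H M] (r : H) :
    actionMap k H M r = 0 ↔ ∀ m : M, r • m = 0 :=
  ⟨fun h m => congrArg (fun f => f m) h, fun h => LinearMap.ext h⟩

/-- If the module `M` is isotypic semisimple of finite length over `H`, a proper ideal containing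
the annihilator is the annihilator. -/
theorem smul_eq_zero_of_proper {H M : Type*} [Ring H] [AddCommGroup M] [Module H M]
    [IsSimpleModule H M] (v : Finset M)
    (hv : ∀ b : H, (∀ x ∈ v, b • x = 0) → ∀ x : M, b • x = 0) (I : Ideal H) [I.IsTwoSided]
    (hI : I ≠ ⊤) (hann : ∀ b : H, (∀ x : M, b • x = 0) → b ∈ I) (b : H) (hb : b ∈ I) (m : M) :
    b • m = 0 := by
  let x : v → M := fun i => i
  let N : Submodule H (v → M) := Submodule.map (LinearMap.toSpanSingleton H (v → M) x) I
  obtain ⟨C, hC⟩ := exists_isCompl N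
  have hx : x ∈ N ⊔ C := by rw [hC.sup_eq_top]; trivial
  obtain ⟨_, ⟨i, hi, rfl⟩, c, hc, hxc⟩ := Submodule.mem_sup.1 hx
  have hc' : c = (1 - i) • x := by
    exact eq_sub_of_add_eq' hxc |>.trans (by rw [sub_smul, one_smul]; rfl)
  by_cases hc0 : c = 0
  · exfalso
    apply hI
    rw [Ideal.eq_top_iff_one]
    have : 1 - i ∈ I := hann _ (hv _ fun y hy => by
      rw [hc0] at hc'
      exact (congrFun hc' ⟨y, hy⟩).symm)
    simpa using I.add_mem this hi
  · obtain ⟨l, hl⟩ := Function.ne_iff.1 hc0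
    have hIc : ∀ r ∈ I, r • c = 0 := by
      intro r hr
      rw [← Submodule.mem_bot H, ← hC.inf_eq_bot]
      refine ⟨⟨r * (1 - i), I.mul_mem_right _ hr, ?_⟩, C.smul_mem _ hc⟩
      rw [hc', ← mul_smul]; rfl
    have hspan : Submodule.span H {c l} = ⊤ := (eq_bot_or_eq_top _).resolve_left (by
      rw [Submodule.span_singleton_eq_bot]; exact hl)
    obtain ⟨h, rfl⟩ := Submodule.mem_span_singleton.1
      (show m ∈ Submodule.span H {c l} by rw [hspan]; trivial)
    rw [← mul_smul]
    exact congrFun (hIc _ (I.mul_mem_right h hb)) l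

theorem exists_algHom_finite_field (k T : Type u) [Field k] [CommRing T] [Nontrivial T]
    [Algebra k T] [Algebra.FiniteType k T] :
    ∃ (K : Type u) (_ : Field K) (_ : Algebra k K) (_ : T →ₐ[k] K), Module.Finite k K := by
  obtain ⟨𝔫, h𝔫⟩ := Ideal.exists_maximal T
  let _ : Field (T ⧸ 𝔫) := Ideal.Quotient.field 𝔫
  exact ⟨T ⧸ 𝔫, inferInstance, inferInstance, Ideal.Quotient.mkₐ k 𝔫,
    finite_of_finite_type_of_isJacobsonRing k (T ⧸ 𝔫)⟩

/-- Simple modules over affine algebras with a polynomial identity are finite-dimensional. -/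
theorem finite_of_isSimpleModule {k H : Type u} {ι : Type*} [Field k] [Ring H] [Algebra k H]
    [Algebra.FiniteType k H] [DecidableEq ι] (d : ℕ) (s : Finset ι) (α : List ι → k)
    (hs : s.card = d) (hα : nz d s α) (hv : VanishesOn d s α (Set.univ : Set H)) (M : Type u)
    [AddCommGroup M] [Module k M] [Module H M] [IsScalarTower k H M] [IsSimpleModule H M] :
    Module.Finite k M := by
  classical
  obtain ⟨F, _, _, m, Φ, -, hΦ, v, hvM⟩ := exists_matrix_rep M d s α hs hα hv
  obtain ⟨t, ht⟩ := Algebra.FiniteType.out (R := k) (A := H)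
  let E : Finset F := t.biUnion fun h => Finset.univ.image fun p : Fin m × Fin m => Φ h p.1 p.2
  let T : Subalgebra k F := Algebra.adjoin k (E : Set F)
  have hT : ∀ h i j, Φ h i j ∈ T := by
    intro h
    have hh : h ∈ Algebra.adjoin k (t : Set H) := by rw [ht]; trivial
    induction hh using Algebra.adjoin_induction with
    | mem x hx =>
      intro i j
      refine Algebra.subset_adjoin ?_
      simp only [E, Finset.coe_biUnion, Set.mem_iUnion, Finset.coe_image]
      exact ⟨x, hx, (i, j), by simp, rfl⟩
    | algebraMap r =>
      intro i j
      rw [AlgHom.commutes, Matrix.algebraMap_matrix_apply]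
      split_ifs
      · exact T.algebraMap_mem r
      · exact T.zero_mem
    | add x y _ _ hx hy =>
      intro i j; rw [map_add, Matrix.add_apply]; exact T.add_mem (hx i j) (hy i j)
    | mul x y _ _ hx hy =>
      intro i j; rw [map_mul, Matrix.mul_apply]
      exact T.sum_mem fun l _ => T.mul_mem (hx i l) (hy l j)
  have : Algebra.FiniteType k T := (Subalgebra.fg_iff_finiteType T).1 ⟨E, rfl⟩
  obtain ⟨K, _, _, π, hK⟩ := exists_algHom_finite_field k T
  have hfinM : Module.Finite k (Matrix (Fin m) (Fin m) K) := Module.Finite.matrix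
  let ΦT : H →ₐ[k] Matrix (Fin m) (Fin m) T :=
    { toFun h := Matrix.of fun i j => ⟨Φ h i j, hT h i j⟩
      map_one' := by
        ext i j
        by_cases hij : i = j
        · subst hij; simp
        · simp [Matrix.one_apply_ne hij]
      map_mul' a b := by
        ext i j
        simp [Matrix.mul_apply]
      map_zero' := by ext i j; simp
      map_add' a b := by ext i j; simp
      commutes' r := by
        ext i j
        by_cases hij : i = j
        · subst hij
          simp [Matrix.algebraMap_matrix_apply]
        · simp [Matrix.algebraMap_matrix_apply, hij] }
  let Φ' : H →ₐ[k] Matrix (Fin m) (Fin m) K := π.mapMatrix.comp ΦT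
  have hker : ∀ b, Φ b = 0 → Φ' b = 0 := by
    intro b hb
    ext i j
    change π ⟨Φ b i j, hT b i j⟩ = 0
    rw [← map_zero π]
    congr 1
    exact Subtype.ext (by simp [hb])
  have := IsSimpleModule.nontrivial H M
  have hm : Nonempty (Fin m) := by
    by_contra hm
    rw [not_nonempty_iff] at hm
    obtain ⟨x, hx⟩ := exists_ne (0 : M)
    apply hx
    rw [← one_smul H x]
    exact (hΦ 1).1 (Subsingleton.elim _ _) x
  have hproper : RingHom.ker Φ' ≠ ⊤ := fun h => by
    have h1 : (1 : H) ∈ RingHom.ker Φ' := by rw [h]; trivial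
    rw [RingHom.mem_ker, map_one] at h1
    exact one_ne_zero h1
  refine finite_of_ker_le_annihilator (H := H) Φ'.toLinearMap fun r hr x => ?_
  exact smul_eq_zero_of_proper v hvM (RingHom.ker Φ') hproper
    (fun b hb => hker b ((hΦ b).2 hb)) r hr x

end FiniteDimensional

section PrimeIdeals

/-- Prime ideals of a noncommutative ring, elementwise. -/
def IsPrimeId {A : Type*} [Ring A] (P : Ideal A) : Prop :=
  P.IsTwoSided ∧ P ≠ ⊤ ∧ ∀ a b, (∀ r, a * r * b ∈ P) → a ∈ P ∨ b ∈ P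

theorem IsPrimeId.isPrimeRing {A : Type*} [Ring A] {P : Ideal A} [P.IsTwoSided]
    (h : IsPrimeId P) : IsPrimeRing (A ⧸ P) := by
  refine ⟨Ideal.Quotient.nontrivial_iff.2 h.2.1, fun a b hab => ?_⟩
  obtain ⟨a, rfl⟩ := Ideal.Quotient.mk_surjective a
  obtain ⟨b, rfl⟩ := Ideal.Quotient.mk_surjective b
  rw [Ideal.Quotient.eq_zero_iff_mem, Ideal.Quotient.eq_zero_iff_mem]
  refine h.2.2 a b fun r => ?_
  rw [← Ideal.Quotient.eq_zero_iff_mem, map_mul, map_mul]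
  exact hab _

theorem isNoetherianRing_quotient {A : Type*} [Ring A] [IsNoetherianRing A] (P : Ideal A)
    [P.IsTwoSided] : IsNoetherianRing (A ⧸ P) :=
  isNoetherianRing_of_surjective A (A ⧸ P) (Ideal.Quotient.mk P) Ideal.Quotient.mk_surjective

theorem isNoetherianRing_op_quotient {A : Type*} [Ring A] [IsNoetherianRing Aᵐᵒᵖ] (P : Ideal A)
    [P.IsTwoSided] : IsNoetherianRing (A ⧸ P)ᵐᵒᵖ :=
  isNoetherianRing_of_surjective Aᵐᵒᵖ _ (RingHom.op (Ideal.Quotient.mk P)) fun x => by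
    obtain ⟨y, hy⟩ := Ideal.Quotient.mk_surjective x.unop
    exact ⟨MulOpposite.op y, by simp [hy]⟩

theorem exists_not_mem_mul_mem {k A : Type*} {ι : Type*} [Field k] [Ring A] [Algebra k A]
    [IsNoetherianRing A] [IsNoetherianRing Aᵐᵒᵖ] [DecidableEq ι]
    (d : ℕ) (s : Finset ι) (α : List ι → k) (hs : s.card = d) (hα : nz d s α)
    (hv : VanishesOn d s α (Set.univ : Set A)) (P : Ideal A) (hP : IsPrimeId P) (L : Ideal A)
    (hPL : P ≤ L) (hL : ∀ u, u ∉ P → ∃ r, r * u ∈ L ∧ r * u ∉ P) :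
    ∃ b, b ∉ P ∧ ∀ r, b * r ∈ L := by
  have := hP.1
  have := isNoetherianRing_quotient P
  have := isNoetherianRing_op_quotient P
  have hmem : ∀ {y}, y ∈ L.map (Ideal.Quotient.mk P) ↔ ∃ x, x ∈ L ∧ Ideal.Quotient.mk P x = y :=
    fun {y} => Ideal.mem_map_iff_of_surjective _ Ideal.Quotient.mk_surjective
  obtain ⟨b, hb0, hb⟩ := exists_mul_mem_of_isEss (k := k) hP.isPrimeRing d s α hs hα 1
    (by rw [eq_bot_iff]; intro y hy; simpa [mem_lann] using hy) (by
      intro x _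
      choose y hy using fun i => Ideal.Quotient.mk_surjective (x i)
      have h1 := map_ev (Ideal.Quotient.mkₐ k P) d s α y
      rw [hv _ fun _ => trivial, map_zero] at h1
      have h2 : x = fun i => Ideal.Quotient.mkₐ k P (y i) := funext fun i => (hy i).symm
      rw [h2, ← h1]) (L.map (Ideal.Quotient.mk P)) (by
      intro m hm
      obtain ⟨u, rfl⟩ := Ideal.Quotient.mk_surjective m
      obtain ⟨r, h1, h2⟩ := hL u (by rwa [Ne, Ideal.Quotient.eq_zero_iff_mem] at hm)
      refine ⟨Ideal.Quotient.mk P r, ?_, ?_⟩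
      · rw [smul_eq_mul, ← map_mul, hmem]; exact ⟨_, h1, rfl⟩
      · rwa [smul_eq_mul, ← map_mul, Ne, Ideal.Quotient.eq_zero_iff_mem])
  obtain ⟨b, rfl⟩ := Ideal.Quotient.mk_surjective b
  refine ⟨b, by rwa [Ne, Ideal.Quotient.eq_zero_iff_mem] at hb0, fun r => ?_⟩
  have h1 := hb (Ideal.Quotient.mk P r)
  rw [← map_mul, hmem] at h1
  obtain ⟨x, hx, hxe⟩ := h1
  rw [Ideal.Quotient.eq] at hxe
  have h2 := L.sub_mem hx (hPL hxe)
  simpa using h2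

end PrimeIdeals

section Residual

theorem le_of_isAtom_of_mem {H M : Type*} [Ring H] [AddCommGroup M] [Module H M]
    {S N : Submodule H M} (hS : IsAtom S) {x : M} (hx : x ≠ 0) (hxS : x ∈ S) (hxN : x ∈ N) :
    S ≤ N := by
  rcases (inf_le_left : S ⊓ N ≤ S).eq_or_lt with h | h
  · exact inf_eq_left.1 h
  · exfalso
    have h1 := hS.2 _ h
    apply hx
    rw [← Submodule.mem_bot H, ← h1]
    exact ⟨hxS, hxN⟩

/-- Finitely generated essential extensions of simple modules are finite-dimensional. -/
theorem finite_of_isEss_isAtom {k H : Type u} {ι : Type*} [Field k] [Ring H] [Algebra k H]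
    [Algebra.FiniteType k H] [IsNoetherianRing H] [IsNoetherianRing Hᵐᵒᵖ] [DecidableEq ι]
    (d : ℕ) (s : Finset ι) (α : List ι → k) (hs : s.card = d) (hα : nz d s α)
    (hv : VanishesOn d s α (Set.univ : Set H)) (𝔞 : Ideal H) :
    ∀ (M : Type u) [AddCommGroup M] [Module k M] [Module H M] [IsScalarTower k H M]
      [Module.Finite H M] (S : Submodule H M), IsAtom S → IsEss S →
      Module.annihilator H M = 𝔞 → Module.Finite k M := by
  classical
  induction 𝔞 using IsNoetherian.induction with
  | hgt 𝔞 ih =>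
  intro M _ _ _ _ _ S hS hess hann
  have hmem : ∀ r, r ∈ 𝔞 ↔ ∀ m : M, r • m = 0 := fun r => by
    rw [← hann, Module.mem_annihilator]
  have h2s : Ideal.IsTwoSided 𝔞 := hann ▸ inferInstance
  have hSs : IsSimpleModule H S := isSimpleModule_iff_isAtom.2 hS
  obtain ⟨y0, hy0S, hy0⟩ := Submodule.exists_mem_ne_zero_of_ne_bot hS.1
  have hsub : ∀ N : Submodule H M, S ≤ N → ∀ a, a ∉ 𝔞 → (∀ n ∈ N, a • n = 0) →
      Module.Finite k N := by
    intro N hSN a ha haN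
    have hS' : IsAtom (S.submoduleOf N) := by
      rw [← isSimpleModule_iff_isAtom]
      exact IsSimpleModule.congr (Submodule.submoduleOfEquivOfLe hSN)
    refine ih (Module.annihilator H N) (lt_of_le_of_ne ?_ ?_) N (S.submoduleOf N) hS' ?_ rfl
    · intro r hr
      rw [Module.mem_annihilator]
      intro n; exact Subtype.ext ((hmem r).1 hr n)
    · intro h
      apply ha
      rw [h, Module.mem_annihilator]
      intro n; exact Subtype.ext (haN n n.2)
    · intro m hm
      obtain ⟨r, h1, h2⟩ := hess m (fun h => hm (Subtype.ext h))
      exact ⟨r, h1, fun h => h2 (congrArg Subtype.val h)⟩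
  have hle : ∀ N : Submodule H M, N ≠ ⊥ → S ≤ N := by
    intro N hN
    obtain ⟨n, hn, hn0⟩ := Submodule.exists_mem_ne_zero_of_ne_bot hN
    obtain ⟨r, h1, h2⟩ := hess n hn0
    exact le_of_isAtom_of_mem hS h2 h1 (N.smul_mem r hn)
  by_cases hprime : ∀ a b, (∀ r, a * r * b ∈ 𝔞) → a ∈ 𝔞 ∨ b ∈ 𝔞
  · have hP : IsPrimeId 𝔞 := ⟨h2s, fun h => hy0 (by
      have := (hmem 1).1 (by rw [h]; trivial) y0
      simpa using this), hprime⟩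
    by_cases hcase : ∀ m : M, ∀ u, u ∉ 𝔞 → ∃ r, (r * u) • m = 0 ∧ r * u ∉ 𝔞
    · exfalso
      have hb : ∀ m : M, ∃ b, b ∉ 𝔞 ∧ ∀ r, (b * r) • m = 0 := fun m =>
        exists_not_mem_mul_mem d s α hs hα hv 𝔞 hP (LinearMap.ker (LinearMap.toSpanSingleton H M m))
          (fun r hr => (hmem r).1 hr m) (hcase m)
      obtain ⟨t, ht⟩ := Module.Finite.fg_top (R := H) (M := M)
      have key : ∀ t : Finset M, ∃ b, b ∉ 𝔞 ∧ ∀ m ∈ t, ∀ r, (b * r) • m = 0 := by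
        intro t
        induction t using Finset.induction_on with
        | empty => exact ⟨1, fun h => hP.2.1 ((Ideal.eq_top_iff_one _).2 h), by simp⟩
        | insert m t hm iht =>
          obtain ⟨b, hb𝔞, hbt⟩ := iht
          obtain ⟨b', hb', hbm⟩ := hb m
          obtain ⟨r, hr⟩ : ∃ r, b * r * b' ∉ 𝔞 := by
            by_contra! h
            rcases hprime b b' h with h | h
            · exact hb𝔞 h
            · exact hb' h
          refine ⟨b * r * b', hr, fun x hx q => ?_⟩
          rcases Finset.mem_insert.1 hx with rfl | hx
          · rw [mul_assoc, mul_smul, hbm, smul_zero]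
          · rw [mul_assoc, mul_assoc]
            exact hbt x hx _
      obtain ⟨b, hb𝔞, hbt⟩ := key t
      apply hb𝔞
      rw [hmem]
      intro m
      have hm : m ∈ Submodule.span H (t : Set M) := by rw [ht]; trivial
      have : ∀ r : H, (b * r) • m = 0 := by
        refine Submodule.span_induction (p := fun m _ => ∀ r : H, (b * r) • m = 0) ?_ ?_ ?_ ?_ hm
        · exact fun x hx => hbt x hx
        · simp
        · intro x y _ _ hx hy r; rw [smul_add, hx, hy, add_zero]
        · intro c x _ hx r; rw [← mul_smul, mul_assoc]; exact hx _
      simpa using this 1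
    · push Not at hcase
      obtain ⟨m, u, hu, hum⟩ := hcase
      have hSfin : Module.Finite k S := finite_of_isSimpleModule d s α hs hα hv S
      have hSu : S ≤ Submodule.span H {u • m} := hle _ (by
        rw [Ne, Submodule.span_singleton_eq_bot]
        intro h
        have := hum 1 (by rw [one_mul]; exact h)
        rw [one_mul] at this; exact hu this)
      refine finite_of_ker_le_annihilator (H := H) (actionMap k H S).toLinearMap fun r hr x => ?_
      have hr' : ∀ n : S, r • n = 0 := (actionMap_eq_zero_iff r).1 hr
      obtain ⟨h0, hh0⟩ := Submodule.mem_span_singleton.1 (hSu hy0S)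
      have hy : h0 * u ∉ 𝔞 := fun h => hy0 (by
        rw [← hh0, ← mul_smul]; exact (hmem _).1 h m)
      refine (hmem r).1 ((hprime r (h0 * u) fun q => ?_).resolve_right hy) x
      rw [← mul_assoc]
      apply hum
      have := congrArg Subtype.val (hr' ⟨(q * h0 * u) • m, by
        rw [mul_assoc, mul_smul, mul_smul, hh0]; exact S.smul_mem q hy0S⟩)
      change r • ((q * h0 * u) • m) = 0 at this
      rw [← mul_smul] at this
      rw [← this]; congr 1; noncomm_ring
  · push Not at hprime
    obtain ⟨a, b, hab, ha, hb⟩ := hprime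
    -- the submodule `b H M` and the elements killed by `b H`
    let N1 : Submodule H M := Submodule.span H (Set.range fun m : M => b • m)
    have hN1 : N1 ≠ ⊥ := by
      intro h
      apply hb
      rw [hmem]
      intro m
      have : b • m ∈ N1 := Submodule.subset_span ⟨m, rfl⟩
      rw [h] at this
      exact (Submodule.mem_bot H).1 this
    have hN1fin : Module.Finite k N1 := hsub N1 (hle _ hN1) a ha (by
      intro n hn
      have : ∀ r : H, (a * r) • n = 0 := by
        refine Submodule.span_induction (p := fun m _ => ∀ r : H, (a * r) • m = 0) ?_ ?_ ?_ ?_ hn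
        · rintro _ ⟨m, rfl⟩ r
          change (a * r) • b • m = 0
          rw [← mul_smul]
          exact (hmem _).1 (hab r) m
        · simp
        · intro x y _ _ hx hy r; rw [smul_add, hx, hy, add_zero]
        · intro c x _ hx r; rw [← mul_smul, mul_assoc]; exact hx _
      simpa using this 1)
    let N2 : Submodule H M :=
      { carrier := {m | ∀ h : H, (b * h) • m = 0}
        add_mem' := fun {x y} hx hy h => by rw [smul_add, hx, hy, add_zero]
        zero_mem' := fun h => smul_zero _
        smul_mem' := fun c x hx h => by rw [← mul_smul, mul_assoc]; exact hx _ }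
    have hN2fin : Module.Finite k N2 := by
      by_cases hN2 : N2 = ⊥
      · rw [hN2]; infer_instance
      · exact hsub N2 (hle _ hN2) b hb fun n hn => by simpa using hn 1
    have hB : Module.Finite k (LinearMap.range ((Submodule.mkQ 𝔞).comp
        (Submodule.span H (Set.range fun r : H => b * r)).subtype)) := by
      have h1 := finite_of_ker_le_annihilator (k := k) (H := H) (M := LinearMap.range
        ((Submodule.mkQ 𝔞).comp (Submodule.span H (Set.range fun r : H => b * r)).subtype))
        (actionMap k H N1).toLinearMap (by
        intro r hr
        have hr' : ∀ n : N1, r • n = 0 := (actionMap_eq_zero_iff r).1 hr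
        rintro ⟨_, ⟨x, hx⟩, rfl⟩
        refine Subtype.ext ?_
        change Submodule.mkQ 𝔞 (r * x) = 0
        rw [Submodule.mkQ_apply, Submodule.Quotient.mk_eq_zero, hmem]
        intro m
        rw [mul_smul]
        have hxm : x • m ∈ N1 := by
          refine Submodule.span_induction (p := fun x _ => x • m ∈ N1) ?_ ?_ ?_ ?_ hx
          · rintro _ ⟨q, rfl⟩
            change (b * q) • m ∈ N1
            rw [mul_smul]
            exact Submodule.subset_span ⟨q • m, rfl⟩
          · simp
          · intro x y _ _ hx hy; rw [add_smul]; exact N1.add_mem hx hy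
          · intro c x _ hx; rw [smul_eq_mul, mul_smul]; exact N1.smul_mem c hx
        exact congrArg Subtype.val (hr' ⟨_, hxm⟩))
      exact h1
    obtain ⟨t, ht⟩ := IsNoetherian.noetherian (Submodule.span H (Set.range fun r : H => b * r))
    have htmem : ∀ x ∈ t, ∀ r, x * r ∈ Submodule.span H (Set.range fun r : H => b * r) := by
      intro x hx r
      have : x ∈ Submodule.span H (Set.range fun r : H => b * r) := by
        rw [← ht]; exact Submodule.subset_span hx
      refine Submodule.span_induction
        (p := fun x _ => x * r ∈ Submodule.span H (Set.range fun r : H => b * r)) ?_ ?_ ?_ ?_ this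
      · rintro _ ⟨q, rfl⟩
        exact Submodule.subset_span ⟨q * r, by simp [mul_assoc]⟩
      · simp
      · intro x y _ _ hx hy; rw [add_mul]; exact Submodule.add_mem _ hx hy
      · intro c x _ hx
        rw [smul_eq_mul, mul_assoc]; exact Submodule.smul_mem _ c hx
    let f : H →ₗ[k] (t → LinearMap.range ((Submodule.mkQ 𝔞).comp
        (Submodule.span H (Set.range fun r : H => b * r)).subtype)) :=
      { toFun := fun r x => ⟨Submodule.mkQ 𝔞 (x * r), ⟨⟨x * r, htmem x x.2 r⟩, rfl⟩⟩
        map_add' := fun r r' => by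
          ext x; simp [mul_add]
        map_smul' := fun c r => by
          ext x
          simp }
    have hquot : Module.Finite k (M ⧸ N2) := by
      refine finite_of_ker_le_annihilator (H := H) f fun r hr m => ?_
      obtain ⟨m, rfl⟩ := N2.mkQ_surjective m
      rw [← map_smul, Submodule.mkQ_apply, Submodule.Quotient.mk_eq_zero]
      have hxr : ∀ x ∈ Submodule.span H (Set.range fun r : H => b * r), x * r ∈ 𝔞 := by
        intro x hx
        rw [← ht] at hx
        refine Submodule.span_induction (p := fun x _ => x * r ∈ 𝔞) ?_ ?_ ?_ ?_ hx
        · intro x hx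
          have := congrArg Subtype.val (congrFun hr ⟨x, hx⟩)
          exact (Submodule.Quotient.mk_eq_zero 𝔞).1 this
        · simp
        · intro x y _ _ hx hy; rw [add_mul]; exact 𝔞.add_mem hx hy
        · intro c x _ hx; rw [smul_eq_mul, mul_assoc]; exact 𝔞.smul_mem c hx
      intro h
      rw [← mul_smul]
      exact (hmem _).1 (hxr _ (Submodule.subset_span ⟨h, rfl⟩)) m
    have h1 : Module.Finite k (N2.restrictScalars k) := hN2fin
    have h2 : Module.Finite k (M ⧸ N2.restrictScalars k) := hquot
    exact Module.Finite.of_submodule_quotient (N2.restrictScalars k)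

/-- Affine noetherian algebras with a polynomial identity are residually finite-dimensional. -/
theorem exists_algHom_matrix_ne_zero {k H : Type u} {ι : Type*} [Field k] [Ring H] [Algebra k H]
    [Algebra.FiniteType k H] [IsNoetherianRing H] [IsNoetherianRing Hᵐᵒᵖ] [DecidableEq ι]
    (d : ℕ) (s : Finset ι) (α : List ι → k) (hs : s.card = d) (hα : nz d s α)
    (hv : VanishesOn d s α (Set.univ : Set H)) (x : H) (hx : x ≠ 0) :
    ∃ (n : ℕ) (ρ : H →ₐ[k] Matrix (Fin n) (Fin n) k), ρ x ≠ 0 := by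
  obtain ⟨L, hxL, hmax⟩ := exists_maximal_of_noeth (fun L : Ideal H => L) (fun L => x ∉ L)
    ⟨⊥, by simpa using hx⟩
  have hbig : ∀ N : Submodule H (H ⧸ L), N ≠ ⊥ → L.mkQ x ∈ N := by
    intro N hN
    by_contra hxN
    have h1 := hmax (N.comap L.mkQ) hxN (fun y hy => by
      rw [Submodule.mem_comap, Submodule.mkQ_apply, (Submodule.Quotient.mk_eq_zero L).2 hy]
      exact N.zero_mem)
    apply hN
    rw [eq_bot_iff]
    intro y hy
    obtain ⟨y, rfl⟩ := L.mkQ_surjective y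
    have h2 : y ∈ N.comap L.mkQ := hy
    rw [h1] at h2
    exact (Submodule.Quotient.mk_eq_zero L).2 h2
  have hx0 : L.mkQ x ≠ 0 := fun h => hxL ((Submodule.Quotient.mk_eq_zero L).1 h)
  have hfin : Module.Finite k (H ⧸ L) := by
    refine finite_of_isEss_isAtom d s α hs hα hv _ (H ⧸ L) (Submodule.span H {L.mkQ x}) ?_ ?_ rfl
    · refine ⟨by rwa [Ne, Submodule.span_singleton_eq_bot], fun N hN => ?_⟩
      by_contra hN0
      exact hN.not_ge ((Submodule.span_singleton_le_iff_mem _ _).2 (hbig N hN0))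
    · intro m hm
      obtain ⟨r, hr⟩ := Submodule.mem_span_singleton.1
        (hbig (Submodule.span H {m}) (by rwa [Ne, Submodule.span_singleton_eq_bot]))
      exact ⟨r, by rw [hr]; exact Submodule.mem_span_singleton_self _, by rwa [hr]⟩
  let b := Module.finBasis k (H ⧸ L)
  refine ⟨_, (LinearMap.toMatrixAlgEquiv b).toAlgHom.comp (actionMap k H (H ⧸ L)), fun h => ?_⟩
  have h1 : actionMap k H (H ⧸ L) x = 0 :=
    (map_eq_zero_iff _ (LinearMap.toMatrixAlgEquiv b).injective).1 h
  have h2 := (actionMap_eq_zero_iff x).1 h1 (L.mkQ 1)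
  rw [← map_smul, smul_eq_mul, mul_one] at h2
  exact hx0 h2

end Residual

section Growth

variable {k A : Type*} [Field k] [Ring A] [Algebra k A]

theorem finrank_map_le_of_ker_le {V V' V'' : Type*} [AddCommGroup V] [Module k V]
    [AddCommGroup V'] [Module k V'] [AddCommGroup V''] [Module k V''] (U : Submodule k V)
    [Module.Finite k U] (f : V →ₗ[k] V') (g : V →ₗ[k] V'')
    (h : ∀ x ∈ U, f x = 0 → g x = 0) :
    Module.finrank k (U.map g) ≤ Module.finrank k (U.map f) := by
  have hf := (f.domRestrict U).finrank_range_add_finrank_ker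
  have hg := (g.domRestrict U).finrank_range_add_finrank_ker
  have hk : LinearMap.ker (f.domRestrict U) ≤ LinearMap.ker (g.domRestrict U) :=
    fun x hx => h x x.2 hx
  have := Submodule.finrank_mono hk
  rw [LinearMap.range_domRestrict] at hf hg
  omega

/-- Dimension of the image of `W ^ n` in `A ⧸ J`. -/
noncomputable def gr (W : Submodule k A) (J : Ideal A) (n : ℕ) : ℕ :=
  Module.finrank k ((W ^ n).map (J.restrictScalars k).mkQ)

/-- The growth of `A ⧸ J` with respect to `W` is bounded by a multiple of `n ^ e`. -/
def PolyGr (W : Submodule k A) (J : Ideal A) (e : ℕ) : Prop :=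
  ∃ C, ∀ n, 1 ≤ n → gr W J n ≤ C * n ^ e

theorem finite_pow {W : Submodule k A} (hW : W.FG) (n : ℕ) :
    Module.Finite k (W ^ n : Submodule k A) :=
  Module.Finite.iff_fg.2 (hW.pow n)

theorem gr_le_of_le {W : Submodule k A} (hW : W.FG) {J J' : Ideal A} (h : J ≤ J') (n : ℕ) :
    gr W J' n ≤ gr W J n := by
  have := finite_pow hW n
  refine finrank_map_le_of_ker_le _ _ _ fun x _ hx => ?_
  rw [Submodule.mkQ_apply, Submodule.Quotient.mk_eq_zero] at hx ⊢
  exact h hx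

theorem PolyGr.of_le {W : Submodule k A} (hW : W.FG) {J J' : Ideal A} (h : J ≤ J') {e : ℕ}
    (hJ : PolyGr W J e) : PolyGr W J' e := by
  obtain ⟨C, hC⟩ := hJ
  exact ⟨C, fun n hn => (gr_le_of_le hW h n).trans (hC n hn)⟩

theorem one_le_gr {W : Submodule k A} (hW : W.FG) (h1 : (1 : A) ∈ W) {J : Ideal A} (hJ : J ≠ ⊤)
    (n : ℕ) : 1 ≤ gr W J n := by
  have := finite_pow hW n
  have hmem : (1 : A) ∈ W ^ n := by simpa using Submodule.pow_mem_pow W h1 n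
  have hne : Nontrivial ((W ^ n).map (J.restrictScalars k).mkQ) := by
    refine ⟨⟨⟨_, 1, hmem, rfl⟩, 0, fun h => hJ ?_⟩⟩
    rw [Ideal.eq_top_iff_one]
    exact (Submodule.Quotient.mk_eq_zero _).1 (congrArg Subtype.val h)
  exact Module.finrank_pos

theorem pow_le_pow_of_one_mem {W : Submodule k A} (h1 : (1 : A) ∈ W) {m n : ℕ} (h : m ≤ n) :
    W ^ m ≤ W ^ n := by
  obtain ⟨j, rfl⟩ := Nat.exists_eq_add_of_le h
  intro x hx
  rw [pow_add, ← mul_one x]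
  exact Submodule.mul_mem_mul hx (by simpa using Submodule.pow_mem_pow W h1 j)

open Pointwise in
/-- Powers of a finitely generated subspace of a commutative algebra grow polynomially. -/
theorem finrank_span_pow_le {K : Type*} [CommRing K] [Algebra k K] {q : ℕ} (u : Fin q → K)
    (n : ℕ) : Module.finrank k ((Submodule.span k (Set.range u)) ^ n : Submodule k K) ≤
      (n + 1) ^ q := by
  classical
  let g : (Fin q → Fin (n + 1)) → K := fun a => ∏ i, u i ^ (a i : ℕ)
  have hmon : ∀ m, ∀ x ∈ (Set.range u) ^ m, ∃ a : Fin q → ℕ, (∀ i, a i ≤ m) ∧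
      x = ∏ i, u i ^ a i := by
    intro m
    induction m with
    | zero =>
      intro x hx
      rw [pow_zero, Set.mem_one] at hx
      exact ⟨0, fun _ => le_rfl, by simp [hx]⟩
    | succ m ih =>
      intro x hx
      rw [pow_succ] at hx
      obtain ⟨y, hy, _, ⟨j, rfl⟩, rfl⟩ := Set.mem_mul.1 hx
      obtain ⟨a, ha, rfl⟩ := ih y hy
      refine ⟨fun i => a i + if i = j then 1 else 0, fun i => ?_, ?_⟩
      · have := ha i
        dsimp only
        split_ifs <;> omega
      · simp_rw [pow_add, Finset.prod_mul_distrib]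
        congr 1
        simp
  rw [Submodule.span_pow]
  have hle : Submodule.span k (Set.range u ^ n) ≤ Submodule.span k (Set.range g) := by
    refine Submodule.span_mono fun x hx => ?_
    obtain ⟨a, ha, rfl⟩ := hmon n x hx
    exact ⟨fun i => ⟨a i, Nat.lt_succ_of_le (ha i)⟩, rfl⟩
  have hfin : Module.Finite k (Submodule.span k (Set.range g)) :=
    Module.Finite.span_of_finite k (Set.finite_range g)
  refine (Submodule.finrank_mono hle).trans ((finrank_range_le_card g).trans ?_)
  simp

/-- Growth of algebras with a faithful multiplicative map to matrices over a commutative ring. -/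
theorem exists_finrank_pow_le {K : Type*} [CommRing K] [Algebra k K] {d : ℕ}
    (Ψ : A →ₗ[k] Matrix (Fin d) (Fin d) K) (hmul : ∀ a b, Ψ (a * b) = Ψ a * Ψ b)
    {W : Submodule k A} (hW : W.FG) :
    ∃ q : ℕ, ∀ n, 1 ≤ n → Module.finrank k ((W ^ n).map Ψ) ≤ d ^ 2 * (n + 1) ^ q := by
  classical
  obtain ⟨t, rfl⟩ := hW
  let T := (Finset.univ ×ˢ Finset.univ ×ˢ t).image fun p : Fin d × Fin d × A => Ψ p.2.2 p.1 p.2.1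
  obtain ⟨q, u, hu⟩ : ∃ (q : ℕ) (u : Fin q → K), Set.range u = (T : Set K) :=
    ⟨T.card, fun i => (T.equivFin.symm i : K), by
      rw [Set.range_comp' Subtype.val, T.equivFin.symm.surjective.range_eq, Set.image_univ,
        Subtype.range_coe]⟩
  refine ⟨q, fun n hn => ?_⟩
  set U := Submodule.span k (Set.range u) with hU
  have hUfg : U.FG := Submodule.fg_span (Set.finite_range u)
  have h1 : ∀ a ∈ Submodule.span k (t : Set A), ∀ i j, Ψ a i j ∈ U := by
    intro a ha i j
    induction ha using Submodule.span_induction with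
    | mem a ha =>
      refine Submodule.subset_span ?_
      rw [hu]
      exact Finset.mem_coe.2 (Finset.mem_image.2 ⟨(i, j, a), by simpa using ha, rfl⟩)
    | zero => simp
    | add x y _ _ hx hy => rw [map_add]; exact U.add_mem hx hy
    | smul c x _ hx => rw [map_smul]; exact U.smul_mem c hx
  have h2 : ∀ m, ∀ a ∈ (Submodule.span k (t : Set A)) ^ (m + 1), ∀ i j, Ψ a i j ∈ U ^ (m + 1) := by
    intro m
    induction m with
    | zero => simpa using h1
    | succ m ih =>
      intro a ha i j
      rw [pow_succ] at ha
      refine Submodule.mul_induction_on (C := fun a => Ψ a i j ∈ U ^ (m + 1 + 1)) ha ?_ ?_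
      · intro x hx y hy
        rw [hmul, Matrix.mul_apply, pow_succ]
        exact Submodule.sum_mem _ fun l _ => Submodule.mul_mem_mul (ih x hx i l) (h1 y hy l j)
      · intro x y hx hy
        rw [map_add]; exact Submodule.add_mem _ hx hy
  obtain ⟨m, rfl⟩ := Nat.exists_eq_succ_of_ne_zero (Nat.one_le_iff_ne_zero.1 hn)
  have hUfin := finite_pow hUfg (m + 1)
  let E : ((Submodule.span k (t : Set A)) ^ (m + 1)).map Ψ →ₗ[k]
      (Fin d → Fin d → (U ^ (m + 1) : Submodule k K)) :=
    { toFun := fun x i j => ⟨x.1 i j, by obtain ⟨_, a, ha, rfl⟩ := x; exact h2 m a ha i j⟩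
      map_add' := fun _ _ => rfl
      map_smul' := fun _ _ => rfl }
  have hE : Function.Injective E := by
    rintro ⟨x, hx⟩ ⟨y, hy⟩ h
    refine Subtype.ext (Matrix.ext fun i j => ?_)
    exact congrArg Subtype.val (congrFun (congrFun h i) j)
  refine (LinearMap.finrank_le_finrank_of_injective hE).trans ?_
  rw [Module.finrank_pi_fintype]
  simp only [Module.finrank_pi_fintype, Finset.sum_const, Finset.card_univ, Fintype.card_fin,
    smul_eq_mul]
  rw [← mul_assoc, ← sq]
  exact Nat.mul_le_mul_left _ (finrank_span_pow_le u _)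

end Growth

section PrimeGrowth

open Polynomial in
theorem VanishesOn.polynomial {k R ι : Type*} [Field k] [Ring R] [Algebra k R] [DecidableEq ι]
    {d : ℕ} {s : Finset ι} {α : List ι → k} (hs : s.card = d)
    (hv : VanishesOn d s α (Set.univ : Set R)) : VanishesOn d s α (Set.univ : Set R[X]) := by
  have h1 : VanishesOn d s α (Set.range (C : R →+* R[X])) := by
    intro x hx
    choose y hy using hx
    have h2 : x = fun i => (Polynomial.CAlgHom (R := k) (A := R)) (y i) :=
      funext fun i => (hy i).symm
    rw [h2, ← map_ev, hv y fun _ => trivial, map_zero]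
  have h2 := VanishesOn.span (F := Subring.center R[X]) hs (Set.range_nonempty _) h1
  have hX : (X : R[X]) ∈ Subring.center R[X] := Subring.mem_center_iff.2 fun p => X_mul.symm
  have htop : ∀ p : R[X],
      p ∈ Submodule.span (Subring.center R[X]) (Set.range (C : R →+* R[X])) := by
    intro p
    rw [p.as_sum_support_C_mul_X_pow]
    refine Submodule.sum_mem _ fun i _ => ?_
    have : C (p.coeff i) * X ^ i = ((⟨X, hX⟩ : Subring.center R[X]) ^ i) • C (p.coeff i) := by
      rw [Algebra.smul_def, map_pow, ← X_pow_mul]; rfl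
    rw [this]
    exact Submodule.smul_mem _ _ (Submodule.subset_span ⟨_, rfl⟩)
  exact fun x _ => h2 x fun i => htop _

/-- Pad a matrix by zeros to a larger size. -/
theorem exists_pad {k F : Type*} [Field k] [CommRing F] [Algebra k F] {m d : ℕ} (h : m ≤ d) :
    ∃ p : Matrix (Fin m) (Fin m) F →ₗ[k] Matrix (Fin d) (Fin d) F,
      (∀ M N, p (M * N) = p M * p N) ∧ ∀ M, p M = 0 → M = 0 := by
  classical
  let P : Matrix (Fin m) (Fin d) F := (1 : Matrix (Fin d) (Fin d) F).submatrix (Fin.castLE h) id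
  have hP : P * P.transpose = 1 := by
    change (1 : Matrix (Fin d) (Fin d) F).submatrix (Fin.castLE h) id *
      ((1 : Matrix (Fin d) (Fin d) F).submatrix (Fin.castLE h) id).transpose = 1
    rw [Matrix.transpose_submatrix, ← Matrix.submatrix_mul _ _ _ _ _ Function.bijective_id]
    rw [Matrix.transpose_one, mul_one]
    exact Matrix.submatrix_one _ (Fin.castLE_injective h)
  refine ⟨{ toFun := fun M => P.transpose * M * P
            map_add' := fun M N => by rw [Matrix.mul_add, Matrix.add_mul]
            map_smul' := fun c M => by simp }, fun M N => ?_, fun M hM => ?_⟩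
  · change P.transpose * (M * N) * P = P.transpose * M * P * (P.transpose * N * P)
    rw [Matrix.mul_assoc (P.transpose * M), Matrix.mul_assoc P.transpose N,
      ← Matrix.mul_assoc P P.transpose, hP, Matrix.one_mul]
    simp only [Matrix.mul_assoc]
  · have h1 : P * (P.transpose * M * P) * P.transpose = M := by
      rw [Matrix.mul_assoc, Matrix.mul_assoc, hP, Matrix.mul_one, ← Matrix.mul_assoc, hP,
        Matrix.one_mul]
    rw [← h1, show P.transpose * M * P = 0 from hM]
    simp

open Polynomial in
theorem IsSemiprimeRing.exists_matrix_ne_zero {k R : Type u} {ι : Type*} [Field k] [Ring R]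
    [Algebra k R] [IsNoetherianRing R] [DecidableEq ι] (hR : IsSemiprimeRing R)
    (d : ℕ) (s : Finset ι) (α : List ι → k) (hs : s.card = d) (hα : nz d s α)
    (hv : VanishesOn d s α (Set.univ : Set R)) (r : R) (hr : r ≠ 0) :
    ∃ (F : Type u) (_ : CommRing F) (_ : Algebra k F) (Ψ : R →ₗ[k] Matrix (Fin d) (Fin d) F),
      (∀ a b, Ψ (a * b) = Ψ a * Ψ b) ∧ Ψ r ≠ 0 := by
  obtain ⟨x, hx⟩ := hR.exists_not_isNilpotent hr
  have hne : Ideal.span {(1 : R[X]) - C (x * r) * X} ≠ ⊤ := by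
    intro h
    rw [Ideal.eq_top_iff_one, Ideal.mem_span_singleton'] at h
    obtain ⟨g, hg⟩ := h
    rw [mul_sub, mul_one, ← mul_assoc] at hg
    have h0 : ∀ i, g.coeff i = (x * r) ^ i := by
      intro i
      induction i with
      | zero => simpa using congrArg (fun p => p.coeff 0) hg
      | succ i ih =>
        have := congrArg (fun p => p.coeff (i + 1)) hg
        simp only [coeff_sub, coeff_mul_X, coeff_mul_C, coeff_one, ih] at this
        rw [pow_succ]
        simpa [sub_eq_zero] using this
    refine hx ⟨g.natDegree + 1, ?_⟩
    rw [← h0]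
    exact coeff_eq_zero_of_natDegree_lt (Nat.lt_succ_self _)
  obtain ⟨𝔪, h𝔪, hle⟩ := Ideal.exists_le_maximal _ hne
  have hgen : (1 : R[X]) - C (x * r) * X ∈ 𝔪 := hle (Ideal.mem_span_singleton_self _)
  have hr𝔪 : C r ∉ 𝔪 := by
    intro h
    refine h𝔪.ne_top ((Ideal.eq_top_iff_one _).2 ?_)
    have h1 : C (x * r) * X ∈ 𝔪 := by
      rw [← X_mul, C_mul, ← mul_assoc]
      exact 𝔪.mul_mem_left _ h
    simpa using 𝔪.add_mem hgen h1
  have hsimple : IsSimpleModule R[X] (R[X] ⧸ 𝔪) := isSimpleModule_iff_isCoatom.2 h𝔪.out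
  obtain ⟨F, iF, iA, m, Φ, hmd, hΦ, -⟩ := exists_matrix_rep (k := k) (R[X] ⧸ 𝔪) d s α hs hα
    (hv.polynomial hs)
  obtain ⟨p, hp1, hp2⟩ := exists_pad (k := k) (F := F) hmd
  refine ⟨F, inferInstance, iA, p ∘ₗ Φ.toLinearMap ∘ₗ (CAlgHom (R := k) (A := R)).toLinearMap,
    fun a b => ?_, fun h => ?_⟩
  · change p (Φ (C (a * b))) = p (Φ (C a)) * p (Φ (C b))
    rw [C_mul, map_mul, hp1]
  · have h1 := (hΦ _).1 (hp2 _ h) (Submodule.Quotient.mk 1)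
    rw [← Submodule.Quotient.mk_smul, Submodule.Quotient.mk_eq_zero, smul_eq_mul, mul_one] at h1
    exact hr𝔪 h1

theorem map_pow_mkQ {k A : Type*} [Field k] [Ring A] [Algebra k A] (W : Submodule k A)
    (J : Ideal A) [J.IsTwoSided] (n : ℕ) :
    (W.map (Ideal.Quotient.mkₐ k J).toLinearMap) ^ n =
      (W ^ n).map (Ideal.Quotient.mkₐ k J).toLinearMap :=
  (Submodule.map_pow W (Ideal.Quotient.mkₐ k J) n).symm

/-- Affine prime noetherian algebras with a polynomial identity have polynomial growth. -/
theorem IsPrimeId.exists_polyGr {k A : Type u} {ι : Type*} [Field k] [Ring A]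
    [Algebra k A] [IsNoetherianRing A] [DecidableEq ι]
    (d : ℕ) (s : Finset ι) (α : List ι → k) (hs : s.card = d) (hα : nz d s α)
    (hv : VanishesOn d s α (Set.univ : Set A)) {W : Submodule k A} (hW : W.FG) {P : Ideal A}
    (hP : IsPrimeId P) : ∃ e, PolyGr W P e := by
  have := hP.1
  have := isNoetherianRing_quotient P
  have hv' : VanishesOn d s α (Set.univ : Set (A ⧸ P)) := by
    intro x _
    choose y hy using fun i => Ideal.Quotient.mkₐ_surjective k P (x i)
    rw [← funext hy, ← map_ev, hv y fun _ => trivial, map_zero]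
  choose F iF iA Ψ hΨ hne using fun r : {r : A ⧸ P // r ≠ 0} =>
    hP.isPrimeRing.isSemiprimeRing.exists_matrix_ne_zero d s α hs hα hv' r.1 r.2
  let Φ : (A ⧸ P) →ₗ[k] Matrix (Fin d) (Fin d) (∀ r, F r) :=
    { toFun := fun a => Matrix.of fun i j r => Ψ r a i j
      map_add' := fun a b => by ext; simp
      map_smul' := fun c a => by ext; simp }
  have hmul : ∀ a b, Φ (a * b) = Φ a * Φ b := by
    intro a b
    ext i j r
    change Ψ r (a * b) i j = (Φ a * Φ b) i j r
    rw [hΨ, Matrix.mul_apply, Matrix.mul_apply, Finset.sum_apply]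
    rfl
  have hker : ∀ a, Φ a = 0 → a = 0 := by
    intro a ha
    by_contra h
    refine hne ⟨a, h⟩ (Matrix.ext fun i j => ?_)
    exact congrFun (congrFun (congrFun ha i) j) ⟨a, h⟩
  obtain ⟨q, hq⟩ := exists_finrank_pow_le Φ hmul (hW.map (Ideal.Quotient.mkₐ k P).toLinearMap)
  refine ⟨q, d ^ 2 * 2 ^ q, fun n hn => ?_⟩
  have hfin := finite_pow hW n
  have h1 := hq n hn
  rw [map_pow_mkQ, ← Submodule.map_comp] at h1
  calc gr W P n ≤ _ := finrank_map_le_of_ker_le (W ^ n)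
        (Φ ∘ₗ (Ideal.Quotient.mkₐ k P).toLinearMap) (P.restrictScalars k).mkQ fun x _ hx => by
          have h2 := hker _ hx
          exact h2
    _ ≤ _ := h1
    _ ≤ d ^ 2 * (2 * n) ^ q := Nat.mul_le_mul_left _ (Nat.pow_le_pow_left (by omega) _)
    _ = _ := by rw [mul_pow]; ring

end PrimeGrowth

section Bond

variable {k A : Type*} [Field k] [Ring A] [Algebra k A]

open MulOpposite in
/-- Comparison of growths along a bimodule. -/
theorem exists_gr_le_of_bond {B : Type*} [AddCommGroup B] [Module k B] [Module A B]
    [IsScalarTower k A B] [Module Aᵐᵒᵖ B] [SMulCommClass A Aᵐᵒᵖ B] [IsScalarTower k Aᵐᵒᵖ B]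
    {W : Submodule k A} (hW : W.FG) (h1 : (1 : A) ∈ W) (hgen : ∀ a, ∃ n, a ∈ W ^ n)
    (P P' : Ideal A) (Z : Submodule A B) (hZ : ∀ (r : A), ∀ z ∈ Z, op r • z ∈ Z)
    {m : ℕ} (b : Fin m → B) (hb : ∀ i (r : A), op r • b i ∈ Submodule.span A (Set.range b) ⊔ Z)
    (hP' : ∀ a ∈ P', ∀ i, a • b i ∈ Z) (hP : ∀ r, (∀ i, op r • b i ∈ Z) → r ∈ P) :
    ∃ p : ℕ, ∀ n, gr W P n ≤ m ^ 2 * gr W P' (p * n) := by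
  classical
  have hb' : ∀ (r : A) i, ∃ a : Fin m → A, op r • b i - ∑ j, a j • b j ∈ Z := by
    intro r i
    obtain ⟨y, hy, z, hz, hyz⟩ := Submodule.mem_sup.1 (hb i r)
    obtain ⟨a, rfl⟩ := (Submodule.mem_span_range_iff_exists_fun A).1 hy
    exact ⟨a, by rw [← hyz, add_sub_cancel_left]; exact hz⟩
  choose a ha using hb'
  choose N hN using hgen
  obtain ⟨t, ht⟩ := hW
  let p := t.sup fun w => Finset.univ.sup fun i => Finset.univ.sup fun j => N (a w i j)
  have hp : ∀ w ∈ t, ∀ i j, a w i j ∈ W ^ p := by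
    intro w hw i j
    refine pow_le_pow_of_one_mem h1 ?_ (hN (a w i j))
    calc N (a w i j) ≤ Finset.univ.sup fun j => N (a w i j) :=
          Finset.le_sup (f := fun j => N (a w i j)) (Finset.mem_univ j)
      _ ≤ Finset.univ.sup fun i => Finset.univ.sup fun j => N (a w i j) :=
          Finset.le_sup (f := fun i => Finset.univ.sup fun j => N (a w i j)) (Finset.mem_univ i)
      _ ≤ p := Finset.le_sup
          (f := fun w => Finset.univ.sup fun i => Finset.univ.sup fun j => N (a w i j)) hw
  have hlin : ∀ (V : Submodule k A) (i : Fin m) (r r' : A),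
      (∃ c : Fin m → A, (∀ j, c j ∈ V) ∧ op r • b i - ∑ j, c j • b j ∈ Z) →
      (∃ c : Fin m → A, (∀ j, c j ∈ V) ∧ op r' • b i - ∑ j, c j • b j ∈ Z) →
      ∃ c : Fin m → A, (∀ j, c j ∈ V) ∧ op (r + r') • b i - ∑ j, c j • b j ∈ Z := by
    rintro V i r r' ⟨c, hc, hcz⟩ ⟨c', hc', hcz'⟩
    refine ⟨c + c', fun j => V.add_mem (hc j) (hc' j), ?_⟩
    have := Z.add_mem hcz hcz'
    simp only [Pi.add_apply, add_smul, Finset.sum_add_distrib, op_add]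
    convert this using 1
    abel
  have hW1 : ∀ w ∈ W, ∀ i, ∃ c : Fin m → A, (∀ j, c j ∈ W ^ p) ∧
      op w • b i - ∑ j, c j • b j ∈ Z := by
    intro w hw i
    rw [← ht] at hw
    induction hw using Submodule.span_induction with
    | mem w hw => exact ⟨a w i, hp w hw i, ha w i⟩
    | zero => exact ⟨0, fun _ => Submodule.zero_mem _, by simp⟩
    | add x y _ _ hx hy => exact hlin _ _ _ _ hx hy
    | smul c x _ hx =>
      obtain ⟨e, he, hez⟩ := hx
      refine ⟨fun j => c • e j, fun j => Submodule.smul_mem _ c (he j), ?_⟩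
      have := (Z.restrictScalars k).smul_mem c hez
      rw [smul_sub, Finset.smul_sum] at this
      simpa [op_smul, smul_assoc] using this
  have hWn : ∀ n, ∀ r ∈ W ^ n, ∀ i, ∃ c : Fin m → A, (∀ j, c j ∈ W ^ (p * n)) ∧
      op r • b i - ∑ j, c j • b j ∈ Z := by
    intro n
    induction n with
    | zero =>
      intro r hr i
      refine ⟨Pi.single i r, fun j => ?_, ?_⟩
      · by_cases h : j = i
        · subst h; simpa using hr
        · simp [Pi.single_eq_of_ne h]
      · rw [pow_zero, Submodule.mem_one] at hr
        obtain ⟨y, rfl⟩ := hr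
        have : op (algebraMap k A y) • b i = algebraMap k A y • b i := by
          rw [Algebra.algebraMap_eq_smul_one, op_smul, smul_assoc, smul_assoc, op_one, one_smul,
            one_smul]
        rw [Finset.sum_eq_single i (fun j _ hj => by simp [Pi.single_eq_of_ne hj]) (by simp),
          Pi.single_eq_same, this, sub_self]
        exact Z.zero_mem
    | succ n ih =>
      intro r hr
      rw [pow_succ'] at hr
      refine Submodule.mul_induction_on (C := fun r => ∀ i, ∃ c : Fin m → A,
        (∀ j, c j ∈ W ^ (p * (n + 1))) ∧ op r • b i - ∑ j, c j • b j ∈ Z) hr ?_ ?_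
      · intro w hw u hu i
        obtain ⟨c, hc, hcz⟩ := hW1 w hw i
        choose e he hez using ih u hu
        refine ⟨fun l => ∑ j, c j * e j l, fun l => Submodule.sum_mem _ fun j _ => ?_, ?_⟩
        · rw [mul_add, mul_one, add_comm, pow_add]
          exact Submodule.mul_mem_mul (hc j) (he j l)
        · have h2 := Z.add_mem (hZ u _ hcz)
            (Submodule.sum_mem Z (t := Finset.univ) fun j _ => Z.smul_mem (c j) (hez j))
          convert h2 using 1
          rw [op_mul, mul_smul, smul_sub, Finset.smul_sum]
          simp only [smul_sub, Finset.sum_sub_distrib, Finset.smul_sum, Finset.sum_smul, mul_smul]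
          rw [Finset.sum_comm]
          have hcomm : ∀ (c : A) (x : B), op u • c • x = c • op u • x :=
            fun c x => (smul_comm _ _ _).symm
          simp only [hcomm]
          abel
      · intro x y hx hy i
        exact hlin _ _ _ _ (hx i) (hy i)
  refine ⟨p, fun n => ?_⟩
  have hWFG : W.FG := ⟨t, ht⟩
  have hfn := finite_pow hWFG n
  have hfp := finite_pow hWFG (p * n)
  let Zk := Z.restrictScalars k
  let g : Fin m → A →ₗ[k] B ⧸ Zk := fun j =>
    Zk.mkQ ∘ₗ (LinearMap.toSpanSingleton A B (b j)).restrictScalars k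
  have hg : ∀ j x, g j x = Zk.mkQ (x • b j) := fun j x => rfl
  let g' : Fin m → (A ⧸ P'.restrictScalars k) →ₗ[k] B ⧸ Zk := fun j =>
    (P'.restrictScalars k).liftQ (g j) fun x hx => by
      rw [LinearMap.mem_ker, hg, Submodule.mkQ_apply, Submodule.Quotient.mk_eq_zero]
      exact hP' x hx j
  let V := (W ^ (p * n)).map (P'.restrictScalars k).mkQ
  let S : (Fin m → V) →ₗ[k] B ⧸ Zk :=
    ∑ j, (g' j ∘ₗ V.subtype) ∘ₗ LinearMap.proj j
  have hS : Module.finrank k (LinearMap.range S) ≤ m * gr W P' (p * n) := by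
    refine (LinearMap.finrank_range_le S).trans ?_
    rw [Module.finrank_pi_fintype]
    simp [gr, V]
  let G : A →ₗ[k] (Fin m → B ⧸ Zk) := LinearMap.pi fun i =>
    { toFun := fun r => Zk.mkQ (op r • b i)
      map_add' := fun x y => by rw [op_add, add_smul, map_add]
      map_smul' := fun c x => by rw [op_smul, smul_assoc, map_smul]; rfl }
  have hG : ∀ r i, G r i = Zk.mkQ (op r • b i) := fun r i => rfl
  let E : (W ^ n).map G →ₗ[k] (Fin m → LinearMap.range S) :=
    { toFun := fun x i => ⟨x.1 i, by
        obtain ⟨_, r, hr, rfl⟩ := x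
        obtain ⟨c, hc, hcz⟩ := hWn n r hr i
        refine ⟨fun j => ⟨_, Submodule.mem_map_of_mem (hc j)⟩, ?_⟩
        have h2 : Zk.mkQ (op r • b i) = Zk.mkQ (∑ j, c j • b j) := by
          rw [← sub_eq_zero, ← map_sub, Submodule.mkQ_apply, Submodule.Quotient.mk_eq_zero]
          exact hcz
        change S _ = G r i
        rw [hG, h2, map_sum, LinearMap.sum_apply]
        rfl⟩
      map_add' := fun _ _ => rfl
      map_smul' := fun _ _ => rfl }
  have hE : Function.Injective E := by
    intro x y h
    refine Subtype.ext (funext fun i => ?_)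
    exact congrArg Subtype.val (congrFun h i)
  calc gr W P n ≤ Module.finrank k ((W ^ n).map G) :=
        finrank_map_le_of_ker_le _ _ _ fun x _ hx => by
          rw [Submodule.mkQ_apply, Submodule.Quotient.mk_eq_zero]
          refine hP x fun i => ?_
          have := congrFun hx i
          rw [hG, Pi.zero_apply, Submodule.mkQ_apply, Submodule.Quotient.mk_eq_zero] at this
          exact this
    _ ≤ _ := LinearMap.finrank_le_finrank_of_injective hE
    _ = m * Module.finrank k (LinearMap.range S) := by rw [Module.finrank_pi_fintype]; simp
    _ ≤ m * (m * gr W P' (p * n)) := Nat.mul_le_mul_left _ hS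
    _ = _ := by ring

theorem PolyGr.of_gr_le {W : Submodule k A} {P P' : Ideal A} {m p : ℕ}
    (hW : W.FG) (h1 : (1 : A) ∈ W) (h : ∀ n, gr W P n ≤ m * gr W P' (p * n)) {e : ℕ}
    (hP' : PolyGr W P' e) : PolyGr W P e := by
  obtain ⟨C, hC⟩ := hP'
  refine ⟨m * (C * (p + 1) ^ e), fun n hn => (h n).trans ?_⟩
  have h2 : gr W P' (p * n) ≤ gr W P' ((p + 1) * n) := by
    have := finite_pow hW ((p + 1) * n)
    exact Submodule.finrank_mono
      (Submodule.map_mono (pow_le_pow_of_one_mem h1 (Nat.mul_le_mul_right _ (Nat.le_succ p))))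
  calc m * gr W P' (p * n) ≤ m * (C * ((p + 1) * n) ^ e) :=
        Nat.mul_le_mul_left _ (h2.trans (hC _ (Nat.mul_pos (Nat.succ_pos p) hn)))
    _ = _ := by rw [mul_pow]; ring

end Bond

section Drop

variable {k A : Type*} [Field k] [Ring A] [Algebra k A]

theorem IsPrimeId.exists_regular_mem [IsNoetherianRing A] [IsNoetherianRing Aᵐᵒᵖ] {P I : Ideal A}
    (hP : IsPrimeId P) (hI : I.IsTwoSided) {a : A} (haI : a ∈ I) (haP : a ∉ P) :
    ∃ c ∈ I, ∀ x, x * c ∈ P → x ∈ P := by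
  have := hP.1
  have := isNoetherianRing_quotient P
  have := isNoetherianRing_op_quotient P
  obtain ⟨c, hc, hc0⟩ := hP.isPrimeRing.isSemiprimeRing.exists_regular
    (I.map (Ideal.Quotient.mk P)) (by
      intro u hu
      obtain ⟨u, rfl⟩ := Ideal.Quotient.mk_surjective u
      rw [Ne, Ideal.Quotient.eq_zero_iff_mem] at hu
      by_contra! hcon
      rcases hP.2.2 a u fun r => by
        have h1 := hcon (Ideal.Quotient.mk P (a * r)) (by
          rw [smul_eq_mul, ← map_mul]
          exact Ideal.mem_map_of_mem _ (I.mul_mem_right _ (I.mul_mem_right _ haI)))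
        rwa [smul_eq_mul, ← map_mul, Ideal.Quotient.eq_zero_iff_mem] at h1 with h | h
      · exact haP h
      · exact hu h)
  obtain ⟨c, hcI, rfl⟩ := (Ideal.mem_map_iff_of_surjective _ Ideal.Quotient.mk_surjective).1 hc
  refine ⟨c, hcI, fun x hx => ?_⟩
  rw [← Ideal.Quotient.eq_zero_iff_mem] at hx ⊢
  rw [← Ideal.mem_bot, ← hc0, mem_lann, ← map_mul, hx]

theorem sum_mul_pow_mem {P P' : Ideal A} [P.IsTwoSided] [P'.IsTwoSided] {c : A} (hcP' : c ∈ P')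
    (hPP' : P ≤ P') (hc : ∀ x, x * c ∈ P → x ∈ P) (V : Submodule k A)
    (hV : ∀ v ∈ V, v ∈ P' → v = 0) : ∀ (n : ℕ) (v : ℕ → A), (∀ i, v i ∈ V) →
      ∑ i ∈ Finset.range n, v i * c ^ i ∈ P → ∀ i < n, v i = 0 := by
  intro n
  induction n with
  | zero => intro v _ _ i hi; omega
  | succ n ih =>
    intro v hv hsum
    rw [Finset.sum_range_succ'] at hsum
    have hfac : ∑ i ∈ Finset.range n, v (i + 1) * c ^ (i + 1) =
        (∑ i ∈ Finset.range n, v (i + 1) * c ^ i) * c := by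
      rw [Finset.sum_mul]
      exact Finset.sum_congr rfl fun i _ => by rw [pow_succ, mul_assoc]
    have h0 : v 0 = 0 := by
      refine hV _ (hv 0) ?_
      have h1 := hPP' hsum
      rw [hfac, pow_zero, mul_one] at h1
      exact (Submodule.add_mem_iff_right _ (P'.mul_mem_left _ hcP')).1 h1
    rw [h0, zero_mul, add_zero, hfac] at hsum
    have h2 := ih (fun i => v (i + 1)) (fun i => hv _) (hc _ hsum)
    intro i hi
    cases i with
    | zero => exact h0
    | succ i => exact h2 i (by omega)

theorem exists_mul_gr_le [IsNoetherianRing A] [IsNoetherianRing Aᵐᵒᵖ]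
    {W : Submodule k A} (hW : W.FG) (h1 : (1 : A) ∈ W) (hgen : ∀ a, ∃ n, a ∈ W ^ n)
    {P P' : Ideal A} (hP : IsPrimeId P) (hP' : IsPrimeId P') (hlt : P < P') :
    ∃ q : ℕ, ∀ n, (n + 1) * gr W P' n ≤ gr W P ((q + 1) * n) := by
  have := hP.1
  have := hP'.1
  obtain ⟨a, haP', haP⟩ := SetLike.exists_of_lt hlt
  obtain ⟨c, hcP', hc⟩ := hP.exists_regular_mem hP'.1 haP' haP
  obtain ⟨q, hq⟩ := hgen c
  refine ⟨q, fun n => ?_⟩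
  have hfn := finite_pow hW n
  have hfq := finite_pow hW ((q + 1) * n)
  obtain ⟨V, hVcompl⟩ := Submodule.exists_isCompl
    (LinearMap.ker ((P'.restrictScalars k).mkQ.domRestrict (W ^ n)))
  have hVdim : Module.finrank k V = gr W P' n := by
    have h2 := Submodule.finrank_add_eq_of_isCompl hVcompl
    have h3 := ((P'.restrictScalars k).mkQ.domRestrict (W ^ n)).finrank_range_add_finrank_ker
    rw [LinearMap.range_domRestrict] at h3
    rw [gr]; omega
  have hV : ∀ v ∈ V.map (W ^ n).subtype, v ∈ P' → v = 0 := by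
    rintro _ ⟨v, hv, rfl⟩ hvP
    have : v ∈ LinearMap.ker ((P'.restrictScalars k).mkQ.domRestrict (W ^ n)) ⊓ V :=
      ⟨LinearMap.mem_ker.2 ((Submodule.Quotient.mk_eq_zero (P'.restrictScalars k)).2 hvP), hv⟩
    rw [hVcompl.inf_eq_bot, Submodule.mem_bot] at this
    rw [this, map_zero]
  let S : (Fin (n + 1) → V) →ₗ[k] A := ∑ i : Fin (n + 1),
    (LinearMap.mulRight k (c ^ (i : ℕ))) ∘ₗ (W ^ n).subtype ∘ₗ V.subtype ∘ₗ LinearMap.proj i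
  have hS : ∀ v, S v = ∑ i : Fin (n + 1), (v i : A) * c ^ (i : ℕ) := by
    intro v; rw [LinearMap.sum_apply]; rfl
  have hmem : ∀ v, S v ∈ W ^ ((q + 1) * n) := by
    intro v
    rw [hS]
    refine Submodule.sum_mem _ fun i _ => ?_
    rw [show (q + 1) * n = n + q * n by ring, pow_add]
    refine Submodule.mul_mem_mul (v i).1.2 ?_
    refine pow_le_pow_of_one_mem h1 (Nat.mul_le_mul_left q (Nat.lt_succ_iff.1 i.2)) ?_
    rw [pow_mul]
    exact Submodule.pow_mem_pow _ hq _
  let E : (Fin (n + 1) → V) →ₗ[k] (W ^ ((q + 1) * n)).map (P.restrictScalars k).mkQ :=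
    LinearMap.codRestrict _ ((P.restrictScalars k).mkQ ∘ₗ S) fun v => ⟨_, hmem v, rfl⟩
  have hE : Function.Injective E := by
    rw [injective_iff_map_eq_zero]
    intro v hv
    have h2 : S v ∈ P := by
      have := congrArg Subtype.val hv
      exact (Submodule.Quotient.mk_eq_zero (P.restrictScalars k)).1 this
    let w : ℕ → A := fun i => if h : i < n + 1 then (v ⟨i, h⟩ : A) else 0
    have h3 := sum_mul_pow_mem (k := k) hcP' hlt.le hc (V.map (W ^ n).subtype) hV (n + 1) w
      (fun i => by
        dsimp only [w]
        split_ifs with h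
        · exact ⟨_, (v ⟨i, h⟩).2, rfl⟩
        · exact Submodule.zero_mem _) (by
        rw [Finset.sum_range]
        have h4 : ∀ i : Fin (n + 1), w i = v i := fun i => dif_pos i.2
        simp only [h4]
        rwa [hS] at h2)
    funext i
    have h4 := h3 i i.2
    simp only [w, i.2, dif_pos] at h4
    exact Subtype.ext (Subtype.ext h4)
  have := LinearMap.finrank_le_finrank_of_injective hE
  rw [Module.finrank_pi_fintype] at this
  simpa [hVdim, gr] using this

theorem PolyGr.drop [IsNoetherianRing A] [IsNoetherianRing Aᵐᵒᵖ]
    {W : Submodule k A} (hW : W.FG) (h1 : (1 : A) ∈ W) (hgen : ∀ a, ∃ n, a ∈ W ^ n)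
    {P P' : Ideal A} (hP : IsPrimeId P) (hP' : IsPrimeId P') (hlt : P < P') {e : ℕ}
    (h : PolyGr W P e) : ∃ e', e = e' + 1 ∧ PolyGr W P' e' := by
  obtain ⟨q, hq⟩ := exists_mul_gr_le hW h1 hgen hP hP' hlt
  obtain ⟨C, hC⟩ := h
  cases e with
  | zero =>
    exfalso
    have h2 := hq (C + 1)
    have h3 := hC ((q + 1) * (C + 1)) (Nat.mul_pos (Nat.succ_pos _) (Nat.succ_pos _))
    have h4 := one_le_gr hW h1 hP'.2.1 (C + 1)
    rw [pow_zero, mul_one] at h3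
    nlinarith
  | succ e =>
    refine ⟨e, rfl, C * (q + 1) ^ (e + 1), fun n hn => ?_⟩
    have h2 := hq n
    have h3 := hC ((q + 1) * n) (Nat.mul_pos (Nat.succ_pos _) hn)
    refine Nat.le_of_mul_le_mul_left (c := n) ?_ hn
    calc n * gr W P' n ≤ (n + 1) * gr W P' n := Nat.mul_le_mul_right _ (Nat.le_succ n)
      _ ≤ _ := h2
      _ ≤ _ := h3
      _ = _ := by rw [mul_pow]; ring

/-- Minimal primes. -/
def IsMinPrime (P : Ideal A) : Prop := IsPrimeId P ∧ ∀ P', IsPrimeId P' → P' ≤ P → P' = P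

omit [Field k] [Algebra k A] in
theorem exists_finset_primes [IsNoetherianRing A] (I : Ideal A) (hI : I.IsTwoSided) :
    ∃ 𝒮 : Finset (Ideal A), (∀ P ∈ 𝒮, IsPrimeId P) ∧
      ∀ P, IsPrimeId P → I ≤ P → ∃ P' ∈ 𝒮, P' ≤ P := by
  classical
  induction I using IsNoetherian.induction with
  | hgt I ih =>
  by_cases htop : I = ⊤
  · refine ⟨∅, by simp, fun P hP hle => ?_⟩
    exact absurd (top_le_iff.1 (htop ▸ hle)) hP.2.1
  by_cases hp : ∀ a b, (∀ r, a * r * b ∈ I) → a ∈ I ∨ b ∈ I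
  · exact ⟨{I}, by simpa using ⟨hI, htop, hp⟩, fun P _ hle => ⟨I, by simp, hle⟩⟩
  push Not at hp
  obtain ⟨a, b, hab, ha, hb⟩ := hp
  have key : ∀ x, x ∉ I → ∃ J : Ideal A, J.IsTwoSided ∧ I < J ∧
      ∀ P : Ideal A, P.IsTwoSided → I ≤ P → x ∈ P → J ≤ P := by
    intro x hx
    let J0 := TwoSidedIdeal.span (insert x (I : Set A))
    refine ⟨TwoSidedIdeal.asIdeal J0, inferInstance, lt_of_le_of_ne ?_ ?_, ?_⟩
    · intro y hy
      exact TwoSidedIdeal.subset_span (Set.mem_insert_of_mem _ hy)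
    · intro h
      apply hx
      rw [h]
      exact TwoSidedIdeal.subset_span (Set.mem_insert _ _)
    · intro P hP hIP hxP y hy
      have : J0 ≤ P.toTwoSided := TwoSidedIdeal.span_le.2 (by
        intro z hz
        rcases hz with rfl | hz
        · simpa using hxP
        · simpa using hIP hz)
      simpa using this hy
  obtain ⟨J, hJ, hIJ, hJP⟩ := key a ha
  obtain ⟨J', hJ', hIJ', hJP'⟩ := key b hb
  obtain ⟨S, hS, hS2⟩ := ih J hIJ hJ
  obtain ⟨S', hS', hS2'⟩ := ih J' hIJ' hJ'
  refine ⟨S ∪ S', fun P hP => ?_, fun P hP hle => ?_⟩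
  · rcases Finset.mem_union.1 hP with h | h
    · exact hS P h
    · exact hS' P h
  · rcases hP.2.2 a b fun r => hle (hab r) with h | h
    · obtain ⟨P', h1, h2⟩ := hS2 P hP (hJP P hP.1 hle h)
      exact ⟨P', Finset.mem_union_left _ h1, h2⟩
    · obtain ⟨P', h1, h2⟩ := hS2' P hP (hJP' P hP.1 hle h)
      exact ⟨P', Finset.mem_union_right _ h1, h2⟩

end Drop

section MaxGrowth

variable {k A : Type*} [Field k] [Ring A] [Algebra k A]

omit [Field k] [Algebra k A] in
theorem exists_isPrimeId [IsNoetherianRing A] [Nontrivial A] : ∃ P : Ideal A, IsPrimeId P := by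
  obtain ⟨P, ⟨h2, hne⟩, hmax⟩ := exists_maximal_of_noeth (fun P : Ideal A => P)
    (fun P => P.IsTwoSided ∧ P ≠ ⊤) ⟨⊥, inferInstance, bot_ne_top⟩
  refine ⟨P, h2, hne, fun a b hab => ?_⟩
  by_contra! hcon
  let K : Ideal A :=
    { carrier := {x | ∀ r, a * r * x ∈ P}
      add_mem' := fun {x y} hx hy r => by rw [mul_add]; exact P.add_mem (hx r) (hy r)
      zero_mem' := fun r => by rw [mul_zero]; exact P.zero_mem
      smul_mem' := fun c x hx r => by
        rw [smul_eq_mul, ← mul_assoc, mul_assoc a]; exact hx (r * c) }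
  have hK2 : K.IsTwoSided := ⟨fun {x} c hx r => by
    rw [← mul_assoc]; exact P.mul_mem_right _ (hx r)⟩
  have hle : P ≤ K := fun x hx r => P.mul_mem_left _ hx
  by_cases hK : K = ⊤
  · have h1 : (1 : A) ∈ K := hK ▸ Submodule.mem_top
    have := h1 1
    rw [mul_one, mul_one] at this
    exact hcon.1 this
  · have := hmax K ⟨hK2, hK⟩ hle
    exact hcon.2 (this ▸ hab)

theorem exists_isPrimeId_max [IsNoetherianRing A] [IsNoetherianRing Aᵐᵒᵖ] [Nontrivial A]
    {W : Submodule k A} (hW : W.FG) (h1 : (1 : A) ∈ W) (hgen : ∀ a, ∃ n, a ∈ W ^ n)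
    (hpoly : ∀ P : Ideal A, IsPrimeId P → ∃ e, PolyGr W P e) :
    ∃ P : Ideal A, IsPrimeId P ∧ ∀ P', IsPrimeId P' →
      (∀ e, PolyGr W P' e → PolyGr W P e) → IsMinPrime P' := by
  let δ : Ideal A → ℕ := fun P => sInf {e | PolyGr W P e}
  have hδ : ∀ P, IsPrimeId P → PolyGr W P (δ P) := fun P hP => Nat.sInf_mem (hpoly P hP)
  have hδle : ∀ P e, PolyGr W P e → δ P ≤ e := fun P e h => Nat.sInf_le h
  obtain ⟨𝒮, h𝒮, hmin⟩ := exists_finset_primes (⊥ : Ideal A) inferInstance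
  obtain ⟨P0, hP0⟩ := exists_isPrimeId (A := A)
  obtain ⟨P, hP, hPmax⟩ := Nat.sSup_mem (s := δ '' {P | IsPrimeId P}) ⟨_, P0, hP0, rfl⟩
    ⟨𝒮.sup δ, by
      rintro _ ⟨P, hP, rfl⟩
      obtain ⟨P', hP', hle⟩ := hmin P hP bot_le
      exact (hδle _ _ ((hδ P' (h𝒮 _ hP')).of_le hW hle)).trans (Finset.le_sup hP')⟩
  have hmax : ∀ P', IsPrimeId P' → δ P' ≤ δ P := by
    intro P' hP'
    rw [hPmax]
    refine le_csSup ⟨𝒮.sup δ, ?_⟩ ⟨P', hP', rfl⟩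
    rintro _ ⟨P, hP, rfl⟩
    obtain ⟨P', hP', hle⟩ := hmin P hP bot_le
    exact (hδle _ _ ((hδ P' (h𝒮 _ hP')).of_le hW hle)).trans (Finset.le_sup hP')
  refine ⟨P, hP, fun P' hP' h => ⟨hP', fun P'' hP'' hle => ?_⟩⟩
  by_contra hne
  obtain ⟨e', he', hpe⟩ := (hδ P'' hP'').drop hW h1 hgen hP'' hP' (lt_of_le_of_ne hle hne)
  have h2 := hδle _ _ (h _ hpe)
  have h3 := hmax P'' hP''
  omega

end MaxGrowth

section Bimodule

variable {k A : Type*} [Field k] [Ring A] [Algebra k A]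

/-- Elements which are regular modulo all minimal primes. -/
def minReg (A : Type*) [Ring A] : Set A :=
  {t | ∀ P : Ideal A, IsMinPrime P → ∀ x, x * t ∈ P → x ∈ P}

open MulOpposite in
theorem mem_of_smul_mem_of_minReg {ι B : Type*} [DecidableEq ι] [IsNoetherianRing A]
    [IsNoetherianRing Aᵐᵒᵖ] [AddCommGroup B] [Module k B] [Module A B]
    [IsScalarTower k A B] [Module Aᵐᵒᵖ B] [SMulCommClass A Aᵐᵒᵖ B] [IsScalarTower k Aᵐᵒᵖ B]
    [IsNoetherian A B]
    (d : ℕ) (s : Finset ι) (α : List ι → k) (hs : s.card = d) (hα : nz d s α)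
    (hv : VanishesOn d s α (Set.univ : Set A))
    {W : Submodule k A} (hW : W.FG) (h1 : (1 : A) ∈ W) (hgen : ∀ a, ∃ n, a ∈ W ^ n)
    {P : Ideal A} (hP : IsPrimeId P)
    (hPmax : ∀ P', IsPrimeId P' → (∀ e, PolyGr W P' e → PolyGr W P e) → IsMinPrime P')
    (Z₀ : Submodule A B) (hZ₀ : ∀ (r : A), ∀ z ∈ Z₀, op r • z ∈ Z₀)
    (hsat : ∀ c : A, (∀ x, x * c ∈ P → x ∈ P) → ∀ b : B, op c • b ∈ Z₀ → b ∈ Z₀)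
    {t : A} (ht : t ∈ minReg A) (b : B) (hb : t • b ∈ Z₀) : b ∈ Z₀ := by
  classical
  obtain ⟨Z, ⟨hZle, hZr, hZsat, hZt⟩, hZmax⟩ := exists_maximal_of_noeth (fun Z : Submodule A B => Z)
    (fun Z => Z₀ ≤ Z ∧ (∀ (r : A), ∀ z ∈ Z, op r • z ∈ Z) ∧
      (∀ c : A, (∀ x, x * c ∈ P → x ∈ P) → ∀ b : B, op c • b ∈ Z → b ∈ Z) ∧
      ∀ b ∈ Z, t • b ∈ Z₀ → b ∈ Z₀)
    ⟨Z₀, le_rfl, hZ₀, hsat, fun b hb _ => hb⟩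
  by_cases hZtop : Z = ⊤
  · exact hZt b (hZtop ▸ Submodule.mem_top) hb
  exfalso
  -- the left annihilator of `Y / Z`
  let annQ : {Y : Submodule A B // ∀ (r : A), ∀ z ∈ Y, op r • z ∈ Y} → Ideal A := fun Y =>
    { carrier := {a | ∀ y ∈ Y.1, a • y ∈ Z}
      add_mem' := fun {a a'} h h' y hy => by rw [add_smul]; exact Z.add_mem (h y hy) (h' y hy)
      zero_mem' := fun y _ => by rw [zero_smul]; exact Z.zero_mem
      smul_mem' := fun c a h y hy => by
        rw [smul_eq_mul, mul_smul]; exact Z.smul_mem c (h y hy) }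
  have hann2 : ∀ Y, (annQ Y).IsTwoSided := fun Y => ⟨fun {a} c ha y hy => by
    rw [mul_smul]; exact ha _ (Y.1.smul_mem c hy)⟩
  obtain ⟨Y, hY, hYmax⟩ := exists_maximal_of_noeth annQ (fun Y => Z < Y.1)
    ⟨⟨⊤, fun _ _ _ => Submodule.mem_top⟩, lt_top_iff_ne_top.2 hZtop⟩
  set P1 := annQ Y with hP1def
  have hP1 : IsPrimeId P1 := by
    refine ⟨hann2 Y, fun h => ?_, fun a c hac => ?_⟩
    · have h1 : (1 : A) ∈ P1 := h ▸ Submodule.mem_top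
      exact hY.not_ge fun y hy => by simpa using h1 y hy
    · by_contra! hcon
      let Y2 : Submodule A B := Z ⊔ Submodule.span A {x | ∃ y ∈ Y.1, x = c • y}
      have hY2r : ∀ (r : A), ∀ z ∈ Y2, op r • z ∈ Y2 := by
        intro r z hz
        obtain ⟨z1, hz1, z2, hz2, rfl⟩ := Submodule.mem_sup.1 hz
        rw [smul_add]
        refine Y2.add_mem (Submodule.mem_sup_left (hZr r _ hz1)) (Submodule.mem_sup_right ?_)
        clear hz
        induction hz2 using Submodule.span_induction with
        | mem x hx =>
          obtain ⟨y, hy, rfl⟩ := hx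
          exact Submodule.subset_span ⟨op r • y, Y.2 r y hy, (smul_comm _ _ _).symm⟩
        | zero => rw [smul_zero]; exact Submodule.zero_mem _
        | add x y _ _ hx hy => rw [smul_add]; exact Submodule.add_mem _ hx hy
        | smul a x _ hx => rw [← smul_comm a (op r) x]; exact Submodule.smul_mem _ a hx
      have hlt : Z < Y2 := by
        refine lt_of_le_of_ne le_sup_left fun h => hcon.2 fun y hy => ?_
        rw [h]
        exact Submodule.mem_sup_right (Submodule.subset_span ⟨y, hy, rfl⟩)
      have hY2le : Y2 ≤ Y.1 := by
        refine sup_le hY.le (Submodule.span_le.2 ?_)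
        rintro _ ⟨y, hy, rfl⟩
        exact Y.1.smul_mem c hy
      have heq := hYmax ⟨Y2, hY2r⟩ hlt fun a ha y hy => ha y (hY2le hy)
      apply hcon.1
      rw [← heq]
      intro y hy
      obtain ⟨z1, hz1, z2, hz2, rfl⟩ := Submodule.mem_sup.1 hy
      rw [smul_add]
      refine Z.add_mem (Z.smul_mem a hz1) ?_
      have key : ∀ r : A, (a * r) • z2 ∈ Z := by
        clear hy
        induction hz2 using Submodule.span_induction with
        | mem x hx =>
          obtain ⟨y, hy, rfl⟩ := hx
          intro r
          rw [← mul_smul]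
          exact hac r y hy
        | zero => simp
        | add x y _ _ hx hy => intro r; rw [smul_add]; exact Z.add_mem (hx r) (hy r)
        | smul c x _ hx => intro r; rw [← mul_smul, mul_assoc]; exact hx _
      simpa using key 1
  let Z' : Submodule A B :=
    { carrier := {b | ∀ a ∈ P1, a • b ∈ Z}
      add_mem' := fun {x y} hx hy a ha => by rw [smul_add]; exact Z.add_mem (hx a ha) (hy a ha)
      zero_mem' := fun a _ => by rw [smul_zero]; exact Z.zero_mem
      smul_mem' := fun c x hx a ha => by
        have := hP1.1
        rw [← mul_smul]; exact hx _ (P1.mul_mem_right c ha) }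
  have hZ'r : ∀ (r : A), ∀ z ∈ Z', op r • z ∈ Z' := fun r z hz a ha => by
    rw [smul_comm]; exact hZr r _ (hz a ha)
  have hYZ' : Y.1 ≤ Z' := fun y hy a ha => ha y hy
  have hZZ' : Z < Z' := hY.trans_le hYZ'
  have hP1min : IsMinPrime P1 := by
    obtain ⟨m, g, hg⟩ :=
      Submodule.fg_iff_exists_fin_generating_family.1 (IsNoetherian.noetherian Z')
    have hgmem : ∀ i, g i ∈ Z' := fun i => hg ▸ Submodule.subset_span ⟨i, rfl⟩
    obtain ⟨p, hp⟩ := exists_gr_le_of_bond (k := k) hW h1 hgen P P1 Z hZr g (fun i r => by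
      rw [hg]; exact Submodule.mem_sup_left (hZ'r r _ (hgmem i)))
      (fun a ha i => hgmem i a ha) (fun r hr => by
        by_contra hrP
        let K : Ideal A :=
          { carrier := {h | ∀ b ∈ Z', op h • b ∈ Z}
            add_mem' := fun {x y} hx hy b hb => by
              rw [op_add, add_smul]; exact Z.add_mem (hx b hb) (hy b hb)
            zero_mem' := fun b _ => by rw [op_zero, zero_smul]; exact Z.zero_mem
            smul_mem' := fun c x hx b hb => by
              rw [smul_eq_mul, op_mul, mul_smul]; exact hx _ (hZ'r c b hb) }
        have hK : K.IsTwoSided := ⟨fun {x} c hx b hb => by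
          rw [op_mul, mul_smul]; exact hZr c _ (hx b hb)⟩
        have hrK : r ∈ K := by
          intro b hb
          rw [← hg] at hb
          induction hb using Submodule.span_induction with
          | mem x hx => obtain ⟨i, rfl⟩ := hx; exact hr i
          | zero => rw [smul_zero]; exact Z.zero_mem
          | add x y _ _ hx hy => rw [smul_add]; exact Z.add_mem hx hy
          | smul a x _ hx => rw [← smul_comm a (op r) x]; exact Z.smul_mem a hx
        obtain ⟨c, hcK, hc⟩ := hP.exists_regular_mem hK hrK hrP
        exact hZZ'.not_ge fun b hb => hZsat c hc b (hcK b hb))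
    exact hPmax P1 hP1 fun e he => he.of_gr_le hW h1 hp
  have hτ : ∀ b ∈ Z', t • b ∈ Z → b ∈ Z := by
    let τ : Submodule A B :=
      { carrier := {b | b ∈ Z' ∧ ∃ c, c ∉ P1 ∧ ∀ r : A, (c * r) • b ∈ Z}
        add_mem' := by
          rintro x y ⟨hx, c, hc, hcx⟩ ⟨hy, c', hc', hcy⟩
          refine ⟨Z'.add_mem hx hy, ?_⟩
          obtain ⟨r, hr⟩ : ∃ r, c * r * c' ∉ P1 := by
            by_contra! h
            rcases hP1.2.2 c c' h with h | h
            · exact hc h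
            · exact hc' h
          refine ⟨c * r * c', hr, fun r' => ?_⟩
          rw [smul_add]
          refine Z.add_mem ?_ ?_
          · rw [mul_assoc, mul_assoc]; exact hcx _
          · rw [mul_assoc, mul_smul]; exact Z.smul_mem _ (hcy r')
        zero_mem' := ⟨Z'.zero_mem, 1, fun h => hP1.2.1 ((Ideal.eq_top_iff_one _).2 h), by simp⟩
        smul_mem' := by
          rintro a x ⟨hx, c, hc, hcx⟩
          exact ⟨Z'.smul_mem a hx, c, hc, fun r => by
            rw [← mul_smul, mul_assoc]; exact hcx _⟩ }
    have hτr : ∀ (r : A), ∀ z ∈ τ, op r • z ∈ τ := by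
      rintro r z ⟨hz, c, hc, hcz⟩
      exact ⟨hZ'r r z hz, c, hc, fun r' => by rw [smul_comm]; exact hZr r _ (hcz r')⟩
    have hZτ : Z ≤ τ := fun z hz => ⟨hZZ'.le hz, 1,
      fun h => hP1.2.1 ((Ideal.eq_top_iff_one _).2 h), fun r => Z.smul_mem _ hz⟩
    have hann : ∀ N : Submodule A B, N.FG → N ≤ τ →
        ∃ c, c ∉ P1 ∧ ∀ r : A, ∀ b ∈ N, (c * r) • b ∈ Z := by
      intro N hN
      induction N, hN using Submodule.fg_induction with
      | singleton x =>
        intro hx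
        obtain ⟨-, c, hc, hcx⟩ := hx (Submodule.mem_span_singleton_self x)
        refine ⟨c, hc, fun r b hb => ?_⟩
        obtain ⟨a, rfl⟩ := Submodule.mem_span_singleton.1 hb
        rw [← mul_smul, mul_assoc]; exact hcx _
      | sup N1 N2 _ _ h1 h2 =>
        intro hle
        obtain ⟨c, hc, hcx⟩ := h1 (le_sup_left.trans hle)
        obtain ⟨c', hc', hcy⟩ := h2 (le_sup_right.trans hle)
        obtain ⟨r, hr⟩ : ∃ r, c * r * c' ∉ P1 := by
          by_contra! h
          rcases hP1.2.2 c c' h with h | h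
          · exact hc h
          · exact hc' h
        refine ⟨c * r * c', hr, fun r' b hb => ?_⟩
        obtain ⟨x, hx, y, hy, rfl⟩ := Submodule.mem_sup.1 hb
        rw [smul_add]
        refine Z.add_mem ?_ ?_
        · rw [mul_assoc, mul_assoc]; exact hcx _ x hx
        · rw [mul_assoc, mul_smul]; exact Z.smul_mem _ (hcy r' y hy)
    obtain ⟨c, hc, hcτ⟩ := hann τ (IsNoetherian.noetherian τ) le_rfl
    have hτZ : τ = Z := by
      by_contra hne
      have heq := hYmax ⟨τ, hτr⟩ (lt_of_le_of_ne hZτ (Ne.symm hne)) fun a ha y hy => hy.1 a ha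
      apply hc
      rw [← heq]
      intro y hy
      simpa using hcτ 1 y hy
    intro b hb htb
    rw [← hτZ]
    refine ⟨hb, ?_⟩
    let L : Ideal A :=
      { carrier := {h | h • b ∈ Z}
        add_mem' := fun {x y} hx hy => by
          change (x + y) • b ∈ Z
          rw [add_smul]; exact Z.add_mem hx hy
        zero_mem' := by
          change (0 : A) • b ∈ Z
          rw [zero_smul]; exact Z.zero_mem
        smul_mem' := fun c x hx => by
          change (c • x) • b ∈ Z
          rw [smul_assoc]; exact Z.smul_mem c hx }
    refine exists_not_mem_mul_mem (k := k) d s α hs hα hv P1 hP1 L (fun a ha => hb a ha) ?_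
    intro u hu
    have := hP1.1
    have := isNoetherianRing_quotient P1
    obtain ⟨r, x, hrx, hne⟩ := isEss_of_lann_eq_bot (c := Ideal.Quotient.mk P1 t) (by
      rw [eq_bot_iff]
      intro y hy
      obtain ⟨y, rfl⟩ := Ideal.Quotient.mk_surjective y
      rw [mem_lann, ← map_mul, Ideal.Quotient.eq_zero_iff_mem] at hy
      exact Ideal.Quotient.eq_zero_iff_mem.2 (ht P1 hP1min y hy)) (Ideal.Quotient.mk P1 u)
      (by rwa [Ne, Ideal.Quotient.eq_zero_iff_mem])
    obtain ⟨r, rfl⟩ := Ideal.Quotient.mk_surjective r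
    obtain ⟨x, rfl⟩ := Ideal.Quotient.mk_surjective x
    rw [← map_mul, Ne, Ideal.Quotient.eq_zero_iff_mem] at hne
    rw [← map_mul, ← map_mul, Ideal.Quotient.eq] at hrx
    refine ⟨r, ?_, hne⟩
    have h2 := Z.add_mem (hb _ hrx) (Z.smul_mem x htb)
    rw [← mul_smul, ← add_smul, sub_add_cancel] at h2
    exact h2
  refine hZZ'.ne (hZmax Z' ⟨hZle.trans hZZ'.le, hZ'r, ?_, ?_⟩ hZZ'.le).symm
  · intro c hc b hb a ha
    have h2 := hb a ha
    rw [smul_comm] at h2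
    exact hZsat c hc _ h2
  · intro b hb htb
    exact hZt b (hτ b hb (hZle htb)) htb

end Bimodule

section Twist

variable {A B ι : Type*} [Ring A] [Ring B] [Fintype ι] [DecidableEq ι]

/-- The module of columns of length `ι` over `M`, with the action twisted by `φ`. -/
@[ext]
structure Tw (φ : A →+* Matrix ι ι B) (M : Type*) where
  /-- The entries of a column. -/
  fn : ι → M

namespace Tw

/-- Columns are functions. -/
def equivFun (φ : A →+* Matrix ι ι B) (M : Type*) : Tw φ M ≃ (ι → M) where
  toFun x := x.fn
  invFun x := ⟨x⟩
  left_inv _ := rfl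
  right_inv _ := rfl

section Group

variable {φ : A →+* Matrix ι ι B} {M : Type*} [AddCommGroup M]

instance : AddCommGroup (Tw φ M) := (equivFun φ M).addCommGroup

theorem add_fn (x y : Tw φ M) (i : ι) : (x + y).fn i = x.fn i + y.fn i := rfl

theorem zero_fn (i : ι) : (0 : Tw φ M).fn i = 0 := rfl

/-- The entries as an additive homomorphism. -/
def entry (φ : A →+* Matrix ι ι B) (M : Type*) [AddCommGroup M] (i : ι) : Tw φ M →+ M where
  toFun x := x.fn i
  map_zero' := rfl
  map_add' _ _ := rfl

theorem sum_fn {κ : Type*} (s : Finset κ) (x : κ → Tw φ M) (i : ι) :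
    (∑ m ∈ s, x m).fn i = ∑ m ∈ s, (x m).fn i :=
  map_sum (entry φ M i) x s

end Group

variable {φ : A →+* Matrix ι ι B} {M : Type*} [AddCommGroup M] [Module B M]

instance : SMul A (Tw φ M) := ⟨fun a x => ⟨fun i => ∑ j, φ a i j • x.fn j⟩⟩

theorem smul_fn (a : A) (x : Tw φ M) (i : ι) : (a • x).fn i = ∑ j, φ a i j • x.fn j := rfl

instance : Module A (Tw φ M) where
  one_smul x := by
    ext i
    rw [smul_fn]
    simp [map_one, Matrix.one_apply, ite_smul]
  mul_smul a b x := by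
    ext i
    simp only [smul_fn, map_mul, Matrix.mul_apply, Finset.sum_smul, Finset.smul_sum, mul_smul]
    exact Finset.sum_comm
  smul_zero a := by
    ext i
    simp [smul_fn, zero_fn]
  smul_add a x y := by
    ext i
    simp [smul_fn, add_fn, smul_add, Finset.sum_add_distrib]
  add_smul a b x := by
    ext i
    simp [smul_fn, add_fn, add_smul, Finset.sum_add_distrib]
  zero_smul x := by
    ext i
    simp [smul_fn, zero_fn]

end Tw

/-- The compatibility between a twist and its dual twist. -/
structure IsDualPair (φ ψ : A →+* Matrix ι ι A) : Prop where
  left : ∀ i l q, ∑ j, φ (ψ q i j) l j = if i = l then q else 0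
  right : ∀ j l q, ∑ i, ψ (φ q i j) i l = if j = l then q else 0

/-- The twisted column module of the regular module is free. -/
def IsDualPair.equiv {φ ψ : A →+* Matrix ι ι A} (h : IsDualPair φ ψ) : (ι → A) ≃ₗ[A] Tw φ A where
  toFun y := ⟨fun l => ∑ j, φ (y j) l j⟩
  invFun x := fun j => ∑ i, ψ (x.fn i) i j
  map_add' x y := by
    ext l
    simp [Tw.add_fn, Finset.sum_add_distrib]
  map_smul' a y := by
    ext l
    simp only [RingHom.id_apply, Tw.smul_fn, Pi.smul_apply, smul_eq_mul, map_mul,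
      Matrix.mul_apply, Finset.mul_sum]
    exact Finset.sum_comm
  left_inv y := by
    funext j
    have : ∀ i, ψ (∑ m, φ (y m) i m) i j = ∑ m, ψ (φ (y m) i m) i j := fun i => by
      rw [map_sum, Matrix.sum_apply]
    simp only [this]
    rw [Finset.sum_comm]
    simp [h.right]
  right_inv x := by
    ext l
    have : ∀ j, φ (∑ i, ψ (x.fn i) i j) l j = ∑ i, φ (ψ (x.fn i) i j) l j := fun j => by
      rw [map_sum, Matrix.sum_apply]
    simp only [this]
    rw [Finset.sum_comm]
    simp [h.left]

open MulOpposite in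
/-- The transposed twist of the opposite ring. -/
def opTwist (φ : A →+* Matrix ι ι A) : Aᵐᵒᵖ →+* Matrix ι ι Aᵐᵒᵖ where
  toFun x := Matrix.of fun i j => op (φ x.unop j i)
  map_one' := by
    ext i j
    simp only [unop_one, map_one, Matrix.of_apply, Matrix.one_apply, apply_ite op, op_one, op_zero,
      eq_comm (a := j)]
  map_mul' x y := by
    ext i j
    simp [Matrix.mul_apply, Finset.op_sum]
  map_zero' := by
    ext i j
    simp
  map_add' x y := by
    ext i j
    simp

open MulOpposite in
theorem opTwist_apply (φ : A →+* Matrix ι ι A) (x : Aᵐᵒᵖ) (i j : ι) :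
    opTwist φ x i j = op (φ x.unop j i) := rfl

open MulOpposite in
theorem IsDualPair.opTwist {φ ψ : A →+* Matrix ι ι A} (h : IsDualPair φ ψ) :
    IsDualPair (opTwist ψ) (opTwist φ) where
  left i l q := by
    have := congrArg op (h.right i l q.unop)
    simpa [opTwist_apply, Finset.op_sum, apply_ite op] using this
  right j l q := by
    have := congrArg op (h.left j l q.unop)
    simpa [opTwist_apply, Finset.op_sum, apply_ite op] using this

end Twist

/-- A twist together with its dual and its bidual. -/
structure DualTriple (A : Type*) [Ring A] where
  ι : Type
  [fintype : Fintype ι]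
  [decEq : DecidableEq ι]
  φ₀ : A →+* Matrix ι ι A
  φ₁ : A →+* Matrix ι ι A
  φ₂ : A →+* Matrix ι ι A
  dual₀₁ : IsDualPair φ₀ φ₁
  dual₁₂ : IsDualPair φ₁ φ₂

attribute [instance] DualTriple.fintype DualTriple.decEq

/-- The opposite triple. -/
def DualTriple.op {A : Type*} [Ring A] (T : DualTriple A) : DualTriple Aᵐᵒᵖ where
  ι := T.ι
  φ₀ := opTwist T.φ₂
  φ₁ := opTwist T.φ₁
  φ₂ := opTwist T.φ₀
  dual₀₁ := T.dual₁₂.opTwist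
  dual₁₂ := T.dual₀₁.opTwist

/-- A directed, jointly faithful family of triples. -/
structure IsGoodFamily {A : Type*} [Ring A] (𝓕 : Set (DualTriple A)) : Prop where
  nonempty : 𝓕.Nonempty
  directed : ∀ T₁ ∈ 𝓕, ∀ T₂ ∈ 𝓕, ∃ T ∈ 𝓕,
    (∃ f : T₁.ι → T.ι, ∀ x i j, T₁.φ₀ x i j = T.φ₀ x (f i) (f j) ∧
      T₁.φ₂ x i j = T.φ₂ x (f i) (f j)) ∧
    (∃ f : T₂.ι → T.ι, ∀ x i j, T₂.φ₀ x i j = T.φ₀ x (f i) (f j) ∧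
      T₂.φ₂ x i j = T.φ₂ x (f i) (f j))
  faithful₀ : ∀ (𝔞 : Ideal A), 𝔞.IsTwoSided → 𝔞 ≠ ⊤ → ∀ x,
    (∀ T ∈ 𝓕, ∀ i j, T.φ₀ x i j ∈ 𝔞) → x = 0
  faithful₂ : ∀ (𝔞 : Ideal A), 𝔞.IsTwoSided → 𝔞 ≠ ⊤ → ∀ x,
    (∀ T ∈ 𝓕, ∀ i j, T.φ₂ x i j ∈ 𝔞) → x = 0

section OpIdeal

variable {A : Type*} [Ring A]

open MulOpposite

/-- The left ideal of `A` attached to a two-sided ideal of the opposite ring. -/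
def unopIdeal (I : Ideal Aᵐᵒᵖ) (hI : I.IsTwoSided) : Ideal A where
  carrier := {x | op x ∈ I}
  add_mem' := fun {x y} hx hy => by
    change op (x + y) ∈ I
    rw [op_add]; exact I.add_mem hx hy
  zero_mem' := I.zero_mem
  smul_mem' := fun c x hx => by
    change op (c * x) ∈ I
    rw [op_mul]; exact I.mul_mem_right _ hx

theorem mem_unopIdeal {I : Ideal Aᵐᵒᵖ} {hI : I.IsTwoSided} {x : A} :
    x ∈ unopIdeal I hI ↔ op x ∈ I := Iff.rfl

theorem isTwoSided_unopIdeal (I : Ideal Aᵐᵒᵖ) (hI : I.IsTwoSided) :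
    (unopIdeal I hI).IsTwoSided := ⟨fun {x} c hx => by
  rw [mem_unopIdeal, op_mul]; exact I.mul_mem_left _ hx⟩

theorem unopIdeal_ne_top {I : Ideal Aᵐᵒᵖ} {hI : I.IsTwoSided} (h : I ≠ ⊤) :
    unopIdeal I hI ≠ ⊤ := fun ht =>
  h ((Ideal.eq_top_iff_one I).2 (mem_unopIdeal.1 ((Ideal.eq_top_iff_one (unopIdeal I hI)).1 ht)))

/-- The left ideal of the opposite ring attached to a two-sided ideal of `A`. -/
def opIdeal (I : Ideal A) (hI : I.IsTwoSided) : Ideal Aᵐᵒᵖ where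
  carrier := {x | x.unop ∈ I}
  add_mem' := fun {x y} hx hy => I.add_mem hx hy
  zero_mem' := I.zero_mem
  smul_mem' := fun c x hx => by
    change (c * x).unop ∈ I
    rw [unop_mul]; exact I.mul_mem_right _ hx

theorem mem_opIdeal {I : Ideal A} {hI : I.IsTwoSided} {x : Aᵐᵒᵖ} :
    x ∈ opIdeal I hI ↔ x.unop ∈ I := Iff.rfl

theorem IsPrimeId.opIdeal {P : Ideal A} (hP : IsPrimeId P) : IsPrimeId (opIdeal P hP.1) := by
  refine ⟨⟨fun {x} c hx => ?_⟩, fun ht => hP.2.1 ?_, fun a b hab => ?_⟩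
  · rw [mem_opIdeal, unop_mul]; exact P.mul_mem_left _ hx
  · exact (Ideal.eq_top_iff_one _).2 (mem_opIdeal.1 ((Ideal.eq_top_iff_one _).1 ht))
  · refine (hP.2.2 b.unop a.unop fun r => ?_).symm
    have := mem_opIdeal.1 (hab (op r))
    simpa [mul_assoc] using this

theorem IsPrimeId.unopIdeal {P : Ideal Aᵐᵒᵖ} (hP : IsPrimeId P) :
    IsPrimeId (unopIdeal P hP.1) := by
  refine ⟨isTwoSided_unopIdeal P hP.1, unopIdeal_ne_top hP.2.1, fun a b hab => ?_⟩
  refine (hP.2.2 (op b) (op a) fun r => ?_).symm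
  have := mem_unopIdeal.1 (hab r.unop)
  simpa [mul_assoc] using this

theorem IsMinPrime.unopIdeal {P : Ideal Aᵐᵒᵖ} (hP : IsMinPrime P) :
    IsMinPrime (unopIdeal P hP.1.1) := by
  refine ⟨hP.1.unopIdeal, fun P' hP' hle => ?_⟩
  have := hP.2 _ hP'.opIdeal fun x hx => by simpa [mem_unopIdeal] using hle (mem_opIdeal.1 hx)
  ext x
  rw [mem_unopIdeal, ← this, mem_opIdeal, unop_op]

theorem op_mem_minReg [IsNoetherianRing A] {t : A} (ht : t ∈ minReg A) :
    op t ∈ minReg Aᵐᵒᵖ := by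
  intro P hP x hx
  have hP' := hP.unopIdeal
  set P' := unopIdeal P hP.1.1
  have := hP'.1.1
  have := isNoetherianRing_quotient P'
  suffices h : x.unop ∈ P' by simpa [P', mem_unopIdeal] using h
  have h2 : t * x.unop ∈ P' := by simpa [P', mem_unopIdeal] using hx
  rw [← Ideal.Quotient.eq_zero_iff_mem] at h2 ⊢
  refine hP'.1.isPrimeRing.isSemiprimeRing.eq_zero_of_mul_eq_zero
    (c := Ideal.Quotient.mk P' t) ?_ (by rw [← map_mul]; exact h2)
  rw [eq_bot_iff]
  intro y hy
  obtain ⟨y, rfl⟩ := Ideal.Quotient.mk_surjective y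
  rw [mem_lann, ← map_mul, Ideal.Quotient.eq_zero_iff_mem] at hy
  exact Ideal.Quotient.eq_zero_iff_mem.2 (ht P' hP' y hy)

theorem IsGoodFamily.op {𝓕 : Set (DualTriple A)} (h : IsGoodFamily 𝓕) :
    IsGoodFamily (DualTriple.op '' 𝓕) where
  nonempty := h.nonempty.image _
  directed := by
    rintro _ ⟨T₁, h₁, rfl⟩ _ ⟨T₂, h₂, rfl⟩
    obtain ⟨T, hT, ⟨f, hf⟩, ⟨g, hg⟩⟩ := h.directed T₁ h₁ T₂ h₂
    refine ⟨_, ⟨T, hT, rfl⟩, ⟨f, fun x i j => ?_⟩, ⟨g, fun x i j => ?_⟩⟩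
    · exact ⟨congrArg MulOpposite.op (hf x.unop j i).2, congrArg MulOpposite.op (hf x.unop j i).1⟩
    · exact ⟨congrArg MulOpposite.op (hg x.unop j i).2, congrArg MulOpposite.op (hg x.unop j i).1⟩
  faithful₀ 𝔞 h𝔞 hne x hx := by
    have := h.faithful₂ _ (isTwoSided_unopIdeal 𝔞 h𝔞) (unopIdeal_ne_top hne) x.unop
      fun T hT i j => hx _ ⟨T, hT, rfl⟩ j i
    simpa using this
  faithful₂ 𝔞 h𝔞 hne x hx := by
    have := h.faithful₀ _ (isTwoSided_unopIdeal 𝔞 h𝔞) (unopIdeal_ne_top hne) x.unop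
      fun T hT i j => hx _ ⟨T, hT, rfl⟩ j i
    simpa using this

end OpIdeal

section Regular

variable {k A : Type u} [Field k] [Ring A] [Algebra k A]

open MulOpposite in
theorem eq_zero_of_mul_eq_zero_of_minReg {ι : Type*} [DecidableEq ι] [IsNoetherianRing A]
    [IsNoetherianRing Aᵐᵒᵖ]
    (d : ℕ) (s : Finset ι) (α : List ι → k) (hs : s.card = d) (hα : nz d s α)
    (hv : VanishesOn d s α (Set.univ : Set A))
    {W : Submodule k A} (hW : W.FG) (h1 : (1 : A) ∈ W) (hgen : ∀ a, ∃ n, a ∈ W ^ n)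
    {𝓕 : Set (DualTriple A)} (h𝓕 : IsGoodFamily 𝓕)
    (hlin : ∀ T ∈ 𝓕, ∀ c : k, T.φ₀ (algebraMap k A c) = algebraMap k _ c)
    {t : A} (ht : t ∈ minReg A) {x : A} (hx : t * x = 0) : x = 0 := by
  rcases subsingleton_or_nontrivial A with hA | hA
  · exact Subsingleton.elim _ _
  obtain ⟨P, hP, hPmax⟩ := exists_isPrimeId_max (k := k) hW h1 hgen fun P hP =>
    IsPrimeId.exists_polyGr d s α hs hα hv hW hP
  have hP2 := hP.1
  refine h𝓕.faithful₀ P hP.1 hP.2.1 x fun T hT i l => ?_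
  let _ : Module k (Tw T.φ₀ A) := (Tw.equivFun T.φ₀ A).module k
  let _ : Module Aᵐᵒᵖ (Tw T.φ₀ A) := (Tw.equivFun T.φ₀ A).module Aᵐᵒᵖ
  have hk : ∀ (c : k) (b : Tw T.φ₀ A) i, (c • b).fn i = c • b.fn i := fun _ _ _ => rfl
  have hop : ∀ (c : A) (b : Tw T.φ₀ A) i, (op c • b).fn i = b.fn i * c := fun _ _ _ => rfl
  have _ : IsScalarTower k Aᵐᵒᵖ (Tw T.φ₀ A) := ⟨fun c a b => by
    ext i
    obtain ⟨a, rfl⟩ := op_surjective a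
    rw [hk, ← op_smul, hop, hop, mul_smul_comm]⟩
  have _ : SMulCommClass A Aᵐᵒᵖ (Tw T.φ₀ A) := ⟨fun a c b => by
    ext i
    obtain ⟨c, rfl⟩ := op_surjective c
    rw [hop, Tw.smul_fn, Tw.smul_fn, Finset.sum_mul]
    simp only [hop, smul_eq_mul, mul_assoc]⟩
  have _ : IsScalarTower k A (Tw T.φ₀ A) := ⟨fun c a b => by
    ext i
    rw [hk, Tw.smul_fn, Tw.smul_fn, Algebra.smul_def, map_mul, hlin T hT,
      ← Algebra.smul_def, Finset.smul_sum]
    simp⟩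
  have _ : IsNoetherian A (Tw T.φ₀ A) := isNoetherian_of_linearEquiv T.dual₀₁.equiv
  let Z₀ : Submodule A (Tw T.φ₀ A) :=
    { carrier := {b | ∀ i, b.fn i ∈ P}
      add_mem' := fun {x y} hx hy i => P.add_mem (hx i) (hy i)
      zero_mem' := fun i => P.zero_mem
      smul_mem' := fun c x hx i => by
        rw [Tw.smul_fn]; exact P.sum_mem fun j _ => P.mul_mem_left _ (hx j) }
  have hcol := mem_of_smul_mem_of_minReg (k := k) (B := Tw T.φ₀ A) d s α hs hα hv hW h1 hgen hP
    hPmax Z₀ (fun r z hz i => by rw [hop]; exact P.mul_mem_right _ (hz i))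
    (fun c hc b hb i => hc _ (hb i)) ht ⟨fun i => T.φ₀ x i l⟩ (by
      intro i
      rw [Tw.smul_fn]
      have h2 : (T.φ₀ t * T.φ₀ x) i l = 0 := by rw [← map_mul, hx, map_zero, Matrix.zero_apply]
      rw [Matrix.mul_apply] at h2
      simp only [smul_eq_mul]
      rw [h2]
      exact P.zero_mem)
  exact hcol i

end Regular

section OpData

variable {k A : Type*} [Field k] [Ring A] [Algebra k A]

theorem exists_generating_submodule (h : Algebra.FiniteType k A) :
    ∃ W : Submodule k A, W.FG ∧ (1 : A) ∈ W ∧ ∀ a, ∃ n, a ∈ W ^ n := by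
  classical
  obtain ⟨s, hs⟩ := h
  let W : Submodule k A := Submodule.span k (insert 1 s : Finset A)
  have h1 : (1 : A) ∈ W := Submodule.subset_span (by simp)
  refine ⟨W, ⟨_, rfl⟩, h1, fun a => ?_⟩
  have ha : a ∈ Algebra.adjoin k (s : Set A) := hs ▸ Algebra.mem_top
  induction ha using Algebra.adjoin_induction with
  | mem x hx => exact ⟨1, by rw [pow_one]; exact Submodule.subset_span (by simp [Finset.mem_coe.1 hx])⟩
  | algebraMap r =>
    exact ⟨0, by rw [pow_zero]; exact Submodule.algebraMap_mem r⟩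
  | add x y _ _ hx hy =>
    obtain ⟨m, hm⟩ := hx
    obtain ⟨n, hn⟩ := hy
    exact ⟨max m n, Submodule.add_mem _ (pow_le_pow_of_one_mem h1 (le_max_left _ _) hm)
      (pow_le_pow_of_one_mem h1 (le_max_right _ _) hn)⟩
  | mul x y _ _ hx hy =>
    obtain ⟨m, hm⟩ := hx
    obtain ⟨n, hn⟩ := hy
    exact ⟨m + n, by rw [pow_add]; exact Submodule.mul_mem_mul hm hn⟩

open MulOpposite in
theorem finiteType_op (h : Algebra.FiniteType k A) : Algebra.FiniteType k Aᵐᵒᵖ := by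
  obtain ⟨W, ⟨s, hs⟩, h1, hgen⟩ := exists_generating_submodule h
  refine ⟨⟨s.map (opEquiv (α := A)).toEmbedding, ?_⟩⟩
  rw [eq_top_iff]
  rintro x -
  obtain ⟨n, hn⟩ := hgen x.unop
  obtain ⟨x, rfl⟩ := op_surjective x
  rw [unop_op] at hn
  induction n generalizing x with
  | zero =>
    rw [pow_zero] at hn
    obtain ⟨c, rfl⟩ := Submodule.mem_one.1 hn
    exact Subalgebra.algebraMap_mem _ c
  | succ n ih =>
    rw [pow_succ] at hn
    induction hn using Submodule.mul_induction_on' with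
    | mem_mul_mem a ha b hb =>
      rw [op_mul]
      refine Subalgebra.mul_mem _ ?_ (ih _ ha)
      rw [← hs] at hb
      induction hb using Submodule.span_induction with
      | mem x hx => exact Algebra.subset_adjoin (by simpa using hx)
      | zero => exact Subalgebra.zero_mem _
      | add x y _ _ hx hy => rw [op_add]; exact Subalgebra.add_mem _ hx hy
      | smul a x _ hx => rw [op_smul]; exact Subalgebra.smul_mem _ hx a
    | add x _ y _ hx hy => rw [op_add]; exact Subalgebra.add_mem _ hx hy

open MulOpposite in
theorem opTwist_algebraMap {ι : Type*} [Fintype ι] [DecidableEq ι] {φ : A →+* Matrix ι ι A} {c : k}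
    (h : φ (algebraMap k A c) = algebraMap k _ c) :
    opTwist φ (algebraMap k Aᵐᵒᵖ c) = algebraMap k _ c := by
  ext i j
  rw [opTwist_apply, MulOpposite.algebraMap_apply, unop_op, h, Matrix.algebraMap_matrix_apply,
    Matrix.algebraMap_matrix_apply, apply_ite op]
  exact if_congr eq_comm rfl rfl

end OpData

section OpPI

variable {k A : Type u} [Field k] [Ring A] [Algebra k A]

open MulOpposite in
theorem satisfiesPolynomialIdentity_op (h : SatisfiesPolynomialIdentity k A) :
    SatisfiesPolynomialIdentity k Aᵐᵒᵖ := by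
  obtain ⟨n, f, hf, hv⟩ := h
  refine ⟨n, star f, by simpa using hf, fun v => ?_⟩
  let Φ : FreeAlgebra k (Fin n) →ₐ[k] Aᵐᵒᵖ := FreeAlgebra.lift k v
  let Ψ : FreeAlgebra k (Fin n) →ₐ[k] A := FreeAlgebra.lift k fun i => (v i).unop
  suffices h : ∀ g, Φ (star g) = op (Ψ g) by
    change Φ (star f) = 0
    rw [h, hv, op_zero]
  intro g
  induction g using FreeAlgebra.induction with
  | grade0 r => rw [FreeAlgebra.star_algebraMap, AlgHom.commutes, AlgHom.commutes]; rfl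
  | grade1 i => simp [Φ, Ψ]
  | mul a b ha hb => rw [star_mul, map_mul, map_mul, op_mul, ha, hb]
  | add a b ha hb => rw [star_add, map_add, map_add, op_add, ha, hb]

/-- Elements regular modulo the minimal primes are regular. -/
theorem isRegular_of_minReg [IsNoetherianRing A] [IsNoetherianRing Aᵐᵒᵖ]
    (hfin : Algebra.FiniteType k A) (hPI : SatisfiesPolynomialIdentity k A)
    {𝓕 : Set (DualTriple A)} (h𝓕 : IsGoodFamily 𝓕)
    (hlin₀ : ∀ T ∈ 𝓕, ∀ c : k, T.φ₀ (algebraMap k A c) = algebraMap k _ c)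
    (hlin₂ : ∀ T ∈ 𝓕, ∀ c : k, T.φ₂ (algebraMap k A c) = algebraMap k _ c)
    {t : A} (ht : t ∈ minReg A) : IsRegular t := by
  constructor
  · obtain ⟨d, s, α, hs, hα, hv⟩ := exists_multilinear_identity hPI
    obtain ⟨W, hW, h1, hgen⟩ := exists_generating_submodule hfin
    refine isLeftRegular_iff_right_eq_zero_of_mul.2 fun x hx =>
      eq_zero_of_mul_eq_zero_of_minReg (k := k) d s α hs hα hv hW h1 hgen h𝓕 hlin₀ ht hx
  · have : IsNoetherianRing Aᵐᵒᵖᵐᵒᵖ := isNoetherianRing_of_ringEquiv A (RingEquiv.opOp A)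
    obtain ⟨d, s, α, hs, hα, hv⟩ := exists_multilinear_identity (satisfiesPolynomialIdentity_op hPI)
    obtain ⟨W, hW, h1, hgen⟩ := exists_generating_submodule (finiteType_op hfin)
    refine isRightRegular_iff_left_eq_zero_of_mul.2 fun x hx => ?_
    have := eq_zero_of_mul_eq_zero_of_minReg (k := k) d s α hs hα hv hW h1 hgen h𝓕.op
      (by
        rintro _ ⟨T, hT, rfl⟩ c
        exact opTwist_algebraMap (hlin₂ T hT c))
      (op_mem_minReg ht) (x := MulOpposite.op x)
      (by rw [← MulOpposite.op_mul, hx, MulOpposite.op_zero])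
    simpa using this

end OpPI

section MinPrimes

variable {A : Type*} [Ring A]

theorem one_mem_minReg : (1 : A) ∈ minReg A := fun P _ x hx => by rwa [mul_one] at hx

theorem mul_mem_minReg {s t : A} (hs : s ∈ minReg A) (ht : t ∈ minReg A) : s * t ∈ minReg A :=
  fun P hP x hx => hs P hP x (ht P hP _ (by rwa [mul_assoc]))

theorem exists_isMinPrime_le [IsNoetherianRing A] :
    ∃ 𝒮 : Finset (Ideal A), (∀ P, IsMinPrime P ↔ P ∈ 𝒮) ∧
      ∀ P, IsPrimeId P → ∃ P' ∈ 𝒮, P' ≤ P := by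
  classical
  obtain ⟨𝒮, h𝒮, hle⟩ := exists_finset_primes (⊥ : Ideal A) inferInstance
  have key : ∀ P, IsPrimeId P → ∃ P' ∈ 𝒮, IsMinPrime P' ∧ P' ≤ P := by
    intro P hP
    obtain ⟨P0, hP0, hP0le⟩ := hle P hP bot_le
    obtain ⟨P', hP', hmin⟩ := (𝒮.filter (· ≤ P)).exists_minimal ⟨P0, by simp [hP0, hP0le]⟩
    rw [Finset.mem_filter] at hP'
    refine ⟨P', hP'.1, ⟨h𝒮 _ hP'.1, fun P'' hP'' h => ?_⟩, hP'.2⟩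
    obtain ⟨P3, hP3, hP3le⟩ := hle P'' hP'' bot_le
    exact le_antisymm h ((hmin (y := P3) (Finset.mem_filter.2 ⟨hP3, (hP3le.trans h).trans hP'.2⟩)
      (hP3le.trans h)).trans hP3le)
  refine ⟨𝒮.filter IsMinPrime, fun P => ⟨fun hP => ?_, fun hP => (Finset.mem_filter.1 hP).2⟩,
    fun P hP => ?_⟩
  · obtain ⟨P', hP', hmin, hle'⟩ := key P hP.1
    have := hP.2 P' hmin.1 hle'
    exact Finset.mem_filter.2 ⟨this ▸ hP', hP⟩
  · obtain ⟨P', hP', hmin, hle'⟩ := key P hP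
    exact ⟨P', Finset.mem_filter.2 ⟨hP', hmin⟩, hle'⟩

theorem IsPrimeId.exists_mem_forall {P : Ideal A} (hP : IsPrimeId P) (𝒮 : Finset (Ideal A))
    (h𝒮 : ∀ Q ∈ 𝒮, Q.IsTwoSided ∧ ¬ Q ≤ P) : ∃ x, x ∉ P ∧ ∀ Q ∈ 𝒮, x ∈ Q := by
  classical
  induction 𝒮 using Finset.induction_on with
  | empty => exact ⟨1, fun h => hP.2.1 ((Ideal.eq_top_iff_one _).2 h), by simp⟩
  | insert Q 𝒮 _ ih =>
    obtain ⟨x, hx, hx𝒮⟩ := ih fun Q' hQ' => h𝒮 Q' (Finset.mem_insert_of_mem hQ')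
    have hQ := h𝒮 Q (Finset.mem_insert_self _ _)
    obtain ⟨y, hyQ, hyP⟩ := Set.not_subset.1 hQ.2
    obtain ⟨r, hr⟩ : ∃ r, y * r * x ∉ P := by
      by_contra! h
      rcases hP.2.2 y x h with h | h
      · exact hyP h
      · exact hx h
    refine ⟨y * r * x, hr, fun Q' hQ' => ?_⟩
    rcases Finset.mem_insert.1 hQ' with rfl | hQ'
    · have := hQ.1
      rw [mul_assoc]
      exact Q'.mul_mem_right _ hyQ
    · exact Q'.mul_mem_left _ (hx𝒮 Q' hQ')

/-- A left ideal which is essential modulo the prime radical meets `minReg`. -/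
theorem exists_mem_minReg [IsNoetherianRing A] [IsNoetherianRing Aᵐᵒᵖ] (K : Ideal A)
    (hK : ∀ P, IsMinPrime P → ∀ u, u ∉ P →
      ∃ r, r * u ∈ K ∧ ∃ P', IsMinPrime P' ∧ r * u ∉ P') :
    ∃ t ∈ K, t ∈ minReg A := by
  classical
  obtain ⟨𝒮, h𝒮, -⟩ := exists_isMinPrime_le (A := A)
  let N : Ideal A := sInf {P | IsMinPrime P}
  have hmemN : ∀ x, x ∈ N ↔ ∀ P, IsMinPrime P → x ∈ P := fun x => by simp [N, Submodule.mem_sInf]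
  have hN : N.IsTwoSided := ⟨fun {x} c hx => by
    rw [hmemN] at hx ⊢
    intro P hP
    have := hP.1.1
    exact P.mul_mem_right _ (hx P hP)⟩
  have := isNoetherianRing_quotient N
  have := isNoetherianRing_op_quotient N
  have hsemi : IsSemiprimeRing (A ⧸ N) := by
    intro a ha
    obtain ⟨a, rfl⟩ := Ideal.Quotient.mk_surjective a
    rw [Ideal.Quotient.eq_zero_iff_mem, hmemN]
    intro P hP
    refine (hP.1.2.2 a a fun r => ?_).elim id id
    have := ha (Ideal.Quotient.mk N r)
    rw [← map_mul, ← map_mul, Ideal.Quotient.eq_zero_iff_mem, hmemN] at this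
    exact this P hP
  obtain ⟨c, hcK, hc⟩ := hsemi.exists_regular (K.map (Ideal.Quotient.mk N)) (by
    intro u hu
    obtain ⟨u, rfl⟩ := Ideal.Quotient.mk_surjective u
    rw [Ne, Ideal.Quotient.eq_zero_iff_mem, hmemN] at hu
    push Not at hu
    obtain ⟨P, hP, huP⟩ := hu
    obtain ⟨r, hr, P', hP', hrP'⟩ := hK P hP u huP
    refine ⟨Ideal.Quotient.mk N r, ?_, ?_⟩
    · rw [smul_eq_mul, ← map_mul]; exact Ideal.mem_map_of_mem _ hr
    · rw [smul_eq_mul, ← map_mul, Ne, Ideal.Quotient.eq_zero_iff_mem, hmemN]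
      exact fun h => hrP' (h P' hP'))
  obtain ⟨t, htK, rfl⟩ := (Ideal.mem_map_iff_of_surjective _ Ideal.Quotient.mk_surjective).1 hcK
  refine ⟨t, htK, fun P hP x hx => ?_⟩
  obtain ⟨y, hyP, hy⟩ := hP.1.exists_mem_forall (𝒮.erase P) fun Q hQ => by
    rw [Finset.mem_erase, ← h𝒮] at hQ
    exact ⟨hQ.2.1.1, fun hle => hQ.1 (hP.2 Q hQ.2.1 hle)⟩
  refine (hP.1.2.2 y x fun r => ?_).resolve_left hyP
  have : y * r * x ∈ N := by
    rw [← Ideal.Quotient.eq_zero_iff_mem]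
    have h2 : Ideal.Quotient.mk N (y * r * x) ∈ lann (Ideal.Quotient.mk N t) := by
      rw [mem_lann, ← map_mul, Ideal.Quotient.eq_zero_iff_mem, hmemN]
      intro Q hQ
      have := hQ.1.1
      by_cases hQP : Q = P
      · subst hQP
        rw [mul_assoc]
        exact Q.mul_mem_left _ hx
      · rw [mul_assoc, mul_assoc]
        exact Q.mul_mem_right _ (hy Q (Finset.mem_erase.2 ⟨hQP, (h𝒮 Q).1 hQ⟩))
    rwa [hc] at h2
  exact (hmemN _).1 this P hP

theorem IsPrimeId.exists_mem_minReg [IsNoetherianRing A] [IsNoetherianRing Aᵐᵒᵖ] {P : Ideal A}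
    (hP : IsPrimeId P) (hmin : ¬ IsMinPrime P) : ∃ t ∈ P, t ∈ minReg A := by
  refine WZ.exists_mem_minReg P fun Q hQ u hu => ?_
  have hle : ¬ P ≤ Q := fun hle => hmin (hQ.2 P hP hle ▸ hQ)
  obtain ⟨y, hyP, hyQ⟩ := Set.not_subset.1 hle
  obtain ⟨r, hr⟩ : ∃ r, y * r * u ∉ Q := by
    by_contra! h
    rcases hQ.1.2.2 y u h with h | h
    · exact hyQ h
    · exact hu h
  have := hP.1
  exact ⟨y * r, by rw [mul_assoc]; exact P.mul_mem_right _ hyP, Q, hQ, hr⟩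

end MinPrimes

section AlmostDCC

variable {A : Type*} [Ring A]

theorem eventually_ess_of_antitone [IsNoetherianRing A] (P : Ideal A) (S : ℕ → Ideal A)
    (hS : Antitone S) (hP : ∀ i, P ≤ S i) :
    ∃ n, ∀ i, n ≤ i → ∀ a ∈ S i, a ∉ P → ∃ r, r * a ∈ S (i + 1) ∧ r * a ∉ P := by
  by_contra! h
  choose f hf a haS haP hra using h
  let n : ℕ → ℕ := fun m => Nat.rec 0 (fun _ x => f x + 1) m
  have hn : ∀ m, n (m + 1) = f (n m) + 1 := fun m => rfl
  let b : ℕ → A := fun m => a (n m)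
  have hnS : ∀ m m', m ≤ m' → n m ≤ n m' := fun m m' hm => by
    induction m', hm using Nat.le_induction with
    | base => exact le_rfl
    | succ j _ ih => have := hf (n j); rw [hn]; omega
  have hbS : ∀ m m', m ≤ m' → b m' ∈ S (n m) := fun m m' hm =>
    hS ((hnS m m' hm).trans (hf (n m'))) (haS (n m'))
  let V : ℕ →o Ideal A := ⟨fun m => P ⊔ Ideal.span (b '' {j | j < m}), fun m m' hm =>
    sup_le_sup_left (Ideal.span_mono (Set.image_mono fun j hj => lt_of_lt_of_le hj hm)) _⟩
  obtain ⟨N, hN⟩ := monotone_stabilizes_iff_noetherian.2 (inferInstance : IsNoetherian A A) V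
  -- independence
  have key : ∀ j m, ∀ (c : ℕ → A), (∑ i ∈ Finset.range j, c i * b (m + i)) ∈ P →
      ∀ i < j, c i * b (m + i) ∈ P := by
    intro j
    induction j with
    | zero => intro m c _ i hi; omega
    | succ j ih =>
      intro m c hc
      rw [Finset.sum_range_succ'] at hc
      have h1 : (∑ i ∈ Finset.range j, c (i + 1) * b (m + (i + 1))) ∈ S (n (m + 1)) :=
        (S _).sum_mem fun i _ => (S _).mul_mem_left _ (hbS (m + 1) (m + (i + 1)) (by omega))
      have h2 : c 0 * b (m + 0) ∈ S (n (m + 1)) := by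
        have := (S (n (m + 1))).sub_mem (hP _ hc) h1
        rwa [add_sub_cancel_left] at this
      have h3 : c 0 * b (m + 0) ∈ P := hra (n m) (c 0) h2
      have h4 := ih (m + 1) (fun i => c (i + 1)) (by
        have := P.sub_mem hc h3
        rw [add_sub_cancel_right] at this
        convert this using 4
        ring)
      intro i hi
      rcases i with _ | i
      · exact h3
      · have := h4 i (by omega)
        rwa [add_assoc, add_comm 1 i] at this
  have hmem : b N ∈ V N := by
    have h1 : b N ∈ V (N + 1) :=
      Submodule.mem_sup_right (Ideal.subset_span ⟨N, Nat.lt_succ_self N, rfl⟩)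
    rwa [← hN (N + 1) (Nat.le_succ N)] at h1
  obtain ⟨p, hp, z, hz, hpz⟩ := Submodule.mem_sup.1 hmem
  have hz' : ∃ c : ℕ → A, z = ∑ i ∈ Finset.range N, c i * b i := by
    clear hpz
    induction hz using Submodule.span_induction with
    | mem x hx =>
      obtain ⟨j, hj, rfl⟩ := hx
      exact ⟨fun i => if i = j then 1 else 0, by
        simp only [ite_mul, one_mul, zero_mul]
        rw [Finset.sum_ite_eq' (Finset.range N) j, if_pos (Finset.mem_range.2 hj)]⟩
    | zero => exact ⟨0, by simp⟩
    | add x y _ _ hx hy =>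
      obtain ⟨c, rfl⟩ := hx
      obtain ⟨c', rfl⟩ := hy
      exact ⟨fun i => c i + c' i, by simp [add_mul, Finset.sum_add_distrib]⟩
    | smul r x _ hx =>
      obtain ⟨c, rfl⟩ := hx
      exact ⟨fun i => r * c i, by simp [Finset.mul_sum, mul_assoc]⟩
  obtain ⟨c, rfl⟩ := hz'
  have h5 := key (N + 1) 0 (fun i => if i < N then c i else -1) (by
    rw [Finset.sum_range_succ]
    have : ∑ i ∈ Finset.range N, (if i < N then c i else -1) * b (0 + i) =
        ∑ i ∈ Finset.range N, c i * b i :=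
      Finset.sum_congr rfl fun i hi => by rw [if_pos (Finset.mem_range.1 hi), zero_add]
    rw [this, if_neg (lt_irrefl N), zero_add, ← hpz]
    simpa using hp) N (Nat.lt_succ_self N)
  rw [if_neg (lt_irrefl N), zero_add, neg_one_mul, neg_mem_iff] at h5
  exact haP _ h5

/-- The descending chain condition up to `minReg`-torsion. -/
def AlmostDCC {M : Type*} [AddCommGroup M] [Module A M] (N : Submodule A M) : Prop :=
  ∀ S : ℕ → Submodule A M, Antitone S → ∃ n, ∀ i, n ≤ i → ∀ a ∈ S i, a ∈ N →
    ∃ t ∈ minReg A, t • a ∈ S (i + 1)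

theorem almostDCC [IsNoetherianRing A] [IsNoetherianRing Aᵐᵒᵖ] (M : Type*) [AddCommGroup M]
    [Module A M] [IsNoetherian A M] : AlmostDCC (⊤ : Submodule A M) := by
  obtain ⟨N, hN, hNmax⟩ := exists_maximal_of_noeth (fun N : Submodule A M => N)
    (fun N => AlmostDCC N) ⟨⊥, fun S _ => ⟨0, fun i _ a _ ha => ⟨1, one_mem_minReg, by
      rw [(Submodule.mem_bot A).1 ha, smul_zero]; exact Submodule.zero_mem _⟩⟩⟩
  by_cases htop : N = ⊤
  · exact htop ▸ hN
  exfalso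
  obtain ⟨m₀, -, hm₀⟩ := Set.not_subset.1 (fun h => htop (top_le_iff.1 h) : ¬ (⊤ : Submodule A M) ≤ N)
  let ann : M → Ideal A := fun m =>
    { carrier := {a | ∀ r : A, (a * r) • m ∈ N}
      add_mem' := fun {x y} hx hy r => by
        rw [add_mul, add_smul]; exact N.add_mem (hx r) (hy r)
      zero_mem' := fun r => by rw [zero_mul, zero_smul]; exact N.zero_mem
      smul_mem' := fun c x hx r => by
        rw [smul_eq_mul, mul_assoc, mul_smul]; exact N.smul_mem c (hx r) }
  obtain ⟨m, hm, hmax⟩ := exists_maximal_of_noeth ann (fun m => m ∉ N) ⟨m₀, hm₀⟩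
  set P := ann m with hPdef
  have hP : IsPrimeId P := by
    refine ⟨⟨fun {a} c ha r => by rw [mul_assoc]; exact ha _⟩, fun h => ?_, fun a c hac => ?_⟩
    · have h1 : (1 : A) ∈ P := h ▸ Submodule.mem_top
      exact hm (by simpa using h1 1)
    · by_contra! hcon
      have : ∃ r : A, (c * r) • m ∉ N := by
        by_contra! h
        exact hcon.2 h
      obtain ⟨r, hr⟩ := this
      have heq := hmax ((c * r) • m) hr fun x hx r' => by
        rw [← mul_smul, mul_assoc]; exact hx _
      apply hcon.1
      rw [← heq]
      intro r'
      have := hac r' r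
      rwa [← mul_smul, ← mul_assoc]
  have := hNmax (N ⊔ Submodule.span A {m}) ?_ le_sup_left
  · exact hm (this ▸ Submodule.mem_sup_right (Submodule.mem_span_singleton_self m))
  intro S hS
  obtain ⟨n₁, hn₁⟩ := hN S hS
  suffices h : ∃ n, ∀ i, n ≤ i → ∀ a ∈ S i, a ∈ N ⊔ Submodule.span A {m} →
      ∃ t ∈ minReg A, ∃ a' ∈ S (i + 1), t • a - a' ∈ N by
    obtain ⟨n₂, hn₂⟩ := h
    refine ⟨max n₁ n₂, fun i hi a ha haN => ?_⟩
    obtain ⟨t, ht, a', ha', htN⟩ := hn₂ i ((le_max_right _ _).trans hi) a ha haN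
    obtain ⟨t', ht', hta⟩ := hn₁ i ((le_max_left _ _).trans hi) (t • a - a')
      ((S i).sub_mem ((S i).smul_mem t ha) (hS (Nat.le_succ i) ha')) htN
    refine ⟨t' * t, mul_mem_minReg ht' ht, ?_⟩
    have := (S (i + 1)).add_mem hta ((S (i + 1)).smul_mem t' ha')
    rwa [← smul_add, sub_add_cancel, ← mul_smul] at this
  by_cases hmin : IsMinPrime P
  · let L : ℕ → Ideal A := fun i =>
      { carrier := {x | ∃ a ∈ S i, x • m - a ∈ N}
        add_mem' := by
          rintro x y ⟨a, ha, hxa⟩ ⟨b, hb, hyb⟩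
          refine ⟨a + b, (S i).add_mem ha hb, ?_⟩
          have := N.add_mem hxa hyb
          rwa [sub_add_sub_comm, ← add_smul] at this
        zero_mem' := ⟨0, (S i).zero_mem, by simp⟩
        smul_mem' := by
          rintro c x ⟨a, ha, hxa⟩
          refine ⟨c • a, (S i).smul_mem c ha, ?_⟩
          rw [smul_eq_mul, mul_smul, ← smul_sub]
          exact N.smul_mem c hxa }
    have hPL : ∀ i, P ≤ L i := fun i x hx => ⟨0, (S i).zero_mem, by simpa using hx 1⟩
    obtain ⟨n, hn⟩ := eventually_ess_of_antitone P L (fun i j hij x hx => by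
      obtain ⟨a, ha, hxa⟩ := hx
      exact ⟨a, hS hij ha, hxa⟩) hPL
    refine ⟨n, fun i hi a ha haN => ?_⟩
    obtain ⟨y, hy, z, hz, rfl⟩ := Submodule.mem_sup.1 haN
    obtain ⟨x, rfl⟩ := Submodule.mem_span_singleton.1 hz
    have hx : x ∈ L i := ⟨_, ha, by simpa using hy⟩
    obtain ⟨t, htK, ht⟩ := exists_mem_minReg (Submodule.comap (LinearMap.toSpanSingleton A A x) (L (i + 1)))
      (by
        have hmemK : ∀ r, r ∈ Submodule.comap (LinearMap.toSpanSingleton A A x) (L (i + 1)) ↔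
            r * x ∈ L (i + 1) := fun r => Iff.rfl
        intro P' hP' u hu
        by_cases huP : u * x ∈ P
        · exact ⟨1, by rw [one_mul, hmemK]; exact hPL _ huP, P', hP', by rwa [one_mul]⟩
        · obtain ⟨r, hr, hrP⟩ := hn i hi (u * x) ((L i).mul_mem_left _ hx) huP
          have hP2 := hP.1
          refine ⟨r, by rwa [hmemK, mul_assoc], P, hmin, fun h => hrP ?_⟩
          rw [← mul_assoc]
          exact P.mul_mem_right _ h)
    obtain ⟨a', ha', hta'⟩ : t * x ∈ L (i + 1) := htK
    refine ⟨t, ht, a', ha', ?_⟩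
    rw [smul_add, ← mul_smul, add_sub_assoc]
    exact N.add_mem (N.smul_mem t hy) hta'
  · obtain ⟨t, htP, ht⟩ := hP.exists_mem_minReg hmin
    refine ⟨0, fun i _ a _ haN => ⟨t, ht, 0, (S _).zero_mem, ?_⟩⟩
    obtain ⟨y, hy, z, hz, rfl⟩ := Submodule.mem_sup.1 haN
    obtain ⟨x, rfl⟩ := Submodule.mem_span_singleton.1 hz
    rw [sub_zero, smul_add, ← mul_smul]
    exact N.add_mem (N.smul_mem t hy) (htP x)

/-- Regular elements form a left Ore set. -/
theorem exists_mul_eq_mul [IsNoetherianRing A] [IsNoetherianRing Aᵐᵒᵖ] (a s : A)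
    (hs : IsRegular s) : ∃ b t : A, t ∈ minReg A ∧ t * a = b * s := by
  obtain ⟨n, hn⟩ := almostDCC (A := A) A (fun i => Ideal.span {s ^ i}) (fun i j hij =>
    Ideal.span_le.2 (Set.singleton_subset_iff.2 (Ideal.mem_span_singleton'.2
      ⟨s ^ (j - i), by rw [← pow_add, Nat.sub_add_cancel hij]⟩)))
  obtain ⟨t, ht, hta⟩ := hn n le_rfl (a * s ^ n)
    (Ideal.mul_mem_left _ _ (Ideal.mem_span_singleton_self _)) trivial
  obtain ⟨b, hb⟩ := Ideal.mem_span_singleton'.1 hta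
  refine ⟨b, t, ht, ?_⟩
  have hreg : IsRightRegular (s ^ n) := hs.right.pow n
  apply hreg
  change t * a * s ^ n = b * s * s ^ n
  rw [mul_assoc, mul_assoc b, ← pow_succ']
  exact hb.symm

theorem isArtinianRing_of_fractions [IsNoetherianRing A] [IsNoetherianRing Aᵐᵒᵖ] {Q : Type*}
    [Ring Q] (f : A →+* Q) (hf : ∀ t ∈ minReg A, IsUnit (f t))
    (hfrac : ∀ q : Q, ∃ a s, IsUnit (f s) ∧ f s * q = f a) : IsArtinianRing Q := by
  refine monotone_stabilizes_iff_artinian.1 fun I => ?_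
  let S : ℕ → Ideal A := fun i => Ideal.comap f (OrderDual.ofDual (I i))
  obtain ⟨n, hn⟩ := almostDCC (A := A) A S fun i j hij => Ideal.comap_mono (I.monotone hij)
  refine ⟨n, fun m hm => ?_⟩
  induction m, hm using Nat.le_induction with
  | base => rfl
  | succ m hm ih =>
    rw [ih]
    refine le_antisymm (I.monotone (Nat.le_succ m)) ?_
    change OrderDual.ofDual (I m) ≤ OrderDual.ofDual (I (m + 1))
    intro q hq
    obtain ⟨a, s, hs, hsa⟩ := hfrac q
    have ha : a ∈ S m := by
      change f a ∈ OrderDual.ofDual (I m)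
      rw [← hsa]
      exact Ideal.mul_mem_left _ _ hq
    obtain ⟨t, ht, hta⟩ := hn m hm a ha trivial
    have hta' : f (t * a) ∈ OrderDual.ofDual (I (m + 1)) := hta
    rw [map_mul] at hta'
    have h1 := (Ideal.unit_mul_mem_iff_mem _ (hf t ht)).1 hta'
    rw [← hsa] at h1
    exact (Ideal.unit_mul_mem_iff_mem _ hs).1 h1

end AlmostDCC

section Fractions

variable {A Q : Type u} [Ring A] [Ring Q]

/-- `f` exhibits its codomain as the two-sided ring of fractions at the regular elements. -/
structure IsFrac (f : A →+* Q) : Prop where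
  injective : Function.Injective f
  isUnit : ∀ s : A, IsRegular s → IsUnit (f s)
  right : ∀ q : Q, ∃ a s : A, IsRegular s ∧ q * f s = f a
  left : ∀ q : Q, ∃ a s : A, IsRegular s ∧ f s * q = f a
  exists_lift : ∀ (R : Type u) [Ring R] (g : A →+* R), (∀ s, IsRegular s → IsUnit (g s)) →
    ∃ G : Q →+* R, ∀ a, G (f a) = g a

theorem exists_isFrac
    (hl : ∀ (a s : A), IsRegular s → ∃ (b t : A), IsRegular t ∧ t * a = b * s)
    (hr : ∀ (a s : A), IsRegular s → ∃ (b t : A), IsRegular t ∧ a * t = s * b) :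
    ∃ (Q : Type u) (_ : Ring Q) (f : A →+* Q), IsFrac f := by
  let S : Submonoid A :=
    { carrier := {s | IsRegular s}
      one_mem' := isRegular_one
      mul_mem' := fun hs ht => hs.mul ht }
  obtain ⟨hS⟩ : Nonempty (OreLocalization.OreSet S) := by
    rw [OreLocalization.nonempty_oreSet_iff]
    refine ⟨fun r₁ r₂ s h => ⟨s, by rw [s.2.right h]⟩, fun r s => ?_⟩
    obtain ⟨b, t, ht, h⟩ := hl r s s.2
    exact ⟨b, ⟨t, ht⟩, h⟩
  let f : A →+* OreLocalization S A := OreLocalization.numeratorRingHom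
  have hf : ∀ a, f a = OreLocalization.numeratorHom a := fun _ => rfl
  have hu : ∀ s : A, IsRegular s → IsUnit (f s) := fun s hs =>
    OreLocalization.numerator_isUnit (⟨s, hs⟩ : S)
  have hleft : ∀ q : OreLocalization S A, ∃ a s : A, IsRegular s ∧ f s * q = f a := by
    intro q
    induction q using OreLocalization.ind with
    | _ r s =>
      refine ⟨r, s, s.2, ?_⟩
      rw [hf, hf, OreLocalization.numeratorHom_apply, OreLocalization.numeratorHom_apply,
        OreLocalization.mul_cancel]
  refine ⟨OreLocalization S A, inferInstance, f, ?_, hu, fun q => ?_, hleft, ?_⟩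
  · exact OreLocalization.numeratorHom_inj fun s hs x hx => by
      exact isLeftRegular_iff_right_eq_zero_of_mul.1 (IsRegular.left hs) x hx
  · obtain ⟨a, s, hs, h⟩ := hleft q
    obtain ⟨b, t, ht, hab⟩ := hr a s hs
    refine ⟨b, t, ht, (hu s hs).mul_left_cancel ?_⟩
    rw [← mul_assoc, h, ← map_mul, ← map_mul, hab]
  · intro R _ g hg
    let fS : S →* Rˣ :=
      { toFun := fun s => (hg s s.2).unit
        map_one' := by ext; simp
        map_mul' := fun s t => by ext; simp }
    exact ⟨OreLocalization.universalHom g fS fun s => rfl, fun a =>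
      OreLocalization.universalHom_commutes _ _ _⟩

theorem IsFrac.exists_common_right {f : A →+* Q} (hf : IsFrac f) {ι : Type*} (s : Finset ι)
    (q : ι → Q) : ∃ u, IsRegular u ∧ ∃ a : ι → A, ∀ i ∈ s, q i * f u = f (a i) := by
  classical
  induction s using Finset.induction_on with
  | empty => exact ⟨1, isRegular_one, 0, by simp⟩
  | insert i s hi ih =>
    obtain ⟨u, hu, a, ha⟩ := ih
    obtain ⟨b, v, hv, hbv⟩ := hf.right (q i)
    obtain ⟨c, t, ht, hct⟩ := hf.right ((hf.isUnit v hv).unit⁻¹ * f u)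
    have key : f (u * t) = f (v * c) := by
      rw [map_mul, map_mul, ← hct, ← mul_assoc, ← mul_assoc]
      simp
    refine ⟨u * t, hu.mul ht, fun j => if j = i then b * c else a j * t, fun j hj => ?_⟩
    beta_reduce
    by_cases hji : j = i
    · subst hji
      rw [if_pos rfl, key, map_mul, ← mul_assoc, hbv, map_mul]
    · rw [if_neg hji, map_mul, ← mul_assoc, ha j ((Finset.mem_insert.1 hj).resolve_left hji),
        map_mul]

theorem IsFrac.isUnit_map {f : A →+* Q} (hf : IsFrac f) [IsArtinianRing Qᵐᵒᵖ] {ι : Type*}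
    [Fintype ι] [DecidableEq ι] {φ ψ : A →+* Matrix ι ι A} (h : IsDualPair φ ψ) {s : A}
    (hs : IsRegular s) : IsUnit ((f.mapMatrix.comp φ) s) := by
  set X : Matrix ι ι Q := (f.mapMatrix.comp φ) s
  have hX : ∀ i j, X i j = f (φ s i j) := fun _ _ => rfl
  have hinj : ∀ v : ι → Q, X.mulVec v = 0 → v = 0 := by
    intro v hv
    obtain ⟨u, hu, a, ha⟩ := hf.exists_common_right Finset.univ v
    have h1 : s • (⟨a⟩ : Tw φ A) = 0 := by
      ext i
      apply hf.injective
      rw [Tw.smul_fn, Tw.zero_fn, map_zero, map_sum]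
      have h2 := congrFun hv i
      rw [Matrix.mulVec, dotProduct, Pi.zero_apply] at h2
      calc ∑ j, f (φ s i j • a j) = ∑ j, (X i j * v j) * f u :=
            Finset.sum_congr rfl fun j _ => by
              rw [smul_eq_mul, map_mul, ← ha j (Finset.mem_univ j), hX, mul_assoc]
        _ = 0 := by rw [← Finset.sum_mul, h2, zero_mul]
    have h3 : s • h.equiv.symm ⟨a⟩ = 0 := by rw [← map_smul, h1, map_zero]
    have h4 : h.equiv.symm ⟨a⟩ = 0 := by
      funext i
      exact isLeftRegular_iff_right_eq_zero_of_mul.1 hs.left _ (congrFun h3 i)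
    have h5 : (⟨a⟩ : Tw φ A) = 0 := by simpa using h4
    funext i
    have h6 : a i = 0 := congrFun (congrArg Tw.fn h5) i
    refine (hf.isUnit u hu).mul_right_cancel ?_
    rw [ha i (Finset.mem_univ i), h6, map_zero, Pi.zero_apply, zero_mul]
  have _ : IsArtinian Qᵐᵒᵖ Q :=
    isArtinian_of_linearEquiv (MulOpposite.opLinearEquiv Qᵐᵒᵖ : Q ≃ₗ[Qᵐᵒᵖ] Qᵐᵒᵖ).symm
  let L : (ι → Q) →ₗ[Qᵐᵒᵖ] (ι → Q) :=
    { toFun := X.mulVec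
      map_add' := X.mulVec_add
      map_smul' := fun c v => X.mulVec_smul c v }
  have hsurj : Function.Surjective L := IsArtinian.surjective_of_injective_endomorphism L
    ((injective_iff_map_eq_zero L).2 hinj)
  choose Y hY using fun j : ι => hsurj (Pi.single j 1)
  have hXY : X * Matrix.of (fun i j => Y j i) = 1 := by
    ext i j
    have := congrFun (hY j) i
    change X.mulVec (Y j) i = _ at this
    rw [Matrix.mulVec, dotProduct] at this
    rw [Matrix.mul_apply, Matrix.one_apply]
    simp only [Matrix.of_apply]
    rw [this, Pi.single_apply]
  have hYX : Matrix.of (fun i j => Y j i) * X = 1 := by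
    rw [← sub_eq_zero]
    ext i j
    have h1 : X * (Matrix.of (fun i j => Y j i) * X - 1) = 0 := by
      rw [mul_sub, ← mul_assoc, hXY, one_mul, mul_one, sub_self]
    have := hinj (fun i => (Matrix.of (fun i j => Y j i) * X - 1) i j) (by
      funext i
      have h2 := congrFun (congrFun h1 i) j
      rw [Matrix.mul_apply] at h2
      exact h2)
    exact congrFun this i
  exact ⟨⟨X, _, hXY, hYX⟩, rfl⟩

/-- Extension of a dual pair to the ring of fractions. -/
theorem IsFrac.isDualPair {f : A →+* Q} (hf : IsFrac f) {ι : Type*}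
    [Fintype ι] [DecidableEq ι] {φ ψ : A →+* Matrix ι ι A} (h : IsDualPair φ ψ)
    {Φ Ψ : Q →+* Matrix ι ι Q} (hΦ : ∀ a, Φ (f a) = f.mapMatrix (φ a))
    (hΨ : ∀ a, Ψ (f a) = f.mapMatrix (ψ a)) : IsDualPair Φ Ψ := by
  have hΦ' : ∀ a i j, Φ (f a) i j = f (φ a i j) := fun a i j => by rw [hΦ]; rfl
  have hΨ' : ∀ a i j, Ψ (f a) i j = f (ψ a i j) := fun a i j => by rw [hΨ]; rfl
  constructor
  · have hmul : ∀ q q', (∀ i l, ∑ j, Φ (Ψ q' i j) l j = if i = l then q' else 0) →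
        ∀ i l, ∑ j, Φ (Ψ (q * q') i j) l j = (∑ j, Φ (Ψ q i j) l j) * q' := by
      intro q q' hq' i l
      calc ∑ j, Φ (Ψ (q * q') i j) l j
          = ∑ j, ∑ m, ∑ p, Φ (Ψ q i m) l p * Φ (Ψ q' m j) p j := by
            refine Finset.sum_congr rfl fun j _ => ?_
            rw [map_mul, Matrix.mul_apply, map_sum, Matrix.sum_apply]
            refine Finset.sum_congr rfl fun m _ => ?_
            rw [map_mul, Matrix.mul_apply]
        _ = ∑ m, ∑ p, Φ (Ψ q i m) l p * ∑ j, Φ (Ψ q' m j) p j := by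
            rw [Finset.sum_comm]
            refine Finset.sum_congr rfl fun m _ => ?_
            rw [Finset.sum_comm]
            exact Finset.sum_congr rfl fun p _ => (Finset.mul_sum _ _ _).symm
        _ = _ := by
            rw [Finset.sum_mul]
            refine Finset.sum_congr rfl fun m _ => ?_
            simp [hq']
    have hA : ∀ a i l, ∑ j, Φ (Ψ (f a) i j) l j = if i = l then f a else 0 := by
      intro a i l
      have := congrArg f (h.left i l a)
      simpa [hΦ', hΨ', apply_ite f] using this
    intro i l q
    obtain ⟨a, s, hs, hsa⟩ := hf.left q
    have hq : q = ↑(hf.isUnit s hs).unit⁻¹ * f a := by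
      rw [← hsa, ← mul_assoc, IsUnit.val_inv_mul, one_mul]
    have h1 := hmul ↑(hf.isUnit s hs).unit⁻¹ (f s) (hA s) i l
    rw [IsUnit.val_inv_mul, ← map_one f, hA, map_one] at h1
    have h2 : ∑ j, Φ (Ψ ↑(hf.isUnit s hs).unit⁻¹ i j) l j =
        if i = l then ↑(hf.isUnit s hs).unit⁻¹ else 0 := by
      refine (hf.isUnit s hs).mul_right_cancel ?_
      rw [← h1]
      split_ifs <;> simp
    rw [hq, hmul _ _ (hA a), h2]
    split_ifs <;> simp
  · have hmul : ∀ q q', (∀ i l, ∑ j, Ψ (Φ q j i) j l = if i = l then q else 0) →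
        ∀ i l, ∑ j, Ψ (Φ (q * q') j i) j l = q * (∑ j, Ψ (Φ q' j i) j l) := by
      intro q q' hq i l
      calc ∑ j, Ψ (Φ (q * q') j i) j l
          = ∑ j, ∑ m, ∑ p, Ψ (Φ q j m) j p * Ψ (Φ q' m i) p l := by
            refine Finset.sum_congr rfl fun j _ => ?_
            rw [map_mul, Matrix.mul_apply, map_sum, Matrix.sum_apply]
            refine Finset.sum_congr rfl fun m _ => ?_
            rw [map_mul, Matrix.mul_apply]
        _ = ∑ m, ∑ p, (∑ j, Ψ (Φ q j m) j p) * Ψ (Φ q' m i) p l := by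
            rw [Finset.sum_comm]
            refine Finset.sum_congr rfl fun m _ => ?_
            rw [Finset.sum_comm]
            exact Finset.sum_congr rfl fun p _ => (Finset.sum_mul _ _ _).symm
        _ = _ := by
            rw [Finset.mul_sum]
            refine Finset.sum_congr rfl fun m _ => ?_
            simp [hq]
    have hA : ∀ a i l, ∑ j, Ψ (Φ (f a) j i) j l = if i = l then f a else 0 := by
      intro a i l
      have := congrArg f (h.right i l a)
      simpa [hΦ', hΨ', apply_ite f] using this
    intro i l q
    obtain ⟨a, s, hs, hsa⟩ := hf.left q
    have h1 := hmul (f s) q (hA s) i l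
    rw [hsa, hA] at h1
    refine (hf.isUnit s hs).mul_left_cancel ?_
    rw [← h1, ← hsa]
    split_ifs <;> simp

theorem IsFrac.exists_extension {f : A →+* Q} (hf : IsFrac f) [IsArtinianRing Qᵐᵒᵖ] {ι : Type}
    [Fintype ι] [DecidableEq ι] (φ : A →+* Matrix ι ι A)
    (h : ∀ s, IsRegular s → IsUnit (f.mapMatrix.comp φ s)) :
    ∃ Φ : Q →+* Matrix ι ι Q, ∀ a, Φ (f a) = f.mapMatrix (φ a) :=
  hf.exists_lift (Matrix ι ι Q) (f.mapMatrix.comp φ) h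

theorem IsFrac.op {f : A →+* Q} (hf : IsFrac f) : IsFrac (RingHom.op f) where
  injective x y h :=
    MulOpposite.unop_injective (hf.injective (MulOpposite.op_injective h))
  isUnit s hs := (hf.isUnit s.unop (by simpa using hs)).op
  right q := by
    obtain ⟨a, s, hs, h⟩ := hf.left q.unop
    exact ⟨MulOpposite.op a, MulOpposite.op s, by simpa using hs, MulOpposite.unop_injective h⟩
  left q := by
    obtain ⟨a, s, hs, h⟩ := hf.right q.unop
    exact ⟨MulOpposite.op a, MulOpposite.op s, by simpa using hs, MulOpposite.unop_injective h⟩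
  exists_lift R _ g hg := by
    let g' : A →+* Rᵐᵒᵖ :=
      { toFun := fun a => MulOpposite.op (g (MulOpposite.op a))
        map_one' := by simp
        map_mul' := by simp
        map_zero' := by simp
        map_add' := by simp }
    obtain ⟨G, hG⟩ := hf.exists_lift Rᵐᵒᵖ g' fun s hs =>
      (hg (MulOpposite.op s) (by simpa using hs)).op
    refine ⟨{ toFun := fun q => (G q.unop).unop
              map_one' := by simp
              map_mul' := by simp
              map_zero' := by simp
              map_add' := by simp }, fun a => ?_⟩
    exact congrArg MulOpposite.unop (hG a.unop)

/-- A twist with a predual carries regular elements to units over the ring of fractions. -/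
theorem IsFrac.isUnit_map_right {f : A →+* Q} (hf : IsFrac f) [IsArtinianRing Q] {ι : Type*}
    [Fintype ι] [DecidableEq ι] {φ ψ : A →+* Matrix ι ι A} (h : IsDualPair φ ψ) {s : A}
    (hs : IsRegular s) : IsUnit ((f.mapMatrix.comp ψ) s) := by
  have _ : IsArtinianRing Qᵐᵒᵖᵐᵒᵖ := (RingEquiv.opOp Q).surjective.isArtinianRing
  obtain ⟨⟨X, Y, hXY, hYX⟩, hX⟩ := hf.op.isUnit_map h.opTwist
    (s := MulOpposite.op s) (by simpa using hs)
  change X = _ at hX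
  have hX' : ∀ i j, (X i j).unop = f (ψ s j i) := fun i j => by rw [hX]; rfl
  refine ⟨⟨_, Matrix.of fun i j => (Y j i).unop, ?_, ?_⟩, rfl⟩
  · ext i j
    have := congrArg MulOpposite.unop (congrFun (congrFun hYX j) i)
    rw [Matrix.mul_apply, Finset.unop_sum, Matrix.one_apply, apply_ite MulOpposite.unop] at this
    rw [Matrix.mul_apply, Matrix.one_apply]
    simpa [hX', eq_comm (a := j)] using this
  · ext i j
    have := congrArg MulOpposite.unop (congrFun (congrFun hXY j) i)
    rw [Matrix.mul_apply, Finset.unop_sum, Matrix.one_apply, apply_ite MulOpposite.unop] at this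
    rw [Matrix.mul_apply, Matrix.one_apply]
    simpa [hX', eq_comm (a := j)] using this

/-- `T'` extends `T` along `f`. -/
theorem IsFrac.exists_triple {f : A →+* Q} (hf : IsFrac f) [IsArtinianRing Q]
    [IsArtinianRing Qᵐᵒᵖ] (T : DualTriple A) :
    ∃ Φ₀ Φ₁ Φ₂ : Q →+* Matrix T.ι T.ι Q, IsDualPair Φ₀ Φ₁ ∧ IsDualPair Φ₁ Φ₂ ∧
      (∀ a, Φ₀ (f a) = f.mapMatrix (T.φ₀ a)) ∧ ∀ a, Φ₂ (f a) = f.mapMatrix (T.φ₂ a) := by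
  obtain ⟨Φ₀, h₀⟩ := hf.exists_extension T.φ₀ fun s hs => hf.isUnit_map T.dual₀₁ hs
  obtain ⟨Φ₁, h₁⟩ := hf.exists_extension T.φ₁ fun s hs => hf.isUnit_map T.dual₁₂ hs
  obtain ⟨Φ₂, h₂⟩ := hf.exists_extension T.φ₂ fun s hs => hf.isUnit_map_right T.dual₁₂ hs
  exact ⟨Φ₀, Φ₁, Φ₂, hf.isDualPair T.dual₀₁ h₀ h₁, hf.isDualPair T.dual₁₂ h₁ h₂, h₀, h₂⟩

/-- The set of elements whose twist has entries in `𝔞`. -/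
def twistKer {ι : Type*} [Fintype ι] [DecidableEq ι] (Φ : Q →+* Matrix ι ι Q) (𝔞 : Ideal Q) :
    Ideal Q where
  carrier := {q | ∀ i j, Φ q i j ∈ 𝔞}
  add_mem' := fun {x y} hx hy i j => by
    rw [map_add]; exact 𝔞.add_mem (hx i j) (hy i j)
  zero_mem' := fun i j => by rw [map_zero]; exact 𝔞.zero_mem
  smul_mem' := fun c x hx i j => by
    rw [smul_eq_mul, map_mul, Matrix.mul_apply]
    exact 𝔞.sum_mem fun l _ => 𝔞.mul_mem_left _ (hx l j)

theorem mem_twistKer {ι : Type*} [Fintype ι] [DecidableEq ι] {Φ : Q →+* Matrix ι ι Q}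
    {𝔞 : Ideal Q} {q : Q} : q ∈ twistKer Φ 𝔞 ↔ ∀ i j, Φ q i j ∈ 𝔞 := Iff.rfl

/-- A twist is irreducible if its entries generate the unit ideal on every nonzero element. -/
def IsIrredTwist {ι : Type*} [Fintype ι] [DecidableEq ι] (Φ : Q →+* Matrix ι ι Q) : Prop :=
  ∀ 𝔞 : Ideal Q, 𝔞.IsTwoSided → 𝔞 ≠ ⊤ → ∀ q ∈ twistKer Φ 𝔞, q = 0

theorem IsFrac.mem_twistKer_iff {f : A →+* Q} (hf : IsFrac f) {ι : Type*}
    [Fintype ι] [DecidableEq ι] {φ : A →+* Matrix ι ι A} {Φ : Q →+* Matrix ι ι Q}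
    (h : ∀ a, Φ (f a) = f.mapMatrix (φ a)) {𝔞 : Ideal Q} {q : Q} {a s : A} (hs : IsRegular s)
    (hq : f s * q = f a) : q ∈ twistKer Φ 𝔞 ↔ ∀ i j, f (φ a i j) ∈ 𝔞 := by
  have h1 : f a ∈ twistKer Φ 𝔞 ↔ ∀ i j, f (φ a i j) ∈ 𝔞 := by
    rw [mem_twistKer, h]; rfl
  rw [← h1, ← hq]
  refine ⟨fun h2 => (twistKer Φ 𝔞).mul_mem_left _ h2, fun h2 => ?_⟩
  have := (twistKer Φ 𝔞).mul_mem_left ↑(hf.isUnit s hs).unit⁻¹ h2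
  rwa [← mul_assoc, IsUnit.val_inv_mul, one_mul] at this

end Fractions

section Select

variable {A Q : Type u} [Ring A] [Ring Q]

theorem exists_maximal_twoSided [IsNoetherianRing Q] (𝔞 : Ideal Q) (h2 : 𝔞.IsTwoSided)
    (hne : 𝔞 ≠ ⊤) : ∃ 𝔪 : Ideal Q, 𝔞 ≤ 𝔪 ∧ 𝔪.IsTwoSided ∧ 𝔪 ≠ ⊤ ∧
      ∀ J : Ideal Q, J.IsTwoSided → J ≠ ⊤ → 𝔪 ≤ J → J = 𝔪 := by
  obtain ⟨𝔪, ⟨h1, h2, h3⟩, h4⟩ := exists_maximal_of_noeth (fun I : Ideal Q => I)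
    (fun I => 𝔞 ≤ I ∧ I.IsTwoSided ∧ I ≠ ⊤) ⟨𝔞, le_rfl, h2, hne⟩
  exact ⟨𝔪, h1, h2, h3, fun J hJ hJ' hle => h4 J ⟨h1.trans hle, hJ, hJ'⟩ hle⟩

theorem isPrimeId_of_maximal {𝔪 : Ideal Q} (h2 : 𝔪.IsTwoSided) (hne : 𝔪 ≠ ⊤)
    (hmax : ∀ J : Ideal Q, J.IsTwoSided → J ≠ ⊤ → 𝔪 ≤ J → J = 𝔪) : IsPrimeId 𝔪 := by
  refine ⟨h2, hne, fun a b hab => ?_⟩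
  by_contra! hcon
  -- the two-sided ideal of elements killing `b` modulo `𝔪`
  let J : Ideal Q :=
    { carrier := {x | ∀ r, x * r * b ∈ 𝔪}
      add_mem' := fun {x y} hx hy r => by
        rw [add_mul, add_mul]; exact 𝔪.add_mem (hx r) (hy r)
      zero_mem' := fun r => by simp
      smul_mem' := fun c x hx r => by
        rw [smul_eq_mul, mul_assoc c, mul_assoc c]; exact 𝔪.mul_mem_left _ (hx r) }
  have hJ : ∀ x, x ∈ J ↔ ∀ r, x * r * b ∈ 𝔪 := fun _ => Iff.rfl
  have hJ2 : J.IsTwoSided := ⟨fun {x} c hx r => by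
    rw [mul_assoc x]; exact hx _⟩
  have := hmax J hJ2 (fun ht => hcon.2 (by
    simpa using (hJ 1).1 (ht ▸ Submodule.mem_top) 1)) fun x hx r => by
      rw [mul_assoc]; exact 𝔪.mul_mem_right _ hx
  exact hcon.1 (this ▸ (hJ a).2 hab)

theorem exists_finset_maximal [IsArtinianRing Q] : ∃ 𝒮 : Finset (Ideal Q),
    (∀ 𝔪 ∈ 𝒮, 𝔪.IsTwoSided ∧ 𝔪 ≠ ⊤) ∧
      ∀ 𝔞 : Ideal Q, 𝔞.IsTwoSided → 𝔞 ≠ ⊤ → ∃ 𝔪 ∈ 𝒮, 𝔞 ≤ 𝔪 := by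
  classical
  let p : Ideal Q → Prop := fun 𝔪 => 𝔪.IsTwoSided ∧ 𝔪 ≠ ⊤ ∧
    ∀ J : Ideal Q, J.IsTwoSided → J ≠ ⊤ → 𝔪 ≤ J → J = 𝔪
  obtain ⟨W, ⟨𝒮, h𝒮, rfl⟩, hW⟩ := IsArtinian.set_has_minimal
    {W : Ideal Q | ∃ 𝒮 : Finset (Ideal Q), (∀ 𝔪 ∈ 𝒮, p 𝔪) ∧ 𝒮.inf id = W}
    ⟨_, ∅, by simp, rfl⟩
  refine ⟨𝒮, fun 𝔪 h => ⟨(h𝒮 𝔪 h).1, (h𝒮 𝔪 h).2.1⟩, fun 𝔞 h2 hne => ?_⟩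
  obtain ⟨𝔪, hle, hp⟩ := exists_maximal_twoSided 𝔞 h2 hne
  suffices h : 𝔪 ∈ 𝒮 from ⟨𝔪, h, hle⟩
  have h1 : 𝒮.inf id ≤ 𝔪 := by
    have := hW _ ⟨insert 𝔪 𝒮, by
      intro x hx
      rcases Finset.mem_insert.1 hx with rfl | hx
      · exact hp
      · exact h𝒮 x hx, rfl⟩
    rw [Finset.inf_insert, id, inf_lt_right] at this
    exact not_not.1 this
  have hprime := isPrimeId_of_maximal hp.1 hp.2.1 hp.2.2
  have key : ∀ 𝒯 : Finset (Ideal Q), (∀ P ∈ 𝒯, P.IsTwoSided) → 𝒯.inf id ≤ 𝔪 →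
      ∃ P ∈ 𝒯, P ≤ 𝔪 := by
    intro 𝒯
    induction 𝒯 using Finset.induction_on with
    | empty => exact fun _ h => absurd (top_le_iff.1 h) hp.2.1
    | insert P 𝒯 hP ih =>
      intro h2 hle
      by_contra! hcon
      obtain ⟨x, hxP, hx⟩ := SetLike.not_le_iff_exists.1 (hcon P (Finset.mem_insert_self _ _))
      have h3 : ¬ 𝒯.inf id ≤ 𝔪 := fun h => by
        obtain ⟨P', hP', h'⟩ := ih (fun P hP => h2 P (Finset.mem_insert_of_mem hP)) h
        exact hcon P' (Finset.mem_insert_of_mem hP') h'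
      obtain ⟨y, hyP, hy⟩ := SetLike.not_le_iff_exists.1 h3
      refine (hprime.2.2 x y fun r => hle ?_).elim hx hy
      rw [Finset.inf_insert]
      have := h2 P (Finset.mem_insert_self _ _)
      exact ⟨by rw [mul_assoc]; exact P.mul_mem_right _ hxP, Ideal.mul_mem_left _ _ hyP⟩
  obtain ⟨P, hP, hle⟩ := key 𝒮 (fun P hP => (h𝒮 P hP).1) h1
  rwa [(h𝒮 P hP).2.2 𝔪 hp.1 hp.2.1 hle]

/-- A good family on `A` has a member that becomes irreducible over an artinian ring of
fractions. -/
theorem IsFrac.exists_irred {f : A →+* Q} (hf : IsFrac f) [IsArtinianRing Q]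
    [IsArtinianRing Qᵐᵒᵖ] {𝓕 : Set (DualTriple A)} (h𝓕 : IsGoodFamily 𝓕) :
    ∃ T : DualTriple Q, IsIrredTwist T.φ₀ ∧ IsIrredTwist T.φ₂ := by
  classical
  choose Φ₀ Φ₁ Φ₂ d₀₁ d₁₂ h₀ h₂ using fun T : DualTriple A => hf.exists_triple T
  obtain ⟨𝒮, h𝒮, hmax⟩ := exists_finset_maximal (Q := Q)
  let K : DualTriple A → Submodule Q (𝒮 × Bool → Q) := fun T =>
    Submodule.pi Set.univ fun p => if p.2 then twistKer (Φ₀ T) p.1 else twistKer (Φ₂ T) p.1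
  obtain ⟨_, ⟨T, hT, rfl⟩, hmin⟩ := IsArtinian.set_has_minimal (K '' 𝓕) (h𝓕.nonempty.image K)
  have hK : ∀ T p, p ∈ K T ↔ ∀ 𝔪 : 𝒮, p (𝔪, true) ∈ twistKer (Φ₀ T) 𝔪.1 ∧
      p (𝔪, false) ∈ twistKer (Φ₂ T) 𝔪.1 := by
    intro T p
    simp [K, Submodule.mem_pi, and_comm]
  have key : ∀ T₁ ∈ 𝓕, K T ≤ K T₁ := by
    intro T₁ hT₁
    obtain ⟨T₂, hT₂, ⟨e₁, he₁⟩, e, he⟩ := h𝓕.directed T₁ hT₁ T hT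
    have hle : ∀ (T' : DualTriple A) (e : T'.ι → T₂.ι) (he : ∀ x i j,
        T'.φ₀ x i j = T₂.φ₀ x (e i) (e j) ∧ T'.φ₂ x i j = T₂.φ₂ x (e i) (e j)),
        K T₂ ≤ K T' := by
      intro T' e he p hp
      rw [hK] at hp ⊢
      intro 𝔪
      obtain ⟨a, s, hs, ha⟩ := hf.left (p (𝔪, true))
      obtain ⟨b, t, ht, hb⟩ := hf.left (p (𝔪, false))
      have hp := hp 𝔪
      rw [hf.mem_twistKer_iff (h₀ T₂) hs ha, hf.mem_twistKer_iff (h₂ T₂) ht hb] at hp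
      rw [hf.mem_twistKer_iff (h₀ T') hs ha, hf.mem_twistKer_iff (h₂ T') ht hb]
      refine ⟨fun i j => ?_, fun i j => ?_⟩
      · rw [(he a i j).1]; exact hp.1 _ _
      · rw [(he b i j).2]; exact hp.2 _ _
    rcases (hle T e he).lt_or_eq with hlt | heq
    · exact absurd hlt (hmin _ ⟨T₂, hT₂, rfl⟩)
    · rw [← heq]; exact hle T₁ e₁ he₁
  have hcomap : ∀ 𝔪 : Ideal Q, 𝔪.IsTwoSided → 𝔪 ≠ ⊤ →
      (Ideal.comap f 𝔪).IsTwoSided ∧ Ideal.comap f 𝔪 ≠ ⊤ := by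
    intro 𝔪 h hne
    exact ⟨inferInstance, Ideal.comap_ne_top f hne⟩
  have hzero : ∀ p ∈ K T, p = 0 := by
    intro p hp
    funext ⟨𝔪, b⟩
    obtain ⟨hm1, hm2⟩ := h𝒮 𝔪 𝔪.2
    obtain ⟨hc1, hc2⟩ := hcomap 𝔪 hm1 hm2
    obtain ⟨a, s, hs, ha⟩ := hf.left (p (𝔪, b))
    have ha0 : a = 0 := by
      cases b with
      | true =>
        refine h𝓕.faithful₀ _ hc1 hc2 a fun T₁ hT₁ i j => ?_
        have := ((hK _ _).1 (key T₁ hT₁ hp) 𝔪).1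
        exact (hf.mem_twistKer_iff (h₀ T₁) hs ha).1 this i j
      | false =>
        refine h𝓕.faithful₂ _ hc1 hc2 a fun T₁ hT₁ i j => ?_
        have := ((hK _ _).1 (key T₁ hT₁ hp) 𝔪).2
        exact (hf.mem_twistKer_iff (h₂ T₁) hs ha).1 this i j
    refine (hf.isUnit s hs).mul_left_cancel ?_
    rw [ha, ha0, map_zero, Pi.zero_apply, mul_zero]
  refine ⟨⟨T.ι, Φ₀ T, Φ₁ T, Φ₂ T, d₀₁ T, d₁₂ T⟩, fun 𝔞 h2 hne q hq => ?_,
    fun 𝔞 h2 hne q hq => ?_⟩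
  · obtain ⟨𝔪, hm, hle⟩ := hmax 𝔞 h2 hne
    have := hzero (Pi.single (⟨𝔪, hm⟩, true) q) ((hK _ _).2 fun 𝔪' => by
      by_cases h : 𝔪' = ⟨𝔪, hm⟩
      · subst h
        simpa [Pi.single_apply, mem_twistKer] using fun i j => hle (hq i j)
      · simp [h])
    simpa using congrFun this (⟨𝔪, hm⟩, true)
  · obtain ⟨𝔪, hm, hle⟩ := hmax 𝔞 h2 hne
    have := hzero (Pi.single (⟨𝔪, hm⟩, false) q) ((hK _ _).2 fun 𝔪' => by
      by_cases h : 𝔪' = ⟨𝔪, hm⟩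
      · subst h
        simpa [Pi.single_apply, mem_twistKer] using fun i j => hle (hq i j)
      · simp [h])
    simpa using congrFun this (⟨𝔪, hm⟩, false)

/-- Irreducibility passes to the opposite twist. -/
theorem IsIrredTwist.opTwist {ι : Type*} [Fintype ι] [DecidableEq ι] {φ : Q →+* Matrix ι ι Q}
    (h : IsIrredTwist φ) : IsIrredTwist (opTwist φ) := by
  intro 𝔞 h2 hne q hq
  have := h _ (isTwoSided_unopIdeal 𝔞 h2) (unopIdeal_ne_top hne) q.unop fun i j => hq j i
  simpa using this

end Select

section AddLength

variable {R : Type u} [Ring R]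

/-- An additive nonnegative function on finitely generated modules. -/
structure IsAddLength (R : Type u) [Ring R]
    (μ : ∀ (M : Type u) [AddCommGroup M] [Module R M], ℝ) : Prop where
  nonneg : ∀ (M : Type u) [AddCommGroup M] [Module R M] [Module.Finite R M], 0 ≤ μ M
  add : ∀ (N M P : Type u) [AddCommGroup N] [Module R N] [AddCommGroup M] [Module R M]
    [AddCommGroup P] [Module R P] [Module.Finite R M] (f : N →ₗ[R] M) (g : M →ₗ[R] P),
    Function.Injective f → Function.Surjective g → Function.Exact f g → μ M = μ N + μ P

namespace IsAddLength

variable {μ : ∀ (M : Type u) [AddCommGroup M] [Module R M], ℝ} (hμ : IsAddLength R μ)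
  {M N : Type u} [AddCommGroup M] [Module R M] [AddCommGroup N] [Module R N]

include hμ

theorem punit : μ PUnit.{u + 1} = 0 := by
  have := hμ.add PUnit PUnit PUnit (0 : PUnit.{u + 1} →ₗ[R] PUnit.{u + 1})
    (0 : PUnit.{u + 1} →ₗ[R] PUnit.{u + 1})
    (fun _ _ _ => rfl) (fun _ => ⟨0, rfl⟩) (fun y => ⟨fun _ => ⟨0, rfl⟩, fun _ => rfl⟩)
  linarith

theorem equiv [Module.Finite R N] (e : M ≃ₗ[R] N) : μ M = μ N := by
  have := hμ.add M N PUnit e.toLinearMap 0 e.injective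
    (fun _ => ⟨0, rfl⟩) (fun y => ⟨fun _ => ⟨e.symm y, by simp⟩, fun _ => rfl⟩)
  rw [hμ.punit, add_zero] at this
  exact this.symm

theorem sub [Module.Finite R M] (p : Submodule R M) : μ M = μ p + μ (M ⧸ p) :=
  hμ.add p M (M ⧸ p) p.subtype p.mkQ p.injective_subtype p.mkQ_surjective
    (LinearMap.exact_subtype_mkQ p)

theorem le_of_injective [Module.Finite R N] (f : M →ₗ[R] N)
    (hf : Function.Injective f) : μ M ≤ μ N := by
  have h1 := hμ.add M N (N ⧸ LinearMap.range f) f (LinearMap.range f).mkQ hf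
    (Submodule.mkQ_surjective _) (LinearMap.exact_map_mkQ_range f)
  have h2 := hμ.nonneg (N ⧸ LinearMap.range f)
  linarith

theorem le_of_surjective [IsNoetherianRing R] [Module.Finite R M] (f : M →ₗ[R] N)
    (hf : Function.Surjective f) : μ N ≤ μ M := by
  have h1 := hμ.add (LinearMap.ker f) M N (LinearMap.ker f).subtype f
    (Submodule.injective_subtype _) hf (LinearMap.exact_subtype_ker_map f)
  have h2 := hμ.nonneg (LinearMap.ker f)
  linarith

theorem prod [Module.Finite R M] [Module.Finite R N] : μ (M × N) = μ M + μ N :=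
  hμ.add M (M × N) N (LinearMap.inl R M N) (LinearMap.snd R M N) LinearMap.inl_injective
    LinearMap.snd_surjective Function.Exact.inl_snd

theorem pi_fin [Module.Finite R M] (n : ℕ) : μ (Fin n → M) = n * μ M := by
  induction n with
  | zero =>
    rw [hμ.equiv (N := PUnit.{u + 1}) ⟨0, fun _ => 0, fun _ => Subsingleton.elim _ _,
      fun _ => rfl⟩, hμ.punit]
    simp
  | succ n ih =>
    rw [← hμ.equiv (Fin.consLinearEquiv R fun _ : Fin (n + 1) => M), hμ.prod, ih]
    push_cast
    ring

theorem pi {κ : Type} [Fintype κ] [Module.Finite R M] :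
    μ (κ → M) = Fintype.card κ * μ M := by
  rw [hμ.equiv (LinearEquiv.funCongrLeft R M (Fintype.equivFin κ).symm), hμ.pi_fin]

end IsAddLength

theorem isAddLength_length [IsArtinianRing R] :
    IsAddLength R fun M _ _ => ((Module.length R M).toNat : ℝ) where
  nonneg _ _ _ _ := Nat.cast_nonneg _
  add N M P _ _ _ _ _ _ _ f g hf hg h := by
    have h1 := Module.length_eq_add_of_exact f g hf hg h
    have h2 : Module.length R M ≠ ⊤ := Module.length_ne_top
    rw [← Nat.cast_add, ← ENat.toNat_add, h1]
    · intro h3; rw [h1, h3] at h2; simp at h2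
    · intro h3; rw [h1, h3] at h2; simp at h2

end AddLength

section TwFunctor

variable {A B ι : Type*} [Ring A] [Ring B] [Fintype ι] [DecidableEq ι] (φ : A →+* Matrix ι ι B)
  {M N P : Type*} [AddCommGroup M] [Module B M] [AddCommGroup N] [Module B N]
  [AddCommGroup P] [Module B P]

namespace Tw

/-- Functoriality of the twist. -/
def map (f : M →ₗ[B] N) : Tw φ M →ₗ[A] Tw φ N where
  toFun x := ⟨fun i => f (x.fn i)⟩
  map_add' x y := by
    ext i
    simp [add_fn]
  map_smul' a x := by
    ext i
    simp [smul_fn]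

theorem map_injective {f : M →ₗ[B] N} (hf : Function.Injective f) :
    Function.Injective (map φ f) := fun x y h => by
  ext i
  exact hf (congrFun (congrArg Tw.fn h) i)

theorem map_surjective {f : M →ₗ[B] N} (hf : Function.Surjective f) :
    Function.Surjective (map φ f) := fun y => by
  choose g hg using fun i => hf (y.fn i)
  exact ⟨⟨g⟩, by ext i; exact hg i⟩

theorem map_exact {f : M →ₗ[B] N} {g : N →ₗ[B] P} (h : Function.Exact f g) :
    Function.Exact (map φ f) (map φ g) := fun y => by
  constructor
  · intro hy
    choose x hx using fun i => (h (y.fn i)).1 (congrFun (congrArg Tw.fn hy) i)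
    exact ⟨⟨x⟩, by ext i; exact hx i⟩
  · rintro ⟨x, rfl⟩
    ext i
    exact (h _).2 ⟨x.fn i, rfl⟩

/-- The twist commutes with finite powers. -/
def piEquiv (κ : Type*) : Tw φ (κ → M) ≃ₗ[A] (κ → Tw φ M) where
  toFun x := fun c => ⟨fun i => x.fn i c⟩
  invFun y := ⟨fun i c => (y c).fn i⟩
  left_inv _ := rfl
  right_inv _ := rfl
  map_add' _ _ := rfl
  map_smul' a x := by
    funext c
    ext i
    simp [smul_fn]

end Tw

theorem IsDualPair.finite {φ ψ : A →+* Matrix ι ι A} (h : IsDualPair φ ψ) (M : Type*)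
    [AddCommGroup M] [Module A M] [Module.Finite A M] : Module.Finite A (Tw φ M) := by
  obtain ⟨n, f, hf⟩ := Module.Finite.exists_fin' A M
  have _ : Module.Finite A (Tw φ A) := Module.Finite.equiv h.equiv
  have _ : Module.Finite A (Tw φ (Fin n → A)) :=
    Module.Finite.equiv (Tw.piEquiv φ (Fin n) (M := A)).symm
  exact Module.Finite.of_surjective _ (Tw.map_surjective φ hf)

end TwFunctor

section Density

variable {R : Type u} [Ring R] {ι : Type} [Fintype ι] [DecidableEq ι]

/-- The normalised length of an iterated twist. -/
noncomputable def twLen (φ : R →+* Matrix ι ι R) :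
    ℕ → ∀ (M : Type u) [AddCommGroup M] [Module R M], ℝ
  | 0, M, _, _ => ((Module.length R M).toNat : ℝ)
  | k + 1, M, _, _ => twLen φ k (Tw φ M) / Fintype.card ι

variable [IsArtinianRing R] {φ ψ : R →+* Matrix ι ι R} (h : IsDualPair φ ψ)

include h

theorem isAddLength_twLen (k : ℕ) : IsAddLength R fun M _ _ => twLen φ k M := by
  induction k with
  | zero => exact isAddLength_length
  | succ k ih =>
    refine ⟨fun M _ _ _ => ?_, fun N M P _ _ _ _ _ _ _ f g hf hg hfg => ?_⟩
    · have _ := h.finite M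
      exact div_nonneg (ih.nonneg (Tw φ M)) (Nat.cast_nonneg _)
    · have _ := h.finite M
      have := ih.add _ _ _ (Tw.map φ f) (Tw.map φ g) (Tw.map_injective φ hf)
        (Tw.map_surjective φ hg) (Tw.map_exact φ hfg)
      simp only [twLen]
      rw [this, add_div]

theorem twLen_self [Nonempty ι] (k : ℕ) : twLen φ k R = ((Module.length R R).toNat : ℝ) := by
  induction k with
  | zero => rfl
  | succ k ih =>
    have hμ := isAddLength_twLen h k
    have _ := h.finite R
    have h1 := hμ.equiv h.equiv
    have h2 := hμ.pi (κ := ι) (M := R)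
    simp only [twLen]
    beta_reduce at h1 h2
    rw [← h1, h2, ih]
    field_simp

theorem exists_twLen_le [Nonempty ι] (M : Type u) [AddCommGroup M] [Module R M]
    [Module.Finite R M] : ∃ B : ℝ, ∀ k, 0 ≤ twLen φ k M ∧ twLen φ k M ≤ B := by
  obtain ⟨n, f, hf⟩ := Module.Finite.exists_fin' R M
  refine ⟨n * ((Module.length R R).toNat : ℝ), fun k => ?_⟩
  have hμ := isAddLength_twLen h k
  have h1 := hμ.le_of_surjective f hf
  have h2 := hμ.pi_fin (M := R) n
  beta_reduce at h1 h2
  rw [h2, twLen_self h] at h1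
  exact ⟨hμ.nonneg M, h1⟩

omit h [IsArtinianRing R] in
/-- The asymptotic density of the iterated twists of a module. -/
noncomputable def density (φ : R →+* Matrix ι ι R) (M : Type u) [AddCommGroup M] [Module R M] :
    ℝ :=
  Filter.limUnder (Filter.hyperfilter ℕ : Filter ℕ)
    fun N => (∑ k ∈ Finset.range N, twLen φ k M) / N

open Filter Topology

theorem tendsto_density [Nonempty ι] (M : Type u) [AddCommGroup M] [Module R M]
    [Module.Finite R M] : Tendsto (fun N : ℕ => (∑ k ∈ Finset.range N, twLen φ k M) / N)
      (hyperfilter ℕ) (𝓝 (density φ M)) := by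
  obtain ⟨B, hB⟩ := exists_twLen_le h M
  have hB0 : 0 ≤ B := (hB 0).1.trans (hB 0).2
  refine tendsto_nhds_limUnder ?_
  have hmem : ∀ N : ℕ, (∑ k ∈ Finset.range N, twLen φ k M) / N ∈ Set.Icc 0 B := by
    intro N
    refine ⟨div_nonneg (Finset.sum_nonneg fun k _ => (hB k).1) (Nat.cast_nonneg _), ?_⟩
    refine div_le_of_le_mul₀ (Nat.cast_nonneg _) hB0 ?_
    calc ∑ k ∈ Finset.range N, twLen φ k M ≤ ∑ k ∈ Finset.range N, B :=
          Finset.sum_le_sum fun k _ => (hB k).2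
      _ = B * N := by simp [mul_comm]
  obtain ⟨x, -, hx⟩ := (isCompact_Icc (a := (0 : ℝ)) (b := B)).ultrafilter_le_nhds
    ((hyperfilter ℕ).map fun N : ℕ => (∑ k ∈ Finset.range N, twLen φ k M) / N)
    (le_principal_iff.2 (Filter.mem_map.2 (univ_mem' hmem)))
  exact ⟨x, hx⟩

theorem isAddLength_density [Nonempty ι] : IsAddLength R fun M _ _ => density φ M where
  nonneg M _ _ _ := ge_of_tendsto' (tendsto_density h M) fun N =>
    div_nonneg (Finset.sum_nonneg fun k _ => (isAddLength_twLen h k).nonneg M)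
      (Nat.cast_nonneg _)
  add N M P _ _ _ _ _ _ _ f g hf hg hfg := by
    have _ : Module.Finite R N := Module.Finite.of_injective f hf
    have _ : Module.Finite R P := Module.Finite.of_surjective g hg
    refine tendsto_nhds_unique (tendsto_density h M)
      (((tendsto_density h N).add (tendsto_density h P)).congr fun n => ?_)
    rw [← add_div, ← Finset.sum_add_distrib]
    congr 1
    exact Finset.sum_congr rfl fun k _ =>
      ((isAddLength_twLen h k).add N M P f g hf hg hfg).symm

theorem density_self [Nonempty ι] : density φ R = ((Module.length R R).toNat : ℝ) := by
  refine tendsto_nhds_unique (tendsto_density h R) (tendsto_const_nhds.congr' ?_)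
  have : ∀ᶠ n in (hyperfilter ℕ : Filter ℕ), n ≠ 0 :=
    (hyperfilter_le_cofinite (α := ℕ)) ((Set.finite_singleton 0).compl_mem_cofinite)
  filter_upwards [this] with n hn
  simp only [twLen_self h, Finset.sum_const, Finset.card_range, nsmul_eq_mul]
  field_simp

theorem density_tw [Nonempty ι] (M : Type u) [AddCommGroup M] [Module R M]
    [Module.Finite R M] : density φ (Tw φ M) = Fintype.card ι * density φ M := by
  have _ := h.finite M
  obtain ⟨B, hB⟩ := exists_twLen_le h M
  have hB0 : 0 ≤ B := (hB 0).1.trans (hB 0).2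
  have hc : (Fintype.card ι : ℝ) ≠ 0 := by simp
  have hz : Tendsto (fun N : ℕ => (twLen φ N M - twLen φ 0 M) / (N : ℝ)) (hyperfilter ℕ)
      (𝓝 0) := by
    have h1 : Tendsto (fun N : ℕ => (twLen φ N M - twLen φ 0 M) / (N : ℝ)) atTop (𝓝 0) := by
      refine squeeze_zero_norm (fun N => ?_) (tendsto_const_div_atTop_nhds_zero_nat (2 * B))
      rw [norm_div, Real.norm_natCast, Real.norm_eq_abs]
      gcongr
      rw [abs_le]
      constructor <;> linarith [(hB N).1, (hB N).2, (hB 0).1, (hB 0).2]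
    exact h1.mono_left (by rw [← Nat.cofinite_eq_atTop]; exact hyperfilter_le_cofinite)
  have h2 := ((tendsto_density h M).add hz).const_mul (Fintype.card ι : ℝ)
  rw [add_zero] at h2
  refine tendsto_nhds_unique (tendsto_density h (Tw φ M)) (h2.congr fun n => ?_)
  have h3 : ∀ k, twLen φ k (Tw φ M) = Fintype.card ι * twLen φ (k + 1) M := fun k => by
    simp only [twLen]
    field_simp
  simp only [h3]
  rw [← Finset.mul_sum, ← add_div, mul_div_assoc]
  congr 2
  have := Finset.sum_range_succ' (fun k => twLen φ k M) n
  rw [Finset.sum_range_succ] at this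
  linarith

end Density

section Embedding

variable {R : Type u} [Ring R]

theorem exists_separating {N : Type*} [AddCommGroup N] [Module R N] [IsArtinianRing R]
    (hN : ∀ q : R, (∀ x : N, q • x = 0) → q = 0) (n : ℕ) :
    ∀ I : Ideal R, Module.length R I ≤ n →
      ∃ v : Fin n → N, ∀ q ∈ I, (∀ i, q • v i = 0) → q = 0 := by
  induction n with
  | zero =>
    intro I hI
    have h1 : Module.length R I = 0 := by simpa using hI
    have h2 := Module.length_eq_zero_iff.1 h1
    refine ⟨0, fun q hq _ => ?_⟩
    simpa using congrArg Subtype.val (Subsingleton.elim (⟨q, hq⟩ : I) 0)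
  | succ n ih =>
    intro I hI
    by_cases hbot : ∃ q ∈ I, q ≠ 0
    · obtain ⟨q, hq, hq0⟩ := hbot
      obtain ⟨x, hx⟩ : ∃ x : N, q • x ≠ 0 := by
        by_contra! hcon
        exact hq0 (hN q hcon)
      let K : Submodule R I := LinearMap.ker ((LinearMap.toSpanSingleton R N x).comp I.subtype)
      have hK : ∀ y : I, y ∈ K ↔ (y : R) • x = 0 := fun y => Iff.rfl
      have hlt : Module.length R K < Module.length R I := Submodule.length_lt fun h =>
        hx ((hK ⟨q, hq⟩).1 (h ▸ Submodule.mem_top))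
      have hle : Module.length R (K.map I.subtype) ≤ n := by
        rw [← (Submodule.equivMapOfInjective I.subtype I.injective_subtype K).length_eq]
        have := hlt.trans_le hI
        push_cast at this
        exact Order.lt_add_one_iff_of_not_isMax (by simp) |>.1 this
      obtain ⟨v, hv⟩ := ih _ hle
      refine ⟨Fin.cons x v, fun r hr h => hv r ?_ fun i => h i.succ⟩
      exact ⟨⟨r, hr⟩, h 0, rfl⟩
    · push Not at hbot
      exact ⟨0, fun q hq _ => hbot q hq⟩

variable {ι : Type} [Fintype ι] [DecidableEq ι] {φ ψ : R →+* Matrix ι ι R}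

theorem IsIrredTwist.eq_zero_of_smul_eq_zero (hφ : IsIrredTwist φ) {M : Type*} [AddCommGroup M]
    [Module R M] [Nontrivial M] {q : R} (hq : ∀ x : Tw φ M, q • x = 0) : q = 0 := by
  refine hφ (Module.annihilator R M) inferInstance (fun h => ?_) q fun i j => ?_
  · obtain ⟨x, hx⟩ := exists_ne (0 : M)
    have := Module.mem_annihilator.1 (h ▸ Submodule.mem_top : (1 : R) ∈ Module.annihilator R M) x
    exact hx (by rwa [one_smul] at this)
  · rw [Module.mem_annihilator]
    intro m
    have := congrFun (congrArg Tw.fn (hq ⟨Pi.single j m⟩)) i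
    rw [Tw.smul_fn] at this
    simpa [Pi.single_apply, smul_ite, Tw.zero_fn] using this

theorem IsIrredTwist.exists_injective [IsArtinianRing R] (hφ : IsIrredTwist φ) (M : Type*)
    [AddCommGroup M] [Module R M] [Nontrivial M] :
    ∃ f : R →ₗ[R] (Fin (Module.length R R).toNat → Tw φ M), Function.Injective f := by
  obtain ⟨v, hv⟩ := exists_separating (fun q hq => hφ.eq_zero_of_smul_eq_zero (M := M) hq)
    (Module.length R R).toNat ⊤ (by
      rw [Module.length_top, ENat.natCast_toNat Module.length_ne_top])
  refine ⟨LinearMap.toSpanSingleton R _ v, (injective_iff_map_eq_zero _).2 fun q hq => ?_⟩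
  exact hv q trivial fun i => congrFun hq i

theorem IsIrredTwist.nonempty [Nontrivial R] (hφ : IsIrredTwist φ) : Nonempty ι := by
  by_contra h
  rw [not_nonempty_iff] at h
  exact one_ne_zero (hφ ⊥ inferInstance bot_ne_top 1 fun i => isEmptyElim i)

theorem length_toNat_pos [IsArtinianRing R] [Nontrivial R] : 0 < (Module.length R R).toNat :=
  Nat.pos_of_ne_zero fun h => by
    rw [ENat.toNat_eq_zero] at h
    rcases h with h | h
    · exact (Module.length_pos (R := R) (M := R)).ne' h
    · exact Module.length_ne_top h

/-- A uniform lower bound for the density of nonzero modules. -/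
theorem IsIrredTwist.le_density [IsArtinianRing R] [Nontrivial R] (hφ : IsIrredTwist φ)
    (h : IsDualPair φ ψ) (M : Type u) [AddCommGroup M] [Module R M] [Nontrivial M]
    [Module.Finite R M] : 1 ≤ Fintype.card ι * density φ M := by
  have _ := hφ.nonempty
  have _ := h.finite M
  obtain ⟨f, hf⟩ := hφ.exists_injective M
  have hμ := isAddLength_density h
  have h1 := hμ.le_of_injective f hf
  have h2 := hμ.pi_fin (M := Tw φ M) (Module.length R R).toNat
  beta_reduce at h1 h2
  rw [h2, density_tw h, density_self h] at h1
  have hpos : (0 : ℝ) < (Module.length R R).toNat := Nat.cast_pos.2 length_toNat_pos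
  exact le_of_mul_le_mul_left (by linarith) hpos

theorem IsIrredTwist.density_pos [IsArtinianRing R] [Nontrivial R] (hφ : IsIrredTwist φ)
    (h : IsDualPair φ ψ) (M : Type u) [AddCommGroup M] [Module R M] [Nontrivial M]
    [Module.Finite R M] : 0 < density φ M := by
  have h1 := hφ.le_density h M
  by_contra! hcon
  have := mul_nonpos_of_nonneg_of_nonpos (Nat.cast_nonneg (α := ℝ) (Fintype.card ι)) hcon
  linarith

end Embedding

section Dual

variable {R : Type u} [Ring R] {M N P : Type u} [AddCommGroup M] [Module R M]
  [AddCommGroup N] [Module R N] [AddCommGroup P] [Module R P]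

open MulOpposite

/-- The transpose of a linear map, as a map of right modules. -/
def dualMap (f : N →ₗ[R] M) : (M →ₗ[R] R) →ₗ[Rᵐᵒᵖ] (N →ₗ[R] R) where
  toFun g := g.comp f
  map_add' _ _ := rfl
  map_smul' _ _ := rfl

theorem dualMap_apply (f : N →ₗ[R] M) (g : M →ₗ[R] R) (x : N) : dualMap f g x = g (f x) := rfl

theorem dualMap_injective {f : N →ₗ[R] M} (hf : Function.Surjective f) :
    Function.Injective (dualMap f) := fun g h hgh => by
  ext x
  obtain ⟨y, rfl⟩ := hf x
  exact LinearMap.congr_fun hgh y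

theorem dualMap_exact {f : N →ₗ[R] M} {g : M →ₗ[R] P} (hg : Function.Surjective g)
    (h : Function.Exact f g) : Function.Exact (dualMap g) (dualMap f) := fun y => by
  constructor
  · intro hy
    have hle : LinearMap.ker g ≤ LinearMap.ker y := fun x hx => by
      obtain ⟨z, rfl⟩ := (h x).1 hx
      exact LinearMap.congr_fun hy z
    refine ⟨((LinearMap.ker g).liftQ y hle).comp (g.quotKerEquivOfSurjective hg).symm.toLinearMap, ?_⟩
    ext x
    rw [dualMap_apply, LinearMap.comp_apply]
    have : (g.quotKerEquivOfSurjective hg).symm (g x) = (LinearMap.ker g).mkQ x := by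
      rw [LinearEquiv.symm_apply_eq]; rfl
    rw [LinearEquiv.coe_coe, this]
    rfl
  · rintro ⟨x, rfl⟩
    ext z
    exact (congrArg x ((h _).2 ⟨z, rfl⟩)).trans (map_zero x)

/-- The dual of the regular module. -/
def dualSelf : (R →ₗ[R] R) ≃ₗ[Rᵐᵒᵖ] Rᵐᵒᵖ where
  toFun f := op (f 1)
  invFun r := LinearMap.toSpanSingleton R R r.unop
  map_add' _ _ := rfl
  map_smul' r f := by
    obtain ⟨r, rfl⟩ := op_surjective r
    rfl
  left_inv f := by ext; simp
  right_inv r := by simp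

/-- The dual of a finite power. -/
def dualPi (n : ℕ) : ((Fin n → M) →ₗ[R] R) ≃ₗ[Rᵐᵒᵖ] (Fin n → (M →ₗ[R] R)) :=
  (LinearMap.lsum R (fun _ : Fin n => M) Rᵐᵒᵖ).symm

/-- The dual of a twisted module is the twist of the dual. -/
def dualTw {ι : Type} [Fintype ι] [DecidableEq ι] {φ₀ φ₁ φ₂ : R →+* Matrix ι ι R}
    (h₀₁ : IsDualPair φ₀ φ₁) (h₁₂ : IsDualPair φ₁ φ₂) :
    (Tw φ₀ M →ₗ[R] R) ≃ₗ[Rᵐᵒᵖ] Tw (opTwist φ₂) (M →ₗ[R] R) := by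
  have key : ∀ (f : Tw φ₀ M →ₗ[R] R) (q : R) (m : M) (i : ι),
      f ⟨Pi.single i (q • m)⟩ = ∑ j, φ₁ q i j * f ⟨Pi.single j m⟩ := by
    intro f q m i
    simp only [← smul_eq_mul, ← map_smul, ← map_sum]
    congr 1
    ext l
    rw [Tw.sum_fn]
    simp only [Tw.smul_fn, Pi.single_apply, smul_ite, smul_zero, Finset.sum_ite_eq',
      Finset.mem_univ, if_true]
    rw [← Finset.sum_smul, h₀₁.left]
    by_cases hil : l = i
    · simp [hil]
    · simp [hil, Ne.symm hil]
  exact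
  { toFun := fun f => ⟨fun j =>
      { toFun := fun m => ∑ i, φ₂ (f ⟨Pi.single i m⟩) i j
        map_add' := fun x y => by
          rw [← Finset.sum_add_distrib]
          refine Finset.sum_congr rfl fun i _ => ?_
          have hxy : (⟨Pi.single i (x + y)⟩ : Tw φ₀ M) = ⟨Pi.single i x⟩ + ⟨Pi.single i y⟩ :=
            Tw.ext (funext fun l => by rw [Tw.add_fn, Pi.single_add]; rfl)
          rw [hxy, map_add, map_add, Matrix.add_apply]
        map_smul' := fun q m => by
          simp only [key, map_sum, map_mul, Matrix.sum_apply, Matrix.mul_apply,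
            RingHom.id_apply, smul_eq_mul]
          rw [Finset.mul_sum, Finset.sum_comm]
          refine Finset.sum_congr rfl fun l _ => ?_
          rw [Finset.sum_comm]
          simp_rw [← Finset.sum_mul, h₁₂.right]
          simp }⟩
    invFun := fun y =>
      { toFun := fun x => ∑ i, ∑ j, φ₁ (y.fn j (x.fn i)) i j
        map_add' := fun x x' => by
          simp [Tw.add_fn, Finset.sum_add_distrib]
        map_smul' := fun q x => by
          simp only [Tw.smul_fn, map_sum, map_smul, smul_eq_mul, map_mul, Matrix.sum_apply,
            Matrix.mul_apply, RingHom.id_apply, Finset.mul_sum]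
          calc _ = ∑ i, ∑ m, ∑ l, φ₁ (φ₀ q i m) i l * ∑ j, φ₁ (y.fn j (x.fn m)) l j := by
                refine Finset.sum_congr rfl fun i _ => ?_
                rw [Finset.sum_comm]
                refine Finset.sum_congr rfl fun m _ => ?_
                rw [Finset.sum_comm]
                exact Finset.sum_congr rfl fun l _ => (Finset.mul_sum _ _ _).symm
            _ = ∑ m, ∑ l, (∑ i, φ₁ (φ₀ q i m) i l) * ∑ j, φ₁ (y.fn j (x.fn m)) l j := by
                rw [Finset.sum_comm]
                refine Finset.sum_congr rfl fun m _ => ?_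
                rw [Finset.sum_comm]
                exact Finset.sum_congr rfl fun l _ => (Finset.sum_mul _ _ _).symm
            _ = _ := by
                refine Finset.sum_congr rfl fun m _ => ?_
                simp [h₀₁.right, Finset.mul_sum] }
    map_add' := fun f g => by
      ext j m
      simp [Tw.add_fn, Finset.sum_add_distrib]
    map_smul' := fun r f => by
      obtain ⟨r, rfl⟩ := op_surjective r
      ext j m
      simp only [Tw.smul_fn, RingHom.id_apply, LinearMap.sum_apply, LinearMap.smul_apply,
        opTwist_apply, unop_op, LinearMap.coe_mk, AddHom.coe_mk, op_smul_eq_mul, map_mul,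
        Matrix.mul_apply, Finset.sum_mul]
      exact Finset.sum_comm
    left_inv := fun f => by
      ext x
      have h1 : ∀ i l, ∑ j, φ₁ (φ₂ (f ⟨Pi.single l (x.fn i)⟩) l j) i j =
          if l = i then f ⟨Pi.single l (x.fn i)⟩ else 0 := fun i l => h₁₂.left _ _ _
      simp only [LinearMap.coe_mk, AddHom.coe_mk, map_sum, Matrix.sum_apply]
      calc _ = ∑ i, ∑ l, ∑ j, φ₁ (φ₂ (f ⟨Pi.single l (x.fn i)⟩) l j) i j :=
            Finset.sum_congr rfl fun i _ => Finset.sum_comm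
        _ = f x := by
            simp only [h1, Finset.sum_ite_eq', Finset.mem_univ, if_true]
            rw [← map_sum]
            congr 1
            ext l
            simp [Tw.sum_fn, Pi.single_apply]
    right_inv := fun y => by
      ext j m
      have h1 : ∀ i l, ∑ t, φ₁ (y.fn t ((Pi.single i m : ι → M) l)) l t =
          if l = i then ∑ t, φ₁ (y.fn t m) i t else 0 := fun i l => by
        rw [Pi.single_apply]
        split_ifs with h
        · rw [h]
        · simp
      simp only [LinearMap.coe_mk, AddHom.coe_mk, h1, Finset.sum_ite_eq', Finset.mem_univ,
        if_true]
      simp only [map_sum, Matrix.sum_apply]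
      rw [Finset.sum_comm]
      simp [h₁₂.right] }

theorem finite_dual [IsNoetherianRing Rᵐᵒᵖ] (M : Type u) [AddCommGroup M] [Module R M]
    [Module.Finite R M] : Module.Finite Rᵐᵒᵖ (M →ₗ[R] R) := by
  obtain ⟨n, f, hf⟩ := Module.Finite.exists_fin' R M
  have _ : Module.Finite Rᵐᵒᵖ (R →ₗ[R] R) := Module.Finite.equiv dualSelf.symm
  have _ : Module.Finite Rᵐᵒᵖ ((Fin n → R) →ₗ[R] R) :=
    Module.Finite.equiv (dualPi (M := R) n).symm
  exact Module.Finite.of_injective _ (dualMap_injective hf)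

end Dual

section Injective

variable {R : Type u} [Ring R] [IsArtinianRing R] [IsArtinianRing Rᵐᵒᵖ] [Nontrivial R]

section Bound

variable {μ : ∀ (M : Type u) [AddCommGroup M] [Module R M], ℝ} (hμ : IsAddLength R μ)
  {ν : ∀ (M : Type u) [AddCommGroup M] [Module Rᵐᵒᵖ M], ℝ} (hν : IsAddLength Rᵐᵒᵖ ν)
  {N M P : Type u} [AddCommGroup M] [Module R M] [AddCommGroup N] [Module R N]
  [AddCommGroup P] [Module R P]

include hν in
omit [IsArtinianRing R] [Nontrivial R] in
theorem dual_eq_add_range [Module.Finite R M] (f : N →ₗ[R] M) (g : M →ₗ[R] P)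
    (hg : Function.Surjective g) (h : Function.Exact f g) :
    ν (M →ₗ[R] R) = ν (P →ₗ[R] R) + ν (LinearMap.range (dualMap f)) := by
  have _ := finite_dual (R := R) M
  refine hν.add _ _ _ (dualMap g) (dualMap f).rangeRestrict (dualMap_injective hg)
    (LinearMap.surjective_rangeRestrict _) fun y => ?_
  rw [← dualMap_exact hg h y, ← Subtype.coe_inj]
  rfl

include hν in
omit [Nontrivial R] in
theorem dual_le_add [Module.Finite R M] (f : N →ₗ[R] M) (g : M →ₗ[R] P)
    (hf : Function.Injective f) (hg : Function.Surjective g) (h : Function.Exact f g) :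
    ν (M →ₗ[R] R) ≤ ν (P →ₗ[R] R) + ν (N →ₗ[R] R) := by
  have _ : Module.Finite R N := Module.Finite.of_injective f hf
  have _ := finite_dual (R := R) N
  rw [dual_eq_add_range hν f g hg h]
  gcongr
  exact hν.le_of_injective _ (LinearMap.range (dualMap f)).injective_subtype

include hμ hν in
omit [Nontrivial R] in
/-- A bound on simple modules extends to all modules of finite length. -/
theorem dual_le_of_simple {c : ℝ}
    (hc : ∀ (S : Type u) [AddCommGroup S] [Module R S] [IsSimpleModule R S],
      ν (S →ₗ[R] R) ≤ c * μ S) (hM : IsFiniteLength R M) : ν (M →ₗ[R] R) ≤ c * μ M := by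
  induction hM with
  | of_subsingleton =>
    rename_i M _ _ hM
    have h1 := hμ.equiv (N := PUnit.{u + 1}) (⟨0, fun _ => 0, fun _ => Subsingleton.elim _ _,
      fun _ => rfl⟩ : M ≃ₗ[R] PUnit.{u + 1})
    have h2 := hν.equiv (N := PUnit.{u + 1}) (⟨0, fun _ => 0, fun _ =>
      LinearMap.ext fun x => by rw [Subsingleton.elim x 0, map_zero, map_zero],
      fun _ => rfl⟩ : (M →ₗ[R] R) ≃ₗ[Rᵐᵒᵖ] PUnit.{u + 1})
    rw [h1, h2, hμ.punit, hν.punit, mul_zero]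
  | of_simple_quotient hN ih =>
    rename_i M _ _ N hs
    have h1 := (isFiniteLength_iff_isNoetherian_isArtinian.1
      (IsFiniteLength.of_simple_quotient hN)).1
    have h2 := dual_le_add hν N.subtype N.mkQ N.injective_subtype N.mkQ_surjective
      (LinearMap.exact_subtype_mkQ N)
    have h3 := hc (M ⧸ N)
    rw [hμ.sub N]
    linarith

end Bound

variable {ι : Type} [Fintype ι] [DecidableEq ι] {φ₀ φ₁ φ₂ : R →+* Matrix ι ι R}

omit [IsArtinianRing R] [IsArtinianRing Rᵐᵒᵖ] [Nontrivial R] in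
theorem IsSimpleModule.exists_surjective (S : Type u) [AddCommGroup S] [Module R S]
    [IsSimpleModule R S] : ∃ f : R →ₗ[R] S, Function.Surjective f := by
  have := IsSimpleModule.nontrivial R S
  obtain ⟨x, hx⟩ := exists_ne (0 : S)
  exact ⟨LinearMap.toSpanSingleton R S x, IsSimpleModule.toSpanSingleton_surjective R hx⟩

/-- A sharp comparison between the densities of left modules and of their duals. -/
theorem exists_dual_bound (h₀₁ : IsDualPair φ₀ φ₁) (h₁₂ : IsDualPair φ₁ φ₂)
    (hφ₀ : IsIrredTwist φ₀) : ∃ c : ℝ,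
      (∀ (M : Type u) [AddCommGroup M] [Module R M] [Module.Finite R M],
        density (opTwist φ₂) (M →ₗ[R] R) ≤ c * density φ₀ M) ∧
      c * density φ₀ R ≤ density (opTwist φ₂) (R →ₗ[R] R) := by
  have _ := hφ₀.nonempty
  have hμ := isAddLength_density h₀₁
  have hν := isAddLength_density h₁₂.opTwist
  set n : ℝ := (Fintype.card ι : ℝ)
  have hn : 0 ≤ n := Nat.cast_nonneg _
  let X : Set ℝ := {r | ∃ (S : Type u) (_ : AddCommGroup S) (_ : Module R S),
    IsSimpleModule R S ∧ r = density (opTwist φ₂) (S →ₗ[R] R) / density φ₀ S}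
  have hfin : ∀ (S : Type u) [AddCommGroup S] [Module R S] [IsSimpleModule R S],
      Module.Finite R S := fun S _ _ _ => by
    obtain ⟨f, hf⟩ := IsSimpleModule.exists_surjective (R := R) S
    exact Module.Finite.of_surjective f hf
  have hpos : ∀ (S : Type u) [AddCommGroup S] [Module R S] [IsSimpleModule R S],
      0 < density φ₀ S ∧ 1 ≤ n * density φ₀ S := fun S _ _ _ => by
    have := IsSimpleModule.nontrivial R S
    have := hfin S
    exact ⟨hφ₀.density_pos h₀₁ S, hφ₀.le_density h₀₁ S⟩
  have hfd : Module.Finite Rᵐᵒᵖ (R →ₗ[R] R) := finite_dual (R := R) R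
  have hbdd : BddAbove X := by
    refine ⟨n * density (opTwist φ₂) (R →ₗ[R] R), ?_⟩
    rintro _ ⟨S, _, _, hS, rfl⟩
    obtain ⟨f, hf⟩ := IsSimpleModule.exists_surjective (R := R) S
    have h1 := hν.le_of_injective _ (dualMap_injective hf)
    have h2 := hν.nonneg (R →ₗ[R] R)
    beta_reduce at h1 h2
    obtain ⟨h3, h4⟩ := hpos S
    rw [div_le_iff₀ h3]
    nlinarith
  have hne : X.Nonempty := by
    obtain ⟨I, hI⟩ := Ideal.exists_maximal R
    have : IsSimpleModule R (R ⧸ I) := isSimpleModule_iff_isCoatom.2 hI.out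
    exact ⟨_, R ⧸ I, inferInstance, inferInstance, this, rfl⟩
  have hc : ∀ (M : Type u) [AddCommGroup M] [Module R M] [Module.Finite R M],
      density (opTwist φ₂) (M →ₗ[R] R) ≤ sSup X * density φ₀ M := by
    intro M _ _ _
    refine dual_le_of_simple hμ hν (fun S _ _ hS => ?_)
      (isFiniteLength_iff_isNoetherian_isArtinian.2 ⟨inferInstance, inferInstance⟩)
    have := le_csSup hbdd ⟨S, _, _, hS, rfl⟩
    rwa [div_le_iff₀ (hpos S).1] at this
  refine ⟨sSup X, hc, ?_⟩
  set l : ℝ := ((Module.length R R).toNat : ℝ)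
  have hl0 : 0 ≤ l := Nat.cast_nonneg _
  have hR : density φ₀ R = l := density_self h₀₁
  have key : ∀ ε > 0, sSup X * density φ₀ R ≤
      density (opTwist φ₂) (R →ₗ[R] R) + ε * (l * n * density φ₀ R) := by
    intro ε hε
    obtain ⟨_, ⟨S, _, _, hS, rfl⟩, hr⟩ := exists_lt_of_lt_csSup hne (sub_lt_self (sSup X) hε)
    rw [lt_div_iff₀ (hpos S).1] at hr
    have _ := hfin S
    have _ := IsSimpleModule.nontrivial R S
    have _ := h₀₁.finite S
    have _ := finite_dual (R := R) S
    have _ := h₁₂.opTwist.finite (S →ₗ[R] R)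
    have _ := finite_dual (R := R) (Tw φ₀ S)
    obtain ⟨f, hf⟩ := hφ₀.exists_injective S
    obtain ⟨g, hg⟩ := IsSimpleModule.exists_surjective (R := R) S
    have h1 := dual_le_add hν f (LinearMap.range f).mkQ hf (Submodule.mkQ_surjective _)
      (LinearMap.exact_map_mkQ_range f)
    have h2 := hc ((Fin (Module.length R R).toNat → Tw φ₀ S) ⧸ LinearMap.range f)
    have h3 := hμ.add _ _ _ f (LinearMap.range f).mkQ hf (Submodule.mkQ_surjective _)
      (LinearMap.exact_map_mkQ_range f)
    have h4 := hμ.pi_fin (M := Tw φ₀ S) (Module.length R R).toNat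
    have h5 := hν.equiv (dualPi (M := Tw φ₀ S) (Module.length R R).toNat)
    have h6 := hν.pi_fin (M := Tw φ₀ S →ₗ[R] R) (Module.length R R).toNat
    have h7 := hν.equiv (dualTw (M := S) h₀₁ h₁₂)
    have h8 := density_tw h₁₂.opTwist (S →ₗ[R] R)
    have h9 := density_tw h₀₁ S
    have h10 := hμ.le_of_surjective g hg
    beta_reduce at h1 h3 h4 h5 h6 h7 h10
    rw [h5, h6, h7, h8] at h1
    rw [h4, h9] at h3
    have h11 : 0 ≤ l * n := mul_nonneg hl0 hn
    have h12 := mul_le_mul_of_nonneg_left hr.le h11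
    have h13 : ε * (l * n * density φ₀ S) ≤ ε * (l * n * density φ₀ R) := by gcongr
    have h14 : sSup X * (l * (n * density φ₀ S)) = sSup X * density φ₀ R + sSup X *
        density φ₀ ((Fin (Module.length R R).toNat → Tw φ₀ S) ⧸ LinearMap.range f) := by
      rw [← mul_add, ← h3]
    linarith
  refine le_of_forall_pos_le_add fun δ hδ => ?_
  have hC : 0 ≤ l * n * density φ₀ R := by rw [hR]; positivity
  refine (key (δ / (l * n * density φ₀ R + 1)) (by positivity)).trans ?_
  gcongr
  rw [div_mul_eq_mul_div, div_le_iff₀ (by positivity)]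
  nlinarith

/-- An artinian ring with an irreducible triple of twists is left self-injective. -/
theorem injective_of_irred (h₀₁ : IsDualPair φ₀ φ₁) (h₁₂ : IsDualPair φ₁ φ₂)
    (hφ₀ : IsIrredTwist φ₀) (hφ₂ : IsIrredTwist φ₂) : Module.Injective R R := by
  refine Module.Baer.injective fun I g => ?_
  have _ := hφ₀.nonempty
  have hμ := isAddLength_density h₀₁
  have hν := isAddLength_density h₁₂.opTwist
  obtain ⟨c, hc, hcR⟩ := exists_dual_bound h₀₁ h₁₂ hφ₀
  have h1 := dual_eq_add_range hν I.subtype I.mkQ I.mkQ_surjective (LinearMap.exact_subtype_mkQ I)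
  have h2 := hc I
  have h3 := hc (R ⧸ I)
  have h4 := hμ.sub I
  have _ := finite_dual (R := R) I
  have h5 := hν.sub (LinearMap.range (dualMap (Submodule.subtype I)))
  beta_reduce at h1 h4 h5
  rw [h4, mul_add] at hcR
  have h6 : Subsingleton ((I →ₗ[R] R) ⧸ LinearMap.range (dualMap (Submodule.subtype I))) := by
    by_contra hcon
    rw [not_subsingleton_iff_nontrivial] at hcon
    have := hφ₂.opTwist.density_pos h₁₂.opTwist
      ((I →ₗ[R] R) ⧸ LinearMap.range (dualMap (Submodule.subtype I)))
    linarith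
  rw [Submodule.Quotient.subsingleton_iff] at h6
  obtain ⟨g', hg'⟩ := (h6 ▸ Submodule.mem_top : g ∈ LinearMap.range (dualMap (Submodule.subtype I)))
  exact ⟨g', fun x hx => LinearMap.congr_fun hg' ⟨x, hx⟩⟩

end Injective

open scoped TensorProduct
open Coalgebra (comul counit)

section Winding

variable {k H : Type u} [Field k] [Ring H] [HopfAlgebra k H]

/-- The operator `h ↦ ∑ ℓ(h₁) h₂`. -/
noncomputable def wind (ℓ : H →ₗ[k] k) : H →ₗ[k] H :=
  (TensorProduct.lid k H).toLinearMap ∘ₗ ℓ.rTensor H ∘ₗ comul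

theorem wind_apply (ℓ : H →ₗ[k] k) (h : H) :
    wind ℓ h = TensorProduct.lid k H (ℓ.rTensor H (comul h)) := rfl

theorem wind_repr {κ : Type*} (ℓ : H →ₗ[k] k) {h : H} (r : Coalgebra.Repr k h κ) :
    wind ℓ h = ∑ m ∈ r.index, ℓ (r.left m) • r.right m := by
  rw [wind_apply, ← r.eq]
  simp

theorem wind_sum {κ : Type*} (s : Finset κ) (ℓ : κ → H →ₗ[k] k) (h : H) :
    wind (∑ m ∈ s, ℓ m) h = ∑ m ∈ s, wind (ℓ m) h := by
  rw [wind_repr _ (Coalgebra.Repr.arbitrary k h)]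
  simp only [wind_repr _ (Coalgebra.Repr.arbitrary k h), LinearMap.sum_apply, Finset.sum_smul]
  exact Finset.sum_comm

theorem wind_add (ℓ m : H →ₗ[k] k) (h : H) : wind (ℓ + m) h = wind ℓ h + wind m h := by
  simp [wind_apply, LinearMap.rTensor_add]

theorem wind_smul (c : k) (ℓ : H →ₗ[k] k) (h : H) : wind (c • ℓ) h = c • wind ℓ h := by
  simp [wind_apply, LinearMap.rTensor_smul]

theorem wind_zero (h : H) : wind (0 : H →ₗ[k] k) h = 0 := by
  simp [wind_apply]

theorem wind_counit (h : H) : wind (counit : H →ₗ[k] k) h = h := by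
  rw [wind_apply, Coalgebra.rTensor_counit_comul]
  simp

theorem wind_algebraMap (ℓ : H →ₗ[k] k) (c : k) :
    wind ℓ (algebraMap k H c) = algebraMap k H (c * ℓ 1) := by
  rw [Algebra.algebraMap_eq_smul_one, map_smul, wind_apply, Bialgebra.comul_one,
    Algebra.TensorProduct.one_def]
  simp [Algebra.algebraMap_eq_smul_one, mul_smul]

theorem counit_wind (ℓ : H →ₗ[k] k) (h : H) : counit (R := k) (wind ℓ h) = ℓ h := by
  let r := Coalgebra.Repr.arbitrary k h
  have h2 := congrArg (fun z => TensorProduct.lid k k (ℓ.rTensor k z))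
    (Coalgebra.sum_tmul_counit_eq r)
  simp only [map_sum, LinearMap.rTensor_tmul, TensorProduct.lid_tmul, smul_eq_mul, mul_one] at h2
  rw [wind_repr _ r, map_sum]
  simpa only [map_smul, smul_eq_mul] using h2

theorem comul_wind (ℓ : H →ₗ[k] k) (h : H) :
    comul (R := k) (wind ℓ h) = (wind ℓ).rTensor H (comul h) := by
  have key : ∀ z : H ⊗[k] H, comul (R := k) (TensorProduct.lid k H (ℓ.rTensor H z)) =
      TensorProduct.lid k (H ⊗[k] H) (ℓ.rTensor (H ⊗[k] H) ((comul (R := k)).lTensor H z)) := by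
    intro z
    induction z with
    | zero => simp
    | tmul a b => simp
    | add a b ha hb => simp only [map_add, ha, hb]
  have key2 : ∀ z : H ⊗[k] H, (wind ℓ).rTensor H z =
      TensorProduct.lid k (H ⊗[k] H) (ℓ.rTensor (H ⊗[k] H)
        (TensorProduct.assoc k H H H ((comul (R := k)).rTensor H z))) := by
    intro z
    induction z with
    | zero => simp
    | tmul a b =>
      rw [LinearMap.rTensor_tmul, LinearMap.rTensor_tmul, wind_apply]
      generalize comul (R := k) a = w
      induction w with
      | zero => simp
      | tmul c d => simp [TensorProduct.smul_tmul']
      | add c d hc hd => simp only [map_add, TensorProduct.add_tmul, hc, hd]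
    | add a b ha hb => simp only [map_add, ha, hb]
  rw [wind_apply, key, key2, Coalgebra.coassoc_apply]

theorem wind_wind (ℓ m : H →ₗ[k] k) (h : H) : wind ℓ (wind m h) = wind (ℓ ∘ₗ wind m) h := by
  rw [wind_apply, comul_wind, ← LinearMap.comp_apply, ← LinearMap.rTensor_comp, ← wind_apply]

end Winding

section Rep

variable {k H : Type u} [Field k] [Ring H] [HopfAlgebra k H] {ι : Type} [Fintype ι]
  [DecidableEq ι]

/-- A matrix coefficient of a representation. -/
def coeff (ρ : H →ₐ[k] Matrix ι ι k) (i j : ι) : H →ₗ[k] k where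
  toFun h := ρ h i j
  map_add' a b := by rw [map_add]; rfl
  map_smul' c a := by rw [map_smul]; rfl

theorem coeff_apply (ρ : H →ₐ[k] Matrix ι ι k) (i j : ι) (h : H) : coeff ρ i j h = ρ h i j := rfl

theorem wind_coeff_mul (ρ : H →ₐ[k] Matrix ι ι k) (i j : ι) (a b : H) :
    wind (coeff ρ i j) (a * b) = ∑ l, wind (coeff ρ i l) a * wind (coeff ρ l j) b := by
  let ra := Coalgebra.Repr.arbitrary k a
  let rb := Coalgebra.Repr.arbitrary k b
  have hab : wind (coeff ρ i j) (a * b) = ∑ m ∈ ra.index, ∑ n ∈ rb.index,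
      coeff ρ i j (ra.left m * rb.left n) • (ra.right m * rb.right n) := by
    rw [wind_apply, Bialgebra.comul_mul, ← ra.eq, ← rb.eq]
    simp [Finset.sum_mul_sum]
  rw [hab]
  simp only [wind_repr _ ra, wind_repr _ rb, Finset.sum_mul_sum, smul_mul_smul_comm,
    coeff_apply, map_mul, Matrix.mul_apply, Finset.sum_smul]
  rw [Finset.sum_comm' (s := Finset.univ) (t := fun _ => ra.index) (t' := ra.index)
    (s' := fun _ => Finset.univ) (by simp)]
  exact Finset.sum_congr rfl fun m _ => Finset.sum_comm

/-- The twist attached to a representation. -/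
noncomputable def repTwist (ρ : H →ₐ[k] Matrix ι ι k) : H →+* Matrix ι ι H where
  toFun h := Matrix.of fun i j => wind (coeff ρ i j) h
  map_one' := by
    ext i j
    have := wind_algebraMap (coeff ρ i j) 1
    rw [map_one] at this
    rw [Matrix.of_apply, this, coeff_apply, map_one, Matrix.one_apply, Matrix.one_apply]
    split_ifs <;> simp
  map_mul' a b := by
    ext i j
    rw [Matrix.mul_apply]
    exact wind_coeff_mul ρ i j a b
  map_zero' := by
    ext i j
    simp
  map_add' a b := by
    ext i j
    simp

theorem repTwist_apply (ρ : H →ₐ[k] Matrix ι ι k) (h : H) (i j : ι) :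
    repTwist ρ h i j = wind (coeff ρ i j) h := rfl

theorem repTwist_algebraMap (ρ : H →ₐ[k] Matrix ι ι k) (c : k) :
    repTwist ρ (algebraMap k H c) = algebraMap k _ c := by
  ext i j
  rw [repTwist_apply, wind_algebraMap, coeff_apply, map_one, Matrix.one_apply,
    Matrix.algebraMap_matrix_apply]
  split_ifs <;> simp

end Rep

section Antipode

variable {k H : Type u} [Field k] [Ring H] [HopfAlgebra k H]
  (hS : Function.Bijective (HopfAlgebra.antipode k : H →ₗ[k] H))

/-- The inverse of a bijective antipode. -/
noncomputable def antipodeInv : H →ₗ[k] H := (LinearEquiv.ofBijective _ hS).symm.toLinearMap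

theorem antipode_antipodeInv (h : H) : HopfAlgebra.antipode k (antipodeInv hS h) = h :=
  (LinearEquiv.ofBijective _ hS).apply_symm_apply h

theorem antipodeInv_injective : Function.Injective (antipodeInv hS) :=
  (LinearEquiv.ofBijective _ hS).symm.injective

theorem antipodeInv_mul (a b : H) :
    antipodeInv hS (a * b) = antipodeInv hS b * antipodeInv hS a := by
  apply hS.1
  rw [HopfAlgebra.antipode_mul_antidistrib]
  simp only [antipode_antipodeInv]

theorem antipodeInv_one : antipodeInv hS 1 = 1 := by
  apply hS.1
  rw [antipode_antipodeInv, HopfAlgebra.antipode_one]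

theorem sum_mul_antipodeInv {κ : Type*} {h : H} (r : Coalgebra.Repr k h κ) :
    ∑ m ∈ r.index, r.right m * antipodeInv hS (r.left m) = algebraMap k H (counit h) := by
  apply hS.1
  rw [map_sum]
  simp only [HopfAlgebra.antipode_mul_antidistrib, antipode_antipodeInv]
  rw [HopfAlgebra.sum_mul_antipode_eq_algebraMap_counit, Algebra.algebraMap_eq_smul_one, map_smul,
    HopfAlgebra.antipode_one]

theorem sum_antipodeInv_mul {κ : Type*} {h : H} (r : Coalgebra.Repr k h κ) :
    ∑ m ∈ r.index, antipodeInv hS (r.right m) * r.left m = algebraMap k H (counit h) := by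
  apply hS.1
  rw [map_sum]
  simp only [HopfAlgebra.antipode_mul_antidistrib, antipode_antipodeInv]
  rw [HopfAlgebra.sum_antipode_mul_eq_algebraMap_counit, Algebra.algebraMap_eq_smul_one, map_smul,
    HopfAlgebra.antipode_one]

variable {ι : Type} [Fintype ι] [DecidableEq ι]

/-- The dual of a representation, formed with the inverse of the antipode. -/
noncomputable def dualRep (ρ : H →ₐ[k] Matrix ι ι k) : H →ₐ[k] Matrix ι ι k :=
  AlgHom.ofLinearMap
    ((Matrix.transposeLinearEquiv ι ι k k).toLinearMap ∘ₗ ρ.toLinearMap ∘ₗ antipodeInv hS)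
    (by simp [antipodeInv_one]) (fun a b => by simp [antipodeInv_mul])

theorem dualRep_apply (ρ : H →ₐ[k] Matrix ι ι k) (h : H) (i j : ι) :
    dualRep hS ρ h i j = ρ (antipodeInv hS h) j i := rfl

theorem coeff_wind_dualRep (ρ : H →ₐ[k] Matrix ι ι k) (i l : ι) :
    ∑ j, coeff ρ l j ∘ₗ wind (coeff (dualRep hS ρ) i j) = if i = l then counit else 0 := by
  ext h
  let r := Coalgebra.Repr.arbitrary k h
  have := congrArg (fun x => ρ x l i) (sum_mul_antipodeInv hS r)
  simp only [map_sum, map_mul, Matrix.sum_apply, Matrix.mul_apply, AlgHom.commutes,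
    Matrix.algebraMap_matrix_apply] at this
  simp only [LinearMap.sum_apply, LinearMap.comp_apply, wind_repr _ r, map_sum, map_smul,
    coeff_apply, dualRep_apply, smul_eq_mul]
  rw [Finset.sum_comm]
  simp only [mul_comm (ρ (antipodeInv hS _) _ _)]
  rw [this]
  simp only [eq_comm (a := l)]
  split_ifs <;> simp

theorem coeff_dualRep_wind (ρ : H →ₐ[k] Matrix ι ι k) (j l : ι) :
    ∑ i, coeff (dualRep hS ρ) i l ∘ₗ wind (coeff ρ i j) = if j = l then counit else 0 := by
  ext h
  let r := Coalgebra.Repr.arbitrary k h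
  have := congrArg (fun x => ρ x l j) (sum_antipodeInv_mul hS r)
  simp only [map_sum, map_mul, Matrix.sum_apply, Matrix.mul_apply, AlgHom.commutes,
    Matrix.algebraMap_matrix_apply] at this
  simp only [LinearMap.sum_apply, LinearMap.comp_apply, wind_repr _ r, map_sum, map_smul,
    coeff_apply, dualRep_apply, smul_eq_mul]
  rw [Finset.sum_comm]
  simp only [mul_comm (ρ (r.left _) _ _)]
  rw [this]
  simp only [eq_comm (a := l)]
  split_ifs <;> simp

theorem isDualPair_dualRep (ρ : H →ₐ[k] Matrix ι ι k) :
    IsDualPair (repTwist ρ) (repTwist (dualRep hS ρ)) where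
  left i l q := by
    simp only [repTwist_apply, wind_wind]
    rw [← wind_sum, coeff_wind_dualRep]
    split_ifs
    · exact wind_counit q
    · exact wind_zero q
  right j l q := by
    simp only [repTwist_apply, wind_wind]
    rw [← wind_sum, coeff_dualRep_wind]
    split_ifs
    · exact wind_counit q
    · exact wind_zero q

/-- The triple attached to a representation. -/
noncomputable def repTriple (ρ : H →ₐ[k] Matrix ι ι k) : DualTriple H where
  ι := ι
  φ₀ := repTwist ρ
  φ₁ := repTwist (dualRep hS ρ)
  φ₂ := repTwist (dualRep hS (dualRep hS ρ))
  dual₀₁ := isDualPair_dualRep hS ρ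
  dual₁₂ := isDualPair_dualRep hS (dualRep hS ρ)

/-- The triples attached to all matrix representations. -/
def repFamily : Set (DualTriple H) :=
  {T | ∃ (ι : Type) (_ : Fintype ι) (_ : DecidableEq ι) (ρ : H →ₐ[k] Matrix ι ι k),
    T = repTriple hS ρ}

theorem repTriple_mem (ρ : H →ₐ[k] Matrix ι ι k) : repTriple hS ρ ∈ repFamily hS :=
  ⟨ι, _, _, ρ, rfl⟩

end Antipode

section Separation

variable {k H : Type u} [Field k] [Ring H] [HopfAlgebra k H]

/-- A separating family of functionals spans all functionals on a finite-dimensional subspace. -/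
theorem exists_mem_span_eqOn {V : Type*} [AddCommGroup V] [Module k V]
    {C : Set (V →ₗ[k] k)} (hC : ∀ x, (∀ f ∈ C, f x = 0) → x = 0) (F : Submodule k V)
    [FiniteDimensional k F] (ℓ : V →ₗ[k] k) : ∃ f ∈ Submodule.span k C, ∀ x ∈ F, f x = ℓ x := by
  let R : (V →ₗ[k] k) →ₗ[k] Module.Dual k F := F.subtype.dualMap
  have htop : (Submodule.span k C).map R = ⊤ := by
    have h : ((Submodule.span k C).map R).dualCoannihilator = ⊥ := by
      rw [eq_bot_iff]
      intro x hx
      rw [Submodule.mem_dualCoannihilator] at hx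
      rw [Submodule.mem_bot]
      refine Subtype.ext (hC x fun f hf => ?_)
      exact hx (R f) (Submodule.mem_map_of_mem (Submodule.subset_span hf))
    rw [← Subspace.dualCoannihilator_dualAnnihilator_eq (W := (Submodule.span k C).map R), h,
      Submodule.dualAnnihilator_bot]
  obtain ⟨f, hf, h⟩ := Submodule.mem_map.1 (htop.ge (Submodule.mem_top (x := R ℓ)))
  exact ⟨f, hf, fun x hx => LinearMap.congr_fun h ⟨x, hx⟩⟩

theorem wind_mem_of_separating {C : Set (H →ₗ[k] k)} (hC : ∀ x, (∀ f ∈ C, f x = 0) → x = 0)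
    (𝔞 : Ideal H) {x : H} (hx : ∀ f ∈ C, wind f x ∈ 𝔞) (ℓ : H →ₗ[k] k) : wind ℓ x ∈ 𝔞 := by
  let r := Coalgebra.Repr.arbitrary k x
  let F : Submodule k H := Submodule.span k (r.left '' r.index)
  have : FiniteDimensional k F :=
    FiniteDimensional.span_of_finite k (r.index.finite_toSet.image _)
  obtain ⟨f, hf, h⟩ := exists_mem_span_eqOn hC F ℓ
  have hfl : wind ℓ x = wind f x := by
    rw [wind_repr _ r, wind_repr _ r]
    refine Finset.sum_congr rfl fun m hm => ?_
    rw [h _ (Submodule.subset_span ⟨m, hm, rfl⟩)]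
  rw [hfl]
  clear hfl h
  induction hf using Submodule.span_induction with
  | mem f hf => exact hx f hf
  | zero => rw [wind_zero]; exact 𝔞.zero_mem
  | add f g _ _ hf hg => rw [wind_add]; exact 𝔞.add_mem hf hg
  | smul c f _ hf =>
    rw [wind_smul, Algebra.smul_def]
    exact 𝔞.mul_mem_left _ hf

theorem counit_eq_zero_of_wind_mem {𝔞 : Ideal H} (h𝔞 : 𝔞 ≠ ⊤) {x : H}
    (hx : ∀ ℓ : H →ₗ[k] k, wind ℓ x ∈ 𝔞) : counit (R := k) x = 0 := by
  classical
  let b := Module.Basis.ofVectorSpace k H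
  have hsum := (TensorProduct.equivFinsuppOfBasisLeft b).symm_apply_apply (comul (R := k) x)
  rw [TensorProduct.equivFinsuppOfBasisLeft_symm_apply] at hsum
  have hS := HopfAlgebra.mul_antipode_rTensor_comul_apply (R := k) x
  rw [← hsum, Finsupp.sum, map_sum, map_sum] at hS
  have hmem : algebraMap k H (counit x) ∈ 𝔞 := by
    rw [← hS]
    refine 𝔞.sum_mem fun i _ => ?_
    rw [LinearMap.rTensor_tmul, LinearMap.mul'_apply, TensorProduct.equivFinsuppOfBasisLeft_apply]
    exact 𝔞.mul_mem_left _ (hx _)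
  by_contra h0
  refine h𝔞 ((Ideal.eq_top_iff_one _).2 ?_)
  have := 𝔞.mul_mem_left (algebraMap k H (counit (R := k) x)⁻¹) hmem
  rwa [← map_mul, inv_mul_cancel₀ h0, map_one] at this

theorem eq_zero_of_wind_mem {C : Set (H →ₗ[k] k)} (hC : ∀ x, (∀ f ∈ C, f x = 0) → x = 0)
    {𝔞 : Ideal H} (h𝔞 : 𝔞 ≠ ⊤) {x : H} (hx : ∀ f ∈ C, wind f x ∈ 𝔞) : x = 0 := by
  rw [← Module.forall_dual_apply_eq_zero_iff k]
  intro f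
  rw [← counit_wind]
  refine counit_eq_zero_of_wind_mem h𝔞 fun ℓ => ?_
  rw [wind_wind]
  exact wind_mem_of_separating hC 𝔞 hx _

end Separation

section Family

variable {k H : Type u} [Field k] [Ring H] [HopfAlgebra k H]

section Sum

variable {ι₁ ι₂ : Type} [Fintype ι₁] [DecidableEq ι₁] [Fintype ι₂] [DecidableEq ι₂]

/-- The direct sum of two representations. -/
def sumRep (ρ₁ : H →ₐ[k] Matrix ι₁ ι₁ k) (ρ₂ : H →ₐ[k] Matrix ι₂ ι₂ k) :
    H →ₐ[k] Matrix (ι₁ ⊕ ι₂) (ι₁ ⊕ ι₂) k where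
  toFun h := Matrix.fromBlocks (ρ₁ h) 0 0 (ρ₂ h)
  map_one' := by simp
  map_mul' a b := by simp [Matrix.fromBlocks_multiply]
  map_zero' := by simp
  map_add' a b := by simp [Matrix.fromBlocks_add]
  commutes' c := by
    ext (i | i) (j | j) <;> simp [Matrix.algebraMap_matrix_apply]

end Sum

theorem isGoodFamily_repFamily (hS : Function.Bijective (HopfAlgebra.antipode k : H →ₗ[k] H))
    (hsep : ∀ x : H, x ≠ 0 → ∃ (n : ℕ) (ρ : H →ₐ[k] Matrix (Fin n) (Fin n) k), ρ x ≠ 0) :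
    IsGoodFamily (repFamily hS) where
  nonempty := ⟨_, repTriple_mem hS (ι := Unit)
    ((Matrix.scalarAlgHom Unit k).comp (Bialgebra.counitAlgHom k H))⟩
  directed := by
    rintro _ ⟨ι₁, _, _, ρ₁, rfl⟩ _ ⟨ι₂, _, _, ρ₂, rfl⟩
    exact ⟨_, repTriple_mem hS (sumRep ρ₁ ρ₂), ⟨Sum.inl, fun x i j => ⟨rfl, rfl⟩⟩,
      ⟨Sum.inr, fun x i j => ⟨rfl, rfl⟩⟩⟩
  faithful₀ := fun 𝔞 _ h𝔞 x hx => by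
    refine eq_zero_of_wind_mem (k := k) (C := {f | ∃ (n : ℕ)
      (ρ : H →ₐ[k] Matrix (Fin n) (Fin n) k) (i j : Fin n), f = coeff ρ i j})
      (fun y hy => ?_) h𝔞 ?_
    · by_contra h0
      obtain ⟨n, ρ, h⟩ := hsep y h0
      exact h (Matrix.ext fun i j => hy _ ⟨n, ρ, i, j, rfl⟩)
    · rintro _ ⟨n, ρ, i, j, rfl⟩
      exact hx _ (repTriple_mem hS ρ) i j
  faithful₂ := fun 𝔞 _ h𝔞 x hx => by
    refine eq_zero_of_wind_mem (k := k) (C := {f | ∃ (n : ℕ)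
      (ρ : H →ₐ[k] Matrix (Fin n) (Fin n) k) (i j : Fin n),
      f = coeff (dualRep hS (dualRep hS ρ)) i j}) (fun y hy => ?_) h𝔞 ?_
    · by_contra h0
      have h1 : antipodeInv hS (antipodeInv hS y) ≠ 0 := fun h => h0 <|
        antipodeInv_injective hS <| antipodeInv_injective hS <| by simpa using h
      obtain ⟨n, ρ, h⟩ := hsep _ h1
      exact h (Matrix.ext fun i j => hy _ ⟨n, ρ, i, j, rfl⟩)
    · rintro _ ⟨n, ρ, i, j, rfl⟩
      exact hx _ (repTriple_mem hS ρ) i j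

end Family

section Main

variable {k A : Type u} [Field k] [Ring A] [Algebra k A]

/-- The opposite form of `isRegular_of_minReg`. -/
theorem isRegular_of_minReg_op [IsNoetherianRing A] [IsNoetherianRing Aᵐᵒᵖ]
    (hfin : Algebra.FiniteType k A) (hPI : SatisfiesPolynomialIdentity k A)
    {𝓕 : Set (DualTriple A)} (h𝓕 : IsGoodFamily 𝓕)
    (hlin₀ : ∀ T ∈ 𝓕, ∀ c : k, T.φ₀ (algebraMap k A c) = algebraMap k _ c)
    (hlin₂ : ∀ T ∈ 𝓕, ∀ c : k, T.φ₂ (algebraMap k A c) = algebraMap k _ c)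
    {t : Aᵐᵒᵖ} (ht : t ∈ minReg Aᵐᵒᵖ) : IsRegular t := by
  have : IsNoetherianRing Aᵐᵒᵖᵐᵒᵖ := isNoetherianRing_of_ringEquiv A (RingEquiv.opOp A)
  refine isRegular_of_minReg (k := k) (finiteType_op hfin) (satisfiesPolynomialIdentity_op hPI)
    h𝓕.op ?_ ?_ ht
  · rintro _ ⟨T, hT, rfl⟩ c
    exact opTwist_algebraMap (hlin₂ T hT c)
  · rintro _ ⟨T, hT, rfl⟩ c
    exact opTwist_algebraMap (hlin₀ T hT c)

/-- A noetherian affine PI algebra with a good family of twists has a quasi-Frobenius ring of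
fractions. -/
theorem exists_quasiFrobenius_fractions [Nontrivial A] [IsNoetherianRing A] [IsNoetherianRing Aᵐᵒᵖ]
    (hfin : Algebra.FiniteType k A) (hPI : SatisfiesPolynomialIdentity k A)
    {𝓕 : Set (DualTriple A)} (h𝓕 : IsGoodFamily 𝓕)
    (hlin₀ : ∀ T ∈ 𝓕, ∀ c : k, T.φ₀ (algebraMap k A c) = algebraMap k _ c)
    (hlin₂ : ∀ T ∈ 𝓕, ∀ c : k, T.φ₂ (algebraMap k A c) = algebraMap k _ c) :
    (∀ (a s : A), IsRegular s → ∃ (b t : A), IsRegular t ∧ t * a = b * s) ∧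
    (∀ (a s : A), IsRegular s → ∃ (b t : A), IsRegular t ∧ a * t = s * b) ∧
    ∃ (Q : Type u) (_ : Ring Q) (f : A →+* Q), IsFrac f ∧
      IsArtinianRing Q ∧ IsArtinianRing Qᵐᵒᵖ ∧
      Module.Injective Q Q ∧ Module.Injective Qᵐᵒᵖ Qᵐᵒᵖ := by
  have : IsNoetherianRing Aᵐᵒᵖᵐᵒᵖ := isNoetherianRing_of_ringEquiv A (RingEquiv.opOp A)
  have hreg : ∀ t ∈ minReg A, IsRegular t := fun t ht =>
    isRegular_of_minReg hfin hPI h𝓕 hlin₀ hlin₂ ht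
  have hreg' : ∀ t ∈ minReg Aᵐᵒᵖ, IsRegular t := fun t ht =>
    isRegular_of_minReg_op hfin hPI h𝓕 hlin₀ hlin₂ ht
  have hl : ∀ (a s : A), IsRegular s → ∃ (b t : A), IsRegular t ∧ t * a = b * s := fun a s hs => by
    obtain ⟨b, t, ht, h⟩ := exists_mul_eq_mul a s hs
    exact ⟨b, t, hreg t ht, h⟩
  have hr : ∀ (a s : A), IsRegular s → ∃ (b t : A), IsRegular t ∧ a * t = s * b := fun a s hs => by
    obtain ⟨b, t, ht, h⟩ := exists_mul_eq_mul (MulOpposite.op a) (MulOpposite.op s)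
      (isRegular_op.2 hs)
    exact ⟨b.unop, t.unop, isRegular_unop.2 (hreg' t ht), congrArg MulOpposite.unop h⟩
  obtain ⟨Q, _, f, hf⟩ := exists_isFrac hl hr
  have hQ : IsArtinianRing Q := isArtinianRing_of_fractions f
    (fun t ht => hf.isUnit t (hreg t ht)) fun q => by
      obtain ⟨a, s, hs, h⟩ := hf.left q
      exact ⟨a, s, hf.isUnit s hs, h⟩
  have hQ' : IsArtinianRing Qᵐᵒᵖ := isArtinianRing_of_fractions (RingHom.op f)
    (fun t ht => hf.op.isUnit t (hreg' t ht)) fun q => by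
      obtain ⟨a, s, hs, h⟩ := hf.op.left q
      exact ⟨a, s, hf.op.isUnit s hs, h⟩
  have : Nontrivial Q := hf.injective.nontrivial
  obtain ⟨T, h₀, h₂⟩ := hf.exists_irred h𝓕
  have : IsArtinianRing Qᵐᵒᵖᵐᵒᵖ := (RingEquiv.opOp Q).surjective.isArtinianRing
  exact ⟨hl, hr, Q, _, f, hf, hQ, hQ', injective_of_irred T.dual₀₁ T.dual₁₂ h₀ h₂,
    injective_of_irred T.dual₁₂.opTwist T.dual₀₁.opTwist h₂.opTwist h₀.opTwist⟩

end Main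

end WZ


theorem affine_noetherian_PI_hopf_has_quasiFrobenius_ring_of_fractions
    (k : Type u) [Field k] (H : Type u) [Ring H] [HopfAlgebra k H]
    (hS : Function.Bijective (HopfAlgebra.antipode k : H →ₗ[k] H))
    (haff : Algebra.FiniteType k H)
    (hnoeth : IsNoetherianRing H) (hnoeth' : IsNoetherianRing Hᵐᵒᵖ)
    (hPI : SatisfiesPolynomialIdentity k H) :
    -- the set of regular elements of `H` is a left Ore set …
    (∀ (a s : H), IsRegular s → ∃ (b t : H), IsRegular t ∧ t * a = b * s) ∧
    -- … and a right Ore set,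
    (∀ (a s : H), IsRegular s → ∃ (b t : H), IsRegular t ∧ a * t = s * b) ∧
    -- and the corresponding ring of fractions is quasi-Frobenius:
    ∃ (Q : Type u) (_ : Ring Q) (f : H →+* Q),
      Function.Injective f ∧
      (∀ s : H, IsRegular s → IsUnit (f s)) ∧
      (∀ q : Q, ∃ (a s : H), IsRegular s ∧ q * f s = f a) ∧
      (∀ q : Q, ∃ (a s : H), IsRegular s ∧ f s * q = f a) ∧
      IsArtinianRing Q ∧ IsArtinianRing Qᵐᵒᵖ ∧
      Module.Injective Q Q ∧ Module.Injective Qᵐᵒᵖ Qᵐᵒᵖ := by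
  have : Nontrivial H := (Bialgebra.counitAlgHom k H).toRingHom.domain_nontrivial
  obtain ⟨d, s, α, hs, hα, hv⟩ := WZ.exists_multilinear_identity hPI
  have hgood := WZ.isGoodFamily_repFamily hS fun x hx =>
    WZ.exists_algHom_matrix_ne_zero d s α hs hα hv x hx
  obtain ⟨hl, hr, Q, _, f, hf, hQ⟩ := WZ.exists_quasiFrobenius_fractions haff hPI hgood
    (by rintro _ ⟨ι, _, _, ρ, rfl⟩ c; exact WZ.repTwist_algebraMap _ c)
    (by rintro _ ⟨ι, _, _, ρ, rfl⟩ c; exact WZ.repTwist_algebraMap _ c)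
  exact ⟨hl, hr, Q, _, f, hf.injective, hf.isUnit, hf.right, hf.left, hQ⟩
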